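/- (Weak independence theorem) Let T be NSOP₂, and suppose a₁ ⫝^{K*}_M b₁, a₂ ⫝^{K*}_M b₂, a₁ ≡_M a₂, and tp(b₂/Mb₁) extends to a strong canonical coheir of tp(b₂/M). Then there exists a realization a of tp(a₁/Mb₁) ∪ tp(a₂/Mb₂) with a ⫝^{K*}_M b₁b₂. -/

import Mathlib

/- Common model-theoretic infrastructure for formalizing
   "NSOP₂ theories are NSOP₁" (arXiv:2206.08512).

   We work with a monster model `𝕄` of a complete theory: a sufficiently
   saturated and strongly homogeneous `L`-structure.  Tuples are functions
   `α → 𝕄`; sets of formulas with parameters are coded via `FmlP`. -/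

open FirstOrder Language

universe u v w

namespace NSOP2Paper

/-- A first-order formula in free variables `α ⊕ Fin n` together with an
`n`-tuple of parameters from `𝕄`. -/
abbrev FmlP (L : FirstOrder.Language.{u, u}) (𝕄 : Type u) (α : Type v) :=
  Σ n : ℕ, L.Formula (α ⊕ Fin n) × (Fin n → 𝕄)

/-- `a ≡_C b` : the tuples `a` and `b` satisfy the same formulas with
parameters from `C`. -/
def EqTpOver (L : FirstOrder.Language.{u, u}) {𝕄 : Type u} [L.Structure 𝕄] (C : Set 𝕄)
    {α : Type v} (a b : α → 𝕄) : Prop :=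
  ∀ (n : ℕ) (φ : L.Formula (α ⊕ Fin n)) (c : Fin n → 𝕄), (∀ i, c i ∈ C) →
    (φ.Realize (Sum.elim a c) ↔ φ.Realize (Sum.elim b c))

/-- `tp(a / C)` is finitely satisfiable in `Ms`: every formula over `C`
satisfied by `a` has a realization by a tuple from `Ms`. -/
def FinSatIn (L : FirstOrder.Language.{u, u}) {𝕄 : Type u} [L.Structure 𝕄] (Ms : Set 𝕄)
    {α : Type v} (a : α → 𝕄) (C : Set 𝕄) : Prop :=
  ∀ (n : ℕ) (φ : L.Formula (α ⊕ Fin n)) (c : Fin n → 𝕄), (∀ i, c i ∈ C) →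
    φ.Realize (Sum.elim a c) →
    ∃ m : α → 𝕄, (∀ i, m i ∈ Ms) ∧ φ.Realize (Sum.elim m c)

/-- `Ms` is the underlying set of a (small) elementary submodel of `𝕄`. -/
def IsElemSubmodel (L : FirstOrder.Language.{u, u}) {𝕄 : Type u} [L.Structure 𝕄] (Ms : Set 𝕄) : Prop :=
  ∃ S : L.ElementarySubstructure 𝕄, (S : Set 𝕄) = Ms

/-- A complete consistent global type (a complete type over the monster `𝕄`)
in variables `α`, coded as the set of formulas-with-parameters it contains. -/
structure GlobalType (L : FirstOrder.Language.{u, u}) (𝕄 : Type u) [L.Structure 𝕄] (α : Type v) where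
  carrier : Set (FmlP L 𝕄 α)
  consistent : ∀ t : Finset (FmlP L 𝕄 α), ↑t ⊆ carrier →
    ∃ a : α → 𝕄, ∀ p ∈ t, p.2.1.Realize (Sum.elim a p.2.2)
  complete : ∀ (n : ℕ) (φ : L.Formula (α ⊕ Fin n)) (c : Fin n → 𝕄),
    (⟨n, (φ, c)⟩ : FmlP L 𝕄 α) ∈ carrier ∨ (⟨n, (φ.not, c)⟩ : FmlP L 𝕄 α) ∈ carrier

variable {L : FirstOrder.Language.{u, u}} {𝕄 : Type u} [L.Structure 𝕄]

/-- The global type `q` is finitely satisfiable in `Ms` (i.e. it is a coheir of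
its restriction to `Ms`). -/
def GlobalType.FinSatInM {α : Type v} (q : GlobalType L 𝕄 α) (Ms : Set 𝕄) : Prop :=
  ∀ t : Finset (FmlP L 𝕄 α), ↑t ⊆ q.carrier →
    ∃ m : α → 𝕄, (∀ i, m i ∈ Ms) ∧ ∀ p ∈ t, p.2.1.Realize (Sum.elim m p.2.2)

/-- `a ⊨ q|_C` : the tuple `a` realizes the restriction of the global type `q`
to parameters from `C`. -/
def RealizesType {α : Type v} (q : GlobalType L 𝕄 α) (a : α → 𝕄) (C : Set 𝕄) : Prop :=
  ∀ (n : ℕ) (φ : L.Formula (α ⊕ Fin n)) (c : Fin n → 𝕄), (∀ i, c i ∈ C) →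
    (⟨n, (φ, c)⟩ : FmlP L 𝕄 α) ∈ q.carrier → φ.Realize (Sum.elim a c)

/-- The global type `q` extends `tp(a / C)`. -/
def ExtendsTpOver {α : Type v} (q : GlobalType L 𝕄 α) (C : Set 𝕄) (a : α → 𝕄) : Prop :=
  ∀ (n : ℕ) (φ : L.Formula (α ⊕ Fin n)) (c : Fin n → 𝕄), (∀ i, c i ∈ C) →
    φ.Realize (Sum.elim a c) → (⟨n, (φ, c)⟩ : FmlP L 𝕄 α) ∈ q.carrier

/-- `B` is a coheir Morley sequence over `Ms` in the global type `q`: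
`q` is finitely satisfiable in `Ms` and `B i ⊨ q|_(Ms ∪ B_{<i})`. -/
def MorleyIn {α : Type v} (q : GlobalType L 𝕄 α) (Ms : Set 𝕄) (B : ℕ → α → 𝕄) : Prop :=
  q.FinSatInM Ms ∧
    ∀ i : ℕ, RealizesType q (B i) (Ms ∪ ⋃ (j : ℕ) (_ : j < i), Set.range (B j))

/-- `B` is a coheir Morley sequence over `Ms`. -/
def CoheirMorley (L : FirstOrder.Language.{u, u}) {𝕄 : Type u} [L.Structure 𝕄] (Ms : Set 𝕄)
    {α : Type v} (B : ℕ → α → 𝕄) : Prop :=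
  ∃ q : GlobalType L 𝕄 α, MorleyIn q Ms B

/-- Flatten an `ℕ`-indexed sequence of `α`-tuples into a single tuple. -/
def flatSeq {α : Type v} (I : ℕ → α → 𝕄) : ℕ × α → 𝕄 := fun p => I p.1 p.2

/-- The sequence `I` is indiscernible over `C`. -/
def IndiscernibleOver (L : FirstOrder.Language.{u, u}) {𝕄 : Type u} [L.Structure 𝕄] (C : Set 𝕄)
    {α : Type v} (I : ℕ → α → 𝕄) : Prop :=
  ∀ (n : ℕ) (f g : Fin n → ℕ), StrictMono f → StrictMono g →
    EqTpOver L C (fun p : Fin n × α => I (f p.1) p.2) (fun p : Fin n × α => I (g p.1) p.2)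

/-- `𝕄` is `κ`-saturated: every finitely satisfiable set of formulas in fewer
than `κ` variables over a parameter set of size `< κ` is realized in `𝕄`. -/
def IsSaturated (L : FirstOrder.Language.{u, u}) (𝕄 : Type u) [L.Structure 𝕄] (κ : Cardinal.{u}) : Prop :=
  ∀ (α : Type u) (A : Set 𝕄), Cardinal.mk α < κ → Cardinal.mk A < κ →
    ∀ Γ : Set (FmlP L 𝕄 α), (∀ p ∈ Γ, ∀ i, p.2.2 i ∈ A) →
      (∀ t : Finset (FmlP L 𝕄 α), ↑t ⊆ Γ →
        ∃ a : α → 𝕄, ∀ p ∈ t, p.2.1.Realize (Sum.elim a p.2.2)) →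
      ∃ a : α → 𝕄, ∀ p ∈ Γ, p.2.1.Realize (Sum.elim a p.2.2)

/-- `𝕄` is strongly `κ`-homogeneous: partial elementary maps between tuples of
length `< κ` extend to automorphisms of `𝕄`. -/
def IsStronglyHomogeneous (L : FirstOrder.Language.{u, u}) (𝕄 : Type u) [L.Structure 𝕄]
    (κ : Cardinal.{u}) : Prop :=
  ∀ (α : Type u), Cardinal.mk α < κ → ∀ a b : α → 𝕄, EqTpOver L (∅ : Set 𝕄) a b →
    ∃ σ : 𝕄 ≃[L] 𝕄, ∀ i, σ (a i) = b i

/-- `𝕄` is a monster model (for smallness degree `κ`): sufficiently saturated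
and strongly homogeneous. -/
def IsMonster (L : FirstOrder.Language.{u, u}) (𝕄 : Type u) [L.Structure 𝕄] (κ : Cardinal.{u}) : Prop :=
  Cardinal.aleph0 < κ ∧ IsSaturated L 𝕄 κ ∧ IsStronglyHomogeneous L 𝕄 κ

/-! ### Tree combinatorics -/

/-- The meet (longest common prefix) of two finite sequences. -/
def meet {A : Type w} [DecidableEq A] : List A → List A → List A
  | a :: as, b :: bs => if a = b then a :: meet as bs else []
  | _, _ => []

/-- The meet of `η 0, …, η i`. -/
def combMeet {A : Type w} [DecidableEq A] {k : ℕ} (η : Fin k → List A) (i : Fin k) : List A :=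
  (List.ofFn fun j : Fin i.val => η (Fin.castLE i.2.le j)).foldl meet (η i)

/-- `η 0, …, η (k-1)` is a descending comb: a lexicographically increasing
antichain such that the meet of `η 0, …, η (i+1)` is a proper initial segment
of the meet of `η 0, …, η i`. -/
def DescendingComb {A : Type w} [DecidableEq A] [LT A] {k : ℕ} (η : Fin k → List A) : Prop :=
  (∀ i j : Fin k, i ≠ j → ¬ η i <+: η j) ∧
  (∀ i j : Fin k, i < j → List.Lex (· < ·) (η i) (η j)) ∧
  (∀ (i : ℕ) (h : i + 1 < k),
    combMeet η ⟨i + 1, h⟩ <+: combMeet η ⟨i, by omega⟩ ∧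
    combMeet η ⟨i + 1, h⟩ ≠ combMeet η ⟨i, by omega⟩)

/-! ### Tree properties of theories (witnessed in the monster model) -/

/-- `T = Th(𝕄)` has `SOP₁`. -/
def HasSOP1 (L : FirstOrder.Language.{u, u}) (𝕄 : Type u) [L.Structure 𝕄] : Prop :=
  ∃ (k m : ℕ) (φ : L.Formula (Fin k ⊕ Fin m)) (b : List Bool → Fin m → 𝕄),
    (∀ σ : ℕ → Bool, ∃ a : Fin k → 𝕄,
      ∀ n : ℕ, φ.Realize (Sum.elim a (b (List.ofFn fun i : Fin n => σ i)))) ∧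
    ∀ η₁ η₂ : List Bool, (η₁ ++ [false]) <+: η₂ →
      ¬ ∃ a : Fin k → 𝕄, φ.Realize (Sum.elim a (b η₂)) ∧
        φ.Realize (Sum.elim a (b (η₁ ++ [true])))

/-- `T = Th(𝕄)` has `SOP₂`. -/
def HasSOP2 (L : FirstOrder.Language.{u, u}) (𝕄 : Type u) [L.Structure 𝕄] : Prop :=
  ∃ (k m : ℕ) (φ : L.Formula (Fin k ⊕ Fin m)) (b : List Bool → Fin m → 𝕄),
    (∀ σ : ℕ → Bool, ∃ a : Fin k → 𝕄,
      ∀ n : ℕ, φ.Realize (Sum.elim a (b (List.ofFn fun i : Fin n => σ i)))) ∧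
    ∀ η₁ η₂ : List Bool, ¬ η₁ <+: η₂ → ¬ η₂ <+: η₁ →
      ¬ ∃ a : Fin k → 𝕄, φ.Realize (Sum.elim a (b η₁)) ∧ φ.Realize (Sum.elim a (b η₂))

/-- `T = Th(𝕄)` has `k`-`DCTP₁`: paths are consistent but descending combs of
size `k` are inconsistent. -/
def HasKDCTP1 (L : FirstOrder.Language.{u, u}) (𝕄 : Type u) [L.Structure 𝕄] (k : ℕ) : Prop :=
  ∃ (r m : ℕ) (φ : L.Formula (Fin r ⊕ Fin m)) (b : List ℕ → Fin m → 𝕄),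
    (∀ σ : ℕ → ℕ, ∃ a : Fin r → 𝕄,
      ∀ n : ℕ, φ.Realize (Sum.elim a (b (List.ofFn fun i : Fin n => σ i)))) ∧
    ∀ η : Fin k → List ℕ, DescendingComb η →
      ¬ ∃ a : Fin r → 𝕄, ∀ i, φ.Realize (Sum.elim a (b (η i)))

/-- `T = Th(𝕄)` has weak `k`-`TP₁`: paths are consistent but any `k` pairwise
incomparable nodes with common pairwise meet are inconsistent. -/
def HasWeakKTP1 (L : FirstOrder.Language.{u, u}) (𝕄 : Type u) [L.Structure 𝕄] (k : ℕ) : Prop :=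
  ∃ (r m : ℕ) (φ : L.Formula (Fin r ⊕ Fin m)) (b : List ℕ → Fin m → 𝕄),
    (∀ σ : ℕ → ℕ, ∃ a : Fin r → 𝕄,
      ∀ n : ℕ, φ.Realize (Sum.elim a (b (List.ofFn fun i : Fin n => σ i)))) ∧
    ∀ η : Fin k → List ℕ,
      (∀ i j, i ≠ j → ¬ η i <+: η j) →
      (∀ i j i' j' : Fin k, i ≠ j → i' ≠ j' → meet (η i) (η j) = meet (η i') (η j')) →
      ¬ ∃ a : Fin r → 𝕄, ∀ i, φ.Realize (Sum.elim a (b (η i)))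

/-- `T = Th(𝕄)` has `k`-`DCTP₂`: paths are `k`-inconsistent but descending
combs are consistent. -/
def HasKDCTP2 (L : FirstOrder.Language.{u, u}) (𝕄 : Type u) [L.Structure 𝕄] (k : ℕ) : Prop :=
  ∃ (r m : ℕ) (φ : L.Formula (Fin r ⊕ Fin m)) (b : List Bool → Fin m → 𝕄),
    (∀ σ : ℕ → Bool, ∀ s : Finset ℕ, s.card = k →
      ¬ ∃ a : Fin r → 𝕄, ∀ n ∈ s,
        φ.Realize (Sum.elim a (b (List.ofFn fun i : Fin n => σ i)))) ∧
    ∀ (l : ℕ) (η : Fin l → List Bool), DescendingComb η →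
      ∃ a : Fin r → 𝕄, ∀ i, φ.Realize (Sum.elim a (b (η i)))

/-! ### Kim-dividing and Conant-dividing, with respect to coheir Morley sequences -/

/-- `φ(x, b)` Kim-divides over `Ms`: some coheir Morley sequence over `Ms`
starting with `b` makes it inconsistent. -/
def KimDivides (L : FirstOrder.Language.{u, u}) {𝕄 : Type u} [L.Structure 𝕄] (Ms : Set 𝕄)
    {α : Type v} {n : ℕ} (φ : L.Formula (α ⊕ Fin n)) (b : Fin n → 𝕄) : Prop :=
  ∃ B : ℕ → Fin n → 𝕄, CoheirMorley L Ms B ∧ B 0 = b ∧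
    ¬ ∃ a : α → 𝕄, ∀ i, φ.Realize (Sum.elim a (B i))

/-- `φ(x, b)` Kim-forks over `Ms`: it implies a finite disjunction of formulas
Kim-dividing over `Ms`. -/
def KimForks (L : FirstOrder.Language.{u, u}) {𝕄 : Type u} [L.Structure 𝕄] (Ms : Set 𝕄)
    {α : Type v} {n : ℕ} (φ : L.Formula (α ⊕ Fin n)) (b : Fin n → 𝕄) : Prop :=
  ∃ (N : ℕ) (m : Fin N → ℕ) (ψ : ∀ j : Fin N, L.Formula (α ⊕ Fin (m j)))
    (c : ∀ j : Fin N, Fin (m j) → 𝕄),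
    (∀ j, KimDivides L Ms (ψ j) (c j)) ∧
    ∀ a : α → 𝕄, φ.Realize (Sum.elim a b) → ∃ j, (ψ j).Realize (Sum.elim a (c j))

/-- `φ(x, b)` Conant-divides over `Ms`: every coheir Morley sequence over `Ms`
starting with `b` makes it inconsistent. -/
def ConantDivides (L : FirstOrder.Language.{u, u}) {𝕄 : Type u} [L.Structure 𝕄] (Ms : Set 𝕄)
    {α : Type v} {n : ℕ} (φ : L.Formula (α ⊕ Fin n)) (b : Fin n → 𝕄) : Prop :=
  ∀ B : ℕ → Fin n → 𝕄, CoheirMorley L Ms B → B 0 = b →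
    ¬ ∃ a : α → 𝕄, ∀ i, φ.Realize (Sum.elim a (B i))

/-- `φ(x, b)` Conant-forks over `Ms`. -/
def ConantForks (L : FirstOrder.Language.{u, u}) {𝕄 : Type u} [L.Structure 𝕄] (Ms : Set 𝕄)
    {α : Type v} {n : ℕ} (φ : L.Formula (α ⊕ Fin n)) (b : Fin n → 𝕄) : Prop :=
  ∃ (N : ℕ) (m : Fin N → ℕ) (ψ : ∀ j : Fin N, L.Formula (α ⊕ Fin (m j)))
    (c : ∀ j : Fin N, Fin (m j) → 𝕄),
    (∀ j, ConantDivides L Ms (ψ j) (c j)) ∧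
    ∀ a : α → 𝕄, φ.Realize (Sum.elim a b) → ∃ j, (ψ j).Realize (Sum.elim a (c j))

/-- `a ⫝^{K*}_{Ms} b` : `tp(a/Ms b)` contains no formula Conant-forking
over `Ms`. -/
def ConantIndep (L : FirstOrder.Language.{u, u}) {𝕄 : Type u} [L.Structure 𝕄] (Ms : Set 𝕄)
    {α : Type v} {β : Type w} (a : α → 𝕄) (b : β → 𝕄) : Prop :=
  ∀ (n : ℕ) (φ : L.Formula (α ⊕ Fin n)) (d : Fin n → 𝕄),
    (∀ i, d i ∈ Ms ∪ Set.range b) → φ.Realize (Sum.elim a d) →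
    ¬ ConantForks L Ms φ d

/-! ### Abstract independence relations between sets over models -/

/-- An abstract ternary relation `A ⫝_M B` between subsets of `𝕄` over
(elementary submodels of) `𝕄`. -/
structure IndRel (L : FirstOrder.Language.{u, u}) (𝕄 : Type u) [L.Structure 𝕄] where
  rel : Set 𝕄 → Set 𝕄 → Set 𝕄 → Prop

/-- A set `S` of `α`-tuples is type-definable over `C`. -/
def TypeDefinableOver (L : FirstOrder.Language.{u, u}) {𝕄 : Type u} [L.Structure 𝕄] (C : Set 𝕄)
    {γ : Type v} (S : Set (γ → 𝕄)) : Prop :=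
  ∃ Γ : Set (FmlP L 𝕄 γ), (∀ p ∈ Γ, ∀ i, p.2.2 i ∈ C) ∧
    ∀ g : γ → 𝕄, g ∈ S ↔ ∀ p ∈ Γ, p.2.1.Realize (Sum.elim g p.2.2)

namespace IndRel


/-- Invariance under automorphisms of `𝕄`. -/
def Invariant (R : IndRel L 𝕄) : Prop :=
  ∀ (σ : 𝕄 ≃[L] 𝕄) (A Ms B : Set 𝕄), R.rel A Ms B →
    R.rel ((⇑σ) '' A) ((⇑σ) '' Ms) ((⇑σ) '' B)

/-- Monotonicity (on both sides). -/
def Mono (R : IndRel L 𝕄) : Prop :=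
  ∀ (A A' Ms B B' : Set 𝕄), IsElemSubmodel L Ms → R.rel A Ms B →
    Ms ⊆ A' → A' ⊆ A → Ms ⊆ B' → B' ⊆ B → R.rel A' Ms B'

/-- Existence: for `M ⊆ A, B` there is `A' ≡_M A` with `A' ⫝_M B`. -/
def Existence (R : IndRel L 𝕄) (κ : Cardinal.{u}) : Prop :=
  ∀ (Ms : Set 𝕄), IsElemSubmodel L Ms → Cardinal.mk Ms < κ →
    ∀ (α β : Type u), Cardinal.mk α < κ → Cardinal.mk β < κ →
      ∀ (a : α → 𝕄) (b : β → 𝕄),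
        ∃ a' : α → 𝕄, EqTpOver L Ms a' a ∧
          R.rel (Ms ∪ Set.range a') Ms (Ms ∪ Set.range b)

/-- Right extension. -/
def RightExt (R : IndRel L 𝕄) (κ : Cardinal.{u}) : Prop :=
  ∀ (Ms : Set 𝕄), IsElemSubmodel L Ms → Cardinal.mk Ms < κ →
    ∀ (α : Type u), Cardinal.mk α < κ → ∀ (a : α → 𝕄) (B C : Set 𝕄),
      Cardinal.mk B < κ → Cardinal.mk C < κ →
      R.rel (Set.range a) Ms B → B ⊆ C →
      ∃ a' : α → 𝕄, EqTpOver L B a' a ∧ R.rel (Set.range a') Ms C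

/-- Quasi-strong finite character: for complete types `p = tp(a₀/Ms)` and
`q = tp(b₀/Ms)`, the set of pairs of realizations `(a, b)` with `a ⫝_Ms b`
is type-definable over `Ms`. -/
def QSFC (R : IndRel L 𝕄) (κ : Cardinal.{u}) : Prop :=
  ∀ (Ms : Set 𝕄), IsElemSubmodel L Ms → Cardinal.mk Ms < κ →
    ∀ (α β : Type u), Cardinal.mk α < κ → Cardinal.mk β < κ →
      ∀ (a₀ : α → 𝕄) (b₀ : β → 𝕄),
        TypeDefinableOver L Ms {g : (α ⊕ β) → 𝕄 |
          EqTpOver L Ms (g ∘ Sum.inl) a₀ ∧ EqTpOver L Ms (g ∘ Sum.inr) b₀ ∧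
          R.rel (Set.range (g ∘ Sum.inl)) Ms (Set.range (g ∘ Sum.inr))}

/-- The coheir chain condition. -/
def CoheirChain (R : IndRel L 𝕄) (κ : Cardinal.{u}) : Prop :=
  ∀ (Ms : Set 𝕄), IsElemSubmodel L Ms → Cardinal.mk Ms < κ →
    ∀ (α β : Type u), Cardinal.mk α < κ → Cardinal.mk β < κ →
      ∀ (a : α → 𝕄) (b : β → 𝕄), R.rel (Set.range a) Ms (Set.range b) →
        ∀ I : ℕ → β → 𝕄, CoheirMorley L Ms I → I 0 = b →
          ∃ I' : ℕ → β → 𝕄, EqTpOver L Ms (flatSeq I') (flatSeq I) ∧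
            R.rel (Set.range a) Ms (⋃ i, Set.range (I' i)) ∧
            ∀ i, EqTpOver L (Ms ∪ Set.range a) (I' i) b

/-- `R` implies `⫝ʰ` : `A ⫝_M B` implies `tp(B / M A)` is finitely
satisfiable in `M`. -/
def StrongerThanH (R : IndRel L 𝕄) : Prop :=
  ∀ (A Ms B : Set 𝕄), IsElemSubmodel L Ms → R.rel A Ms B →
    FinSatIn L Ms (fun x : B => (x : 𝕄)) (Ms ∪ A)

end IndRel

/-- The axioms satisfied by the relations among which `⫝^CK` is weakest. -/
def GoodRel (R : IndRel L 𝕄) (κ : Cardinal.{u}) : Prop :=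
  R.StrongerThanH ∧ R.Invariant ∧ R.Mono ∧ R.Existence κ ∧ R.RightExt κ ∧ R.CoheirChain κ

/-- `R` is `⫝^CK` : the weakest relation implying `⫝ʰ` and satisfying
invariance, monotonicity, existence, right extension and the coheir chain
condition. -/
def IsCK (R : IndRel L 𝕄) (κ : Cardinal.{u}) : Prop :=
  GoodRel R κ ∧ ∀ R' : IndRel L 𝕄, GoodRel R' κ →
    ∀ A Ms B : Set 𝕄, R'.rel A Ms B → R.rel A Ms B

/-- `q` is a canonical global type over `Ms` (w.r.t. the relation `R = ⫝^CK`):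
whenever `c ⊨ q|_{Ms b}` we have `b ⫝^CK_{Ms} c`. -/
def IsCanonicalGlobal (R : IndRel L 𝕄) (κ : Cardinal.{u}) (Ms : Set 𝕄) {α : Type v}
    (q : GlobalType L 𝕄 α) : Prop :=
  ∀ (β : Type u), Cardinal.mk β < κ → ∀ (b : β → 𝕄) (c : α → 𝕄),
    RealizesType q c (Ms ∪ Set.range b) → R.rel (Set.range b) Ms (Set.range c)

/-- A canonical Morley sequence over `Ms`: a coheir Morley sequence in a
canonical coheir. -/
def CanonicalMorley (R : IndRel L 𝕄) (κ : Cardinal.{u}) (Ms : Set 𝕄) {α : Type v}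
    (I : ℕ → α → 𝕄) : Prop :=
  ∃ q : GlobalType L 𝕄 α, IsCanonicalGlobal R κ Ms q ∧ MorleyIn q Ms I

/-- `q` is a strong canonical global type over `Ms`. -/
def IsStrongCanonical (R : IndRel L 𝕄) (κ : Cardinal.{u}) (Ms : Set 𝕄) {α : Type v}
    (q : GlobalType L 𝕄 α) : Prop :=
  ∀ (β : Type u), Cardinal.mk β < κ → ∀ (b : β → 𝕄) (c : α → 𝕄),
    RealizesType q c (Ms ∪ Set.range b) →
    ∀ (γ : Type u), Cardinal.mk γ < κ → ∀ (a : γ → 𝕄),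
      ∃ a' : γ → 𝕄, EqTpOver L (Ms ∪ Set.range c) a' a ∧
        ∃ q' : GlobalType L 𝕄 (γ ⊕ α), IsCanonicalGlobal R κ Ms q' ∧
          ExtendsTpOver q' (Ms ∪ Set.range b) (Sum.elim a' c)

/-! ### `M`-invariant ideals and `𝓘`-Kim-dividing -/

/-- An `Ms`-invariant ideal on the definable subsets of `𝕄` (in variables `α`). -/
structure InvIdeal (L : FirstOrder.Language.{u, u}) (𝕄 : Type u) [L.Structure 𝕄] (Ms : Set 𝕄)
    (α : Type v) where
  mem : Set (α → 𝕄) → Prop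
  definable_of_mem : ∀ S, mem S → ∃ (n : ℕ) (ψ : L.Formula (α ⊕ Fin n)) (c : Fin n → 𝕄),
    S = {a : α → 𝕄 | ψ.Realize (Sum.elim a c)}
  union_mem : ∀ S T, mem S → mem T → mem (S ∪ T)
  subset_mem : ∀ S T, mem S →
    (∃ (n : ℕ) (ψ : L.Formula (α ⊕ Fin n)) (c : Fin n → 𝕄),
      T = {a : α → 𝕄 | ψ.Realize (Sum.elim a c)}) →
    T ⊆ S → mem T
  invariant : ∀ σ : 𝕄 ≃[L] 𝕄, (∀ x ∈ Ms, σ x = x) → ∀ S, mem S →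
    mem ((fun a => (⇑σ) ∘ a) '' S)

/-- `φ(x, b)` `𝓘`-Kim-divides over `Ms`. -/
def IKimDivides {Ms : Set 𝕄} {α : Type v} (I : InvIdeal L 𝕄 Ms α) {n : ℕ}
    (φ : L.Formula (α ⊕ Fin n)) (b : Fin n → 𝕄) : Prop :=
  ∃ (B : ℕ → Fin n → 𝕄) (k : ℕ), CoheirMorley L Ms B ∧ B 0 = b ∧ 0 < k ∧
    ∀ s : Finset ℕ, s.card = k →
      I.mem {a : α → 𝕄 | ∀ i ∈ s, φ.Realize (Sum.elim a (B i))}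

/-- `φ(x, b)` `𝓘`-Kim-forks over `Ms`. -/
def IKimForks {Ms : Set 𝕄} {α : Type v} (I : InvIdeal L 𝕄 Ms α) {n : ℕ}
    (φ : L.Formula (α ⊕ Fin n)) (b : Fin n → 𝕄) : Prop :=
  ∃ (N : ℕ) (m : Fin N → ℕ) (ψ : ∀ j : Fin N, L.Formula (α ⊕ Fin (m j)))
    (c : ∀ j : Fin N, Fin (m j) → 𝕄),
    (∀ j, IKimDivides I (ψ j) (c j)) ∧
    ∀ a : α → 𝕄, φ.Realize (Sum.elim a b) → ∃ j, (ψ j).Realize (Sum.elim a (c j))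

/-- `φ(x, b)` `𝓘`-quasi-divides over `Ms`. -/
def IQuasiDivides {Ms : Set 𝕄} {α : Type v} (I : InvIdeal L 𝕄 Ms α) {n : ℕ}
    (φ : L.Formula (α ⊕ Fin n)) (b : Fin n → 𝕄) : Prop :=
  ∃ (mm : ℕ) (b' : Fin mm → Fin n → 𝕄), 0 < mm ∧ (∀ j, EqTpOver L Ms (b' j) b) ∧
    I.mem {a : α → 𝕄 | ∀ j, φ.Realize (Sum.elim a (b' j))}

/-! ### `h^⫝`-inconsistency and the derived relation `⫝'` -/

/-- A family of formulas is `h^⫝`-inconsistent with respect to `P = tp(a₀/Ms)`. -/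
def HInconsistent (R : IndRel L 𝕄) (Ms : Set 𝕄) {α : Type v} (a₀ : α → 𝕄)
    {ι : Type w} (m : ι → ℕ) (φ : ∀ i : ι, L.Formula (α ⊕ Fin (m i)))
    (b : ∀ i : ι, Fin (m i) → 𝕄) : Prop :=
  ¬ ∃ a : α → 𝕄, EqTpOver L Ms a a₀ ∧
      R.rel (Set.range a) Ms (⋃ i, Set.range (b i)) ∧
      ∀ i, (φ i).Realize (Sum.elim a (b i))

/-- A single formula is `h^⫝`-inconsistent with respect to `P = tp(a₀/Ms)`. -/
def HInconsistentSingle (R : IndRel L 𝕄) (Ms : Set 𝕄) {α : Type v} (a₀ : α → 𝕄)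
    {n : ℕ} (φ : L.Formula (α ⊕ Fin n)) (b : Fin n → 𝕄) : Prop :=
  ¬ ∃ a : α → 𝕄, EqTpOver L Ms a a₀ ∧ R.rel (Set.range a) Ms (Set.range b) ∧
      φ.Realize (Sum.elim a b)

/-- `φ(x, b)` `h^⫝`-Kim-divides with respect to `tp(a₀/Ms)`. -/
def HKimDivides (R : IndRel L 𝕄) (Ms : Set 𝕄) {α : Type v} (a₀ : α → 𝕄)
    {n : ℕ} (φ : L.Formula (α ⊕ Fin n)) (b : Fin n → 𝕄) : Prop :=
  ∃ B : ℕ → Fin n → 𝕄, CoheirMorley L Ms B ∧ B 0 = b ∧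
    HInconsistent R Ms a₀ (fun _ : ℕ => n) (fun _ => φ) B

/-- `φ(x, b)` `h^⫝`-Kim-forks with respect to `tp(a₀/Ms)`. -/
def HKimForks (R : IndRel L 𝕄) (Ms : Set 𝕄) {α : Type v} (a₀ : α → 𝕄)
    {n : ℕ} (φ : L.Formula (α ⊕ Fin n)) (b : Fin n → 𝕄) : Prop :=
  ∃ (N : ℕ) (m : Fin N → ℕ) (ψ : ∀ j : Fin N, L.Formula (α ⊕ Fin (m j)))
    (c : ∀ j : Fin N, Fin (m j) → 𝕄),
    (∀ j, HKimDivides R Ms a₀ (ψ j) (c j)) ∧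
    ∀ a : α → 𝕄, φ.Realize (Sum.elim a b) → ∃ j, (ψ j).Realize (Sum.elim a (c j))

/-- `φ(x, b)` `h^⫝`-quasi-divides with respect to `tp(a₀/Ms)`. -/
def HQuasiDivides (R : IndRel L 𝕄) (Ms : Set 𝕄) {α : Type v} (a₀ : α → 𝕄)
    {n : ℕ} (φ : L.Formula (α ⊕ Fin n)) (b : Fin n → 𝕄) : Prop :=
  ∃ (mm : ℕ) (b' : Fin mm → Fin n → 𝕄), 0 < mm ∧ (∀ j, EqTpOver L Ms (b' j) b) ∧
    HInconsistent R Ms a₀ (fun _ : Fin mm => n) (fun _ => φ) b'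

/-- The derived relation `⫝'` on tuples:
`tp(a / Ms b)` contains no formula `h^⫝`-Kim-forking w.r.t. `tp(a/Ms)`. -/
def DerivedIndep (R : IndRel L 𝕄) (Ms : Set 𝕄) {α : Type v} {β : Type w}
    (a : α → 𝕄) (b : β → 𝕄) : Prop :=
  ∀ (n : ℕ) (φ : L.Formula (α ⊕ Fin n)) (d : Fin n → 𝕄),
    (∀ i, d i ∈ Ms ∪ Set.range b) → φ.Realize (Sum.elim a d) →
    ¬ HKimForks R Ms a φ d

/-- The derived relation `⫝'` as a relation between sets over models. -/
def derived (R : IndRel L 𝕄) : IndRel L 𝕄 where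
  rel A Ms B := ∀ (n : ℕ) (φ : L.Formula (↥A ⊕ Fin n)) (d : Fin n → 𝕄),
    (∀ i, d i ∈ Ms ∪ B) → φ.Realize (Sum.elim (fun x : A => (x : 𝕄)) d) →
    ¬ HKimForks R Ms (fun x : A => (x : 𝕄)) φ d

/-! ### Coheir trees -/

/-- The tuple, indexed by extensions, consisting of the part of the tree `c`
lying (weakly) above the node `ν` (where `ν` has length `Lh`). -/
def subtreeTupleLen {α : Type v} {n : ℕ} (c : {l : List ℕ // l.length ≤ n} → α → 𝕄)
    (Lh : ℕ) (ν : List ℕ) (hν : ν.length = Lh) :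
    ({s : List ℕ // Lh + s.length ≤ n} × α) → 𝕄 :=
  fun p => c ⟨ν ++ p.1.1, by rw [List.length_append, hν]; exact p.1.2⟩ p.2

end NSOP2Paper

universe x

namespace NSOP2Paper

section Definability

variable {L : FirstOrder.Language.{u, u}} {𝕄 : Type u} [L.Structure 𝕄]
  {α : Type v} {β : Type w}

theorem definable_of_formula {C : Set 𝕄} {n : ℕ} (φ : L.Formula (α ⊕ Fin n)) (c : Fin n → 𝕄)
    (hc : ∀ i, c i ∈ C) : C.Definable L {a : α → 𝕄 | φ.Realize (Sum.elim a c)} := by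
  rw [Set.definable_iff_exists_formula_sum]
  refine ⟨φ.relabel (Sum.elim Sum.inr fun i => Sum.inl ⟨c i, hc i⟩), ?_⟩
  ext a
  simp only [Formula.realize_relabel, Set.mem_ofPred_eq]
  congr! 1
  funext i
  rcases i with i | i <;> rfl

theorem exists_formula_of_definable {C : Set 𝕄} {S : Set (α → 𝕄)} (h : C.Definable L S) :
    ∃ (n : ℕ) (φ : L.Formula (α ⊕ Fin n)) (c : Fin n → 𝕄), (∀ i, c i ∈ C) ∧
      ∀ a, a ∈ S ↔ φ.Realize (Sum.elim a c) := by
  rw [Set.definable_iff_finitely_definable] at h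
  obtain ⟨A, hA, h⟩ := h
  rw [Set.definable_iff_exists_formula_sum] at h
  obtain ⟨φ, rfl⟩ := h
  refine ⟨A.card, φ.relabel (Sum.elim (fun x => Sum.inr (A.equivFin x)) Sum.inl),
    fun i => (A.equivFin.symm i : 𝕄), fun i => hA (A.equivFin.symm i).2, fun a => ?_⟩
  simp only [Formula.realize_relabel, Set.mem_ofPred_eq]
  congr! 1
  funext i
  rcases i with i | i
  · simp only [Function.comp, Sum.elim_inl, Sum.elim_inr]
    exact congrArg Subtype.val (A.equivFin.symm_apply_apply i).symm
  · rfl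

theorem eqTpOver_iff {C : Set 𝕄} {a b : α → 𝕄} :
    EqTpOver L C a b ↔ ∀ S : Set (α → 𝕄), C.Definable L S → (a ∈ S ↔ b ∈ S) := by
  constructor
  · intro h S hS
    obtain ⟨n, φ, c, hc, hφ⟩ := exists_formula_of_definable hS
    rw [hφ, hφ]
    exact h n φ c hc
  · intro h n φ c hc
    exact h _ (definable_of_formula φ c hc)

theorem finSatIn_iff {Ms C : Set 𝕄} {a : α → 𝕄} :
    FinSatIn L Ms a C ↔ ∀ S : Set (α → 𝕄), C.Definable L S → a ∈ S →
      ∃ m : α → 𝕄, (∀ i, m i ∈ Ms) ∧ m ∈ S := by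
  constructor
  · intro h S hS ha
    obtain ⟨n, φ, c, hc, hφ⟩ := exists_formula_of_definable hS
    obtain ⟨m, hm, hm'⟩ := h n φ c hc ((hφ a).1 ha)
    exact ⟨m, hm, (hφ m).2 hm'⟩
  · intro h n φ c hc ha
    exact h _ (definable_of_formula φ c hc) ha

theorem EqTpOver.refl {C : Set 𝕄} (a : α → 𝕄) : EqTpOver L C a a := fun _ _ _ _ => Iff.rfl

theorem EqTpOver.symm {C : Set 𝕄} {a b : α → 𝕄} (h : EqTpOver L C a b) : EqTpOver L C b a :=
  fun n φ c hc => (h n φ c hc).symm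

theorem EqTpOver.trans {C : Set 𝕄} {a b c : α → 𝕄} (h : EqTpOver L C a b)
    (h' : EqTpOver L C b c) : EqTpOver L C a c :=
  fun n φ d hd => (h n φ d hd).trans (h' n φ d hd)

theorem EqTpOver.mono {C D : Set 𝕄} {a b : α → 𝕄} (h : EqTpOver L D a b) (hCD : C ⊆ D) :
    EqTpOver L C a b :=
  fun n φ d hd => h n φ d fun i => hCD (hd i)

/-- Substituting variables and constants from `C` into a `C`-definable set. -/
theorem Definable.subst {C : Set 𝕄} {S : Set (α → 𝕄)} (hS : C.Definable L S) (t : α → β ⊕ 𝕄)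
    (ht : ∀ i c, t i = Sum.inr c → c ∈ C) :
    C.Definable L {x : β → 𝕄 | (fun i => Sum.elim x id (t i)) ∈ S} := by
  rw [Set.definable_iff_exists_formula_sum] at hS ⊢
  obtain ⟨φ, rfl⟩ := hS
  refine ⟨φ.relabel (Sum.elim Sum.inl fun i =>
    match h : t i with
    | Sum.inl j => Sum.inr j
    | Sum.inr c => Sum.inl ⟨c, ht i c h⟩), ?_⟩
  ext x
  simp only [Formula.realize_relabel, Set.mem_ofPred_eq]
  congr! 1
  funext i
  rcases i with i | i
  · rfl
  · simp only [Sum.elim_inr, Function.comp]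
    split <;> rename_i h <;> simp [h]

theorem Definable.elim_const {C : Set 𝕄} {S : Set (α ⊕ β → 𝕄)} (hS : C.Definable L S) (b : β → 𝕄)
    (hb : ∀ i, b i ∈ C) : C.Definable L {x : α → 𝕄 | Sum.elim x b ∈ S} := by
  have := Definable.subst hS (Sum.elim Sum.inl fun i => Sum.inr (b i)) (by
    rintro (i | i) c h
    · simp at h
    · simp only [Sum.elim_inr, Sum.inr.injEq] at h
      exact h ▸ hb i)
  convert this using 1
  ext x
  simp only [Set.mem_ofPred_eq]
  congr! 1
  funext j
  rcases j with j | j <;> rfl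

theorem Definable.unparam {C : Set 𝕄} {S : Set (α → 𝕄)} {b : β → 𝕄}
    (hS : (C ∪ Set.range b).Definable L S) :
    ∃ S' : Set (α ⊕ β → 𝕄), C.Definable L S' ∧ ∀ x, x ∈ S ↔ Sum.elim x b ∈ S' := by
  classical
  rw [Set.definable_iff_exists_formula_sum] at hS
  obtain ⟨φ, rfl⟩ := hS
  have hb : ∀ x : ↥(C ∪ Set.range b), ∃ y : C ⊕ (α ⊕ β),
      ∀ a : α → 𝕄, Sum.elim (fun c : C => (c : 𝕄)) (Sum.elim a b) y = x := by
    rintro ⟨x, hx | ⟨j, rfl⟩⟩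
    · exact ⟨Sum.inl ⟨x, hx⟩, fun a => rfl⟩
    · exact ⟨Sum.inr (Sum.inr j), fun a => rfl⟩
  choose y hy using hb
  refine ⟨_, Set.definable_iff_exists_formula_sum.2
    ⟨φ.relabel (Sum.elim y fun i => Sum.inr (Sum.inl i)), rfl⟩, fun x => ?_⟩
  simp only [Formula.realize_relabel, Set.mem_ofPred_eq]
  congr! 1
  funext i
  rcases i with i | i
  · simp [hy]
  · rfl

theorem Definable.exists_finset {C : Set 𝕄} {S : Set (α → 𝕄)} (hS : C.Definable L S) :
    ∃ (F : Finset α) (S' : Set (F → 𝕄)), C.Definable L S' ∧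
      ∀ x, x ∈ S ↔ (fun i : F => x i) ∈ S' := by
  classical
  obtain ⟨φ, rfl⟩ := hS
  refine ⟨φ.freeVarFinset, _, ⟨φ.restrictFreeVar id, rfl⟩, fun x => ?_⟩
  exact (BoundedFormula.realize_restrictFreeVar x (by intro a; rfl)).symm

theorem definable_coord_eq {C : Set 𝕄} (i : α) {c : 𝕄} (hc : c ∈ C) :
    C.Definable L {x : α → 𝕄 | x i = c} := by
  have := (definable_of_formula (L := L) (α := α) (C := C) (n := 1)
    (Term.equal (Term.var (Sum.inl i)) (Term.var (Sum.inr 0))) (fun _ => c) (fun _ => hc))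
  convert this using 2
  simp [Formula.realize_equal]

/-- The projection of a definable set along an injection is definable. -/
theorem Definable.image_comp_of_injective [Nonempty 𝕄] {C : Set 𝕄} {S : Set (β → 𝕄)}
    (hS : C.Definable L S) {f : α → β} (hf : Function.Injective f) :
    C.Definable L ((fun x : β → 𝕄 => x ∘ f) '' S) := by
  classical
  obtain ⟨F, S', hS', h⟩ := Definable.exists_finset hS
  let G : Type v := {i : α // f i ∈ F}
  have : Finite G := Finite.of_injective (fun i : G => (⟨f i, i.2⟩ : F)) fun i j hij =>
    Subtype.ext (hf (congrArg Subtype.val hij))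
  have h1 := (hS'.image_comp (fun i : G => (⟨f i, i.2⟩ : F))).preimage_comp
    (fun i : G => (i : α))
  convert h1 using 1
  ext y
  constructor
  · rintro ⟨x, hx, rfl⟩
    exact ⟨_, (h x).1 hx, rfl⟩
  · rintro ⟨z, hz, hzy⟩
    let o : 𝕄 := Classical.arbitrary 𝕄
    refine ⟨fun j => if hj : j ∈ F then z ⟨j, hj⟩ else
      if hj : ∃ i, f i = j then y hj.choose else o, ?_, ?_⟩
    · rw [h]
      convert hz using 1
      funext i
      simp
    · funext i
      by_cases hi : f i ∈ F
      · have := congrFun hzy ⟨i, hi⟩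
        simp only [Function.comp] at this ⊢
        simp [hi, this]
      · have hex : ∃ i', f i' = f i := ⟨i, rfl⟩
        simp only [Function.comp, hi, hex, dite_true, dite_false]
        rw [hf hex.choose_spec]

theorem Definable.image_comp_of_finite [Nonempty 𝕄] [Finite α] {C : Set 𝕄} {S : Set (β → 𝕄)}
    (hS : C.Definable L S) (f : α → β) :
    C.Definable L ((fun x : β → 𝕄 => x ∘ f) '' S) := by
  classical
  have h1 := Definable.image_comp_of_injective hS (f := fun i : Set.range f => (i : β))
    Subtype.val_injective
  have h2 := h1.image_comp (Set.rangeFactorization f)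
  convert h2 using 1
  rw [Set.image_image]
  rfl

/-- Tarski–Vaught: a nonempty `Ms`-definable set contains a point of `Ms`, and coordinates already
in `Ms` may be kept. -/
theorem IsElemSubmodel.exists_mem {Ms : Set 𝕄} (hMs : IsElemSubmodel L Ms) {S : Set (α → 𝕄)}
    (hS : Ms.Definable L S) {x₀ : α → 𝕄} (hx₀ : x₀ ∈ S) :
    ∃ x ∈ S, (∀ i, x i ∈ Ms) ∧ ∀ i, x₀ i ∈ Ms → x i = x₀ i := by
  classical
  rcases isEmpty_or_nonempty α with hα | hα
  · exact ⟨x₀, hx₀, fun i => hα.elim i, fun i => hα.elim i⟩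
  have : Nonempty 𝕄 := ⟨x₀ hα.some⟩
  obtain ⟨F, S', hS', h⟩ := Definable.exists_finset hS
  let S'' : Set (F → 𝕄) := S' ∩ ⋂ i : {i : F // x₀ i ∈ Ms}, {y | y i.1 = x₀ i.1}
  have hS'' : Ms.Definable L S'' := hS'.inter
    (Set.definable_iInter_of_finite fun i => definable_coord_eq _ i.2)
  obtain ⟨N, rfl⟩ := hMs
  have hne : ∃ y ∈ S'', ∀ i, y i ∈ (N : Set 𝕄) := by
    obtain ⟨φ, hφ⟩ := Set.definable_iff_exists_formula_sum.1 hS''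
    have h0 : (φ.iExs F).Realize (fun c : (N : Set 𝕄) => (c : 𝕄)) := by
      rw [Formula.realize_iExs]
      refine ⟨fun i => x₀ i, ?_⟩
      have : (fun i : F => x₀ i) ∈ S'' := ⟨(h x₀).1 hx₀, by
        simp⟩
      rw [hφ] at this
      exact this
    have h1 : (φ.iExs F).Realize (fun c : (N : Set 𝕄) => (⟨c, c.2⟩ : N)) := by
      rw [← N.subtype.map_formula]
      exact h0
    rw [Formula.realize_iExs] at h1
    obtain ⟨y, hy⟩ := h1
    rw [← N.subtype.map_formula] at hy
    refine ⟨fun i => (y i : 𝕄), ?_, fun i => (y i).2⟩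
    rw [hφ]
    simp only [Set.mem_ofPred_eq]
    convert hy using 1
    funext i
    rcases i with i | i <;> rfl
  obtain ⟨y, ⟨hyS, hyeq⟩, hyM⟩ := hne
  have hN : (N : Set 𝕄).Nonempty := by
    have : Nonempty N := by
      by_contra hN
      have h3 := (N.subtype.map_formula (α := Empty)
        ((Term.equal (Term.var (Sum.inr ())) (Term.var (Sum.inr ())) : L.Formula (Empty ⊕ Unit)).iExs
          Unit) Empty.elim).1
      rw [Formula.realize_iExs, Formula.realize_iExs] at h3
      obtain ⟨i, -⟩ := h3 ⟨fun _ => Classical.arbitrary 𝕄, by simp [Formula.realize_equal]⟩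
      exact hN ⟨i ()⟩
    exact ⟨this.some, this.some.2⟩
  refine ⟨fun i => if hi : i ∈ F then y ⟨i, hi⟩ else if x₀ i ∈ (N : Set 𝕄) then x₀ i else hN.some,
    ?_, fun i => ?_, fun i hi => ?_⟩
  · rw [h]
    convert hyS using 1
    funext i
    simp
  · dsimp only
    split_ifs with h1 h2
    · exact hyM _
    · exact h2
    · exact hN.some_mem
  · dsimp only
    split_ifs with h1
    · exact Set.mem_iInter.1 hyeq ⟨⟨i, h1⟩, hi⟩
    · rfl

/-- Automorphisms transport definable sets. -/
theorem Definable.map_equiv {C : Set 𝕄} {S : Set (α → 𝕄)} (hS : C.Definable L S) (σ : 𝕄 ≃[L] 𝕄) :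
    (σ '' C).Definable L {x : α → 𝕄 | σ.symm ∘ x ∈ S} := by
  obtain ⟨n, φ, c, hc, hφ⟩ := exists_formula_of_definable hS
  have := definable_of_formula φ (σ ∘ c) (C := σ '' C) fun i => ⟨_, hc i, rfl⟩
  convert this using 1
  ext x
  simp only [Set.mem_ofPred_eq]
  rw [hφ, ← StrongHomClass.realize_formula σ φ]
  congr! 1
  funext i
  rcases i with i | i <;> simp [Function.comp]

theorem Definable.comap_equiv {C : Set 𝕄} {S : Set (α → 𝕄)} {σ : 𝕄 ≃[L] 𝕄}
    (hS : (σ '' C).Definable L S) : C.Definable L {x : α → 𝕄 | σ ∘ x ∈ S} := by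
  have := Definable.map_equiv hS σ.symm
  convert this using 1
  · rw [Set.image_image]
    simp
  · rfl

/-- Automorphisms fixing `C` preserve `C`-definable sets. -/
theorem Definable.mem_equiv_iff {C : Set 𝕄} {S : Set (α → 𝕄)} (hS : C.Definable L S)
    {σ : 𝕄 ≃[L] 𝕄} (hσ : ∀ x ∈ C, σ x = x) (a : α → 𝕄) : (σ ∘ a) ∈ S ↔ a ∈ S := by
  obtain ⟨n, φ, c, hc, hφ⟩ := exists_formula_of_definable hS
  rw [hφ, hφ, ← StrongHomClass.realize_formula σ φ (v := Sum.elim a c)]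
  congr! 1
  funext i
  rcases i with i | i <;> simp [Function.comp, hσ _ (hc _)]

end Definability


section Small

/-- `α` has fewer than `κ` elements; `α` may live in any universe. -/
def Small (κ : Cardinal.{u}) (α : Type v) : Prop :=
  ∃ β : Type u, Cardinal.mk β < κ ∧ ∃ f : α → β, Function.Injective f

variable {κ : Cardinal.{u}} {α : Type v} {β : Type w}

theorem Small.of_lt {α : Type u} (h : Cardinal.mk α < κ) : Small κ α :=
  ⟨α, h, id, Function.injective_id⟩

theorem Small.lt {α : Type u} (h : Small κ α) : Cardinal.mk α < κ := by
  obtain ⟨β, hβ, f, hf⟩ := h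
  exact (Cardinal.mk_le_of_injective hf).trans_lt hβ

theorem Small.of_injective (h : Small κ β) {f : α → β} (hf : Function.Injective f) :
    Small κ α := by
  obtain ⟨γ, hγ, g, hg⟩ := h
  exact ⟨γ, hγ, g ∘ f, hg.comp hf⟩

theorem Small.of_surjective (h : Small κ α) {f : α → β} (hf : Function.Surjective f) :
    Small κ β :=
  h.of_injective (Function.injective_surjInv hf)

theorem Small.range (h : Small κ α) (f : α → β) : Small κ (Set.range f) :=
  h.of_surjective Set.rangeFactorization_surjective

theorem Small.mono {A B : Set α} (h : Small κ B) (hAB : A ⊆ B) : Small κ A :=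
  h.of_injective (Set.inclusion_injective hAB)

theorem Small.sum (hκ : Cardinal.aleph0 < κ) (h : Small κ α) (h' : Small κ β) :
    Small κ (α ⊕ β) := by
  obtain ⟨γ, hγ, g, hg⟩ := h
  obtain ⟨δ, hδ, k, hk⟩ := h'
  refine ⟨γ ⊕ δ, ?_, Sum.map g k, hg.sumMap hk⟩
  rw [Cardinal.mk_sum, Cardinal.lift_id, Cardinal.lift_id]
  exact Cardinal.add_lt_of_lt hκ.le hγ hδ

theorem Small.prod (hκ : Cardinal.aleph0 < κ) (h : Small κ α) (h' : Small κ β) :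
    Small κ (α × β) := by
  obtain ⟨γ, hγ, g, hg⟩ := h
  obtain ⟨δ, hδ, k, hk⟩ := h'
  refine ⟨γ × δ, ?_, Prod.map g k, hg.prodMap hk⟩
  rw [Cardinal.mk_prod, Cardinal.lift_id, Cardinal.lift_id]
  exact Cardinal.mul_lt_of_lt hκ.le hγ hδ

theorem Small.of_countable (hκ : Cardinal.aleph0 < κ) (α : Type v) [Countable α] : Small κ α := by
  obtain ⟨f, hf⟩ := exists_injective_nat α
  exact ⟨ULift ℕ, by simpa using hκ, fun a => ⟨f a⟩, fun a b h => hf (by simpa using h)⟩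

theorem Small.union (hκ : Cardinal.aleph0 < κ) {A B : Set α} (h : Small κ A) (h' : Small κ B) :
    Small κ ↥(A ∪ B) := by
  refine (h.sum hκ h').of_surjective
    (f := Sum.elim (Set.inclusion Set.subset_union_left) (Set.inclusion Set.subset_union_right)) ?_
  rintro ⟨x, hx | hx⟩
  · exact ⟨Sum.inl ⟨x, hx⟩, rfl⟩
  · exact ⟨Sum.inr ⟨x, hx⟩, rfl⟩

theorem Small.exists_equiv (h : Small κ α) : ∃ β : Type u, Cardinal.mk β < κ ∧ Nonempty (α ≃ β) := by
  obtain ⟨γ, hγ, g, hg⟩ := h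
  exact ⟨Set.range g, (Cardinal.mk_le_of_injective Subtype.val_injective).trans_lt hγ,
    ⟨Equiv.ofInjective g hg⟩⟩

end Small

section Saturation

variable {L : FirstOrder.Language.{u, u}} {𝕄 : Type u} [L.Structure 𝕄] {κ : Cardinal.{u}}
  {α : Type v}

theorem IsMonster.exists_mem (hm : IsMonster L 𝕄 κ) {ι : Type w} (hα : Small κ α) {C : Set 𝕄}
    (hC : Small κ C) (F : ι → Set (α → 𝕄)) (hF : ∀ i, C.Definable L (F i))
    (hfin : ∀ t : Finset ι, ∃ x, ∀ i ∈ t, x ∈ F i) : ∃ x, ∀ i, x ∈ F i := by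
  classical
  obtain ⟨β, hβ, ⟨e⟩⟩ := hα.exists_equiv
  let Γ : Set (FmlP L 𝕄 β) := {p | (∀ i, p.2.2 i ∈ C) ∧
    ∃ i, ∀ x, x ∈ F i ↔ p.2.1.Realize (Sum.elim (x ∘ e.symm) p.2.2)}
  obtain ⟨a, ha⟩ := hm.2.1 β C hβ hC.lt Γ (fun p hp => hp.1) (by
    intro t ht
    choose i hi using fun p : t => (ht p.2).2
    obtain ⟨x, hx⟩ := hfin (Finset.univ.image i)
    exact ⟨x ∘ e.symm, fun p hp => (hi ⟨p, hp⟩ x).1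
      (hx _ (Finset.mem_image_of_mem _ (Finset.mem_univ _)))⟩)
  refine ⟨a ∘ e, fun i => ?_⟩
  obtain ⟨n, φ, c, hc, hφ⟩ := exists_formula_of_definable (hF i)
  have hΓ : (⟨n, φ.relabel (Sum.map e id), c⟩ : FmlP L 𝕄 β) ∈ Γ := by
    refine ⟨hc, i, fun x => ?_⟩
    rw [hφ]
    simp only [Formula.realize_relabel]
    congr! 1
    funext j
    rcases j with j | j <;> simp
  have := ha _ hΓ
  rw [hφ]
  simp only [Formula.realize_relabel] at this
  convert this using 1
  funext j
  rcases j with j | j <;> simp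

/-- Directed form of saturation. -/
theorem IsMonster.exists_mem_of_directed (hm : IsMonster L 𝕄 κ) (hα : Small κ α) {C : Set 𝕄}
    (hC : Small κ C) (𝓕 : Set (Set (α → 𝕄))) (hF : ∀ S ∈ 𝓕, C.Definable L S)
    (hinter : ∀ S ∈ 𝓕, ∀ T ∈ 𝓕, S ∩ T ∈ 𝓕) (huniv : Set.univ ∈ 𝓕)
    (hne : ∀ S ∈ 𝓕, S.Nonempty) : ∃ x, ∀ S ∈ 𝓕, x ∈ S := by
  classical
  obtain ⟨x, hx⟩ := hm.exists_mem hα hC (fun S : 𝓕 => (S : Set (α → 𝕄))) (fun S => hF S S.2) (by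
    intro t
    have : (⋂ S ∈ t, (S : Set (α → 𝕄))) ∈ 𝓕 := by
      induction t using Finset.induction_on with
      | empty => simpa using huniv
      | insert a s _ ih =>
        rw [Finset.set_biInter_insert]
        exact hinter _ a.2 _ ih
    obtain ⟨x, hx⟩ := hne _ this
    exact ⟨x, fun S hS => Set.mem_iInter₂.1 hx S hS⟩)
  exact ⟨x, fun S hS => hx ⟨S, hS⟩⟩

theorem IsMonster.exists_equiv (hm : IsMonster L 𝕄 κ) (hα : Small κ α) {C : Set 𝕄}
    (hC : Small κ C) {a b : α → 𝕄} (h : EqTpOver L C a b) :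
    ∃ σ : 𝕄 ≃[L] 𝕄, (∀ x ∈ C, σ x = x) ∧ σ ∘ a = b := by
  obtain ⟨β, hβ, ⟨e⟩⟩ := (hα.sum hm.1 hC).exists_equiv
  obtain ⟨σ, hσ⟩ := hm.2.2 β hβ (Sum.elim a (fun c : C => (c : 𝕄)) ∘ e.symm)
    (Sum.elim b (fun c : C => (c : 𝕄)) ∘ e.symm) (by
      rw [eqTpOver_iff]
      intro S hS
      rw [eqTpOver_iff] at h
      exact h {x | (Sum.elim x (fun c : C => (c : 𝕄)) ∘ e.symm) ∈ S}
        (Definable.elim_const ((hS.mono (Set.empty_subset C)).preimage_comp e.symm)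
          (fun c : C => (c : 𝕄)) fun c => c.2))
  refine ⟨σ, fun x hx => ?_, funext fun i => ?_⟩
  · simpa using hσ (e (Sum.inr ⟨x, hx⟩))
  · simpa using hσ (e (Sum.inl i))

end Saturation

theorem EqTpOver.of_equiv {L : FirstOrder.Language.{u, u}} {𝕄 : Type u} [L.Structure 𝕄]
    {α : Type v} {C : Set 𝕄} {σ : 𝕄 ≃[L] 𝕄} (hσ : ∀ x ∈ C, σ x = x) (a : α → 𝕄) :
    EqTpOver L C (σ ∘ a) a :=
  eqTpOver_iff.2 fun _ hS => Definable.mem_equiv_iff hS hσ a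

theorem EqTpOver.comp {L : FirstOrder.Language.{u, u}} {𝕄 : Type u} [L.Structure 𝕄]
    {α : Type v} {β : Type w} {C : Set 𝕄} {a b : α → 𝕄} (h : EqTpOver L C a b) (f : β → α) :
    EqTpOver L C (a ∘ f) (b ∘ f) := by
  rw [eqTpOver_iff] at h ⊢
  exact fun S hS => h _ (hS.preimage_comp f)

/-- Two tuples have the same type iff all their initial parts do. -/
theorem EqTpOver.of_finset {L : FirstOrder.Language.{u, u}} {𝕄 : Type u} [L.Structure 𝕄]
    {α : Type v} {C : Set 𝕄} {a b : α → 𝕄}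
    (h : ∀ F : Finset α, EqTpOver L C (fun i : F => a i) (fun i : F => b i)) :
    EqTpOver L C a b := by
  rw [eqTpOver_iff]
  intro S hS
  obtain ⟨F, S', hS', hS⟩ := Definable.exists_finset hS
  rw [hS, hS]
  exact eqTpOver_iff.1 (h F) S' hS'

/-- `a, b` have the same type over `C ∪ d` if `(a, d)` and `(b, d)` have the same type over `C`. -/
theorem EqTpOver.of_elim {L : FirstOrder.Language.{u, u}} {𝕄 : Type u} [L.Structure 𝕄]
    {α : Type v} {β : Type w} {C : Set 𝕄} {a b : α → 𝕄} {d : β → 𝕄}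
    (h : EqTpOver L C (Sum.elim a d) (Sum.elim b d)) :
    EqTpOver L (C ∪ Set.range d) a b := by
  rw [eqTpOver_iff] at h ⊢
  intro S hS
  obtain ⟨S', hS', hS⟩ := Definable.unparam hS
  rw [hS, hS]
  exact h S' hS'

theorem EqTpOver.elim {L : FirstOrder.Language.{u, u}} {𝕄 : Type u} [L.Structure 𝕄]
    {α : Type v} {β : Type w} {C : Set 𝕄} {a b : α → 𝕄} {d : β → 𝕄}
    (h : EqTpOver L (C ∪ Set.range d) a b) :
    EqTpOver L C (Sum.elim a d) (Sum.elim b d) := by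
  rw [eqTpOver_iff] at h ⊢
  intro S hS
  exact h {x | Sum.elim x d ∈ S} (Definable.elim_const (hS.mono Set.subset_union_left) d
    fun i => Or.inr ⟨i, rfl⟩)

section Ultra

variable {L : FirstOrder.Language.{u, u}} {𝕄 : Type u} [L.Structure 𝕄] {κ : Cardinal.{u}}
  {α : Type v} {β : Type w}

theorem exists_ultrafilter_of_directed {X : Type v} (𝓕 : Set (Set X)) (huniv : Set.univ ∈ 𝓕)
    (hinter : ∀ S ∈ 𝓕, ∀ T ∈ 𝓕, S ∩ T ∈ 𝓕) (hne : ∀ S ∈ 𝓕, S.Nonempty) :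
    ∃ 𝒟 : Ultrafilter X, ∀ S ∈ 𝓕, S ∈ 𝒟 := by
  classical
  obtain ⟨𝒟, h𝒟⟩ := Ultrafilter.exists_ultrafilter_of_finite_inter_nonempty 𝓕 (by
    intro t ht
    have : ⋂₀ (t : Set (Set X)) ∈ 𝓕 := by
      induction t using Finset.induction_on with
      | empty => simpa using huniv
      | insert a s _ ih =>
        rw [Finset.coe_insert, Set.sInter_insert]
        rw [Finset.coe_insert, Set.insert_subset_iff] at ht
        exact hinter _ ht.1 _ (ih ht.2)
    exact hne _ this)
  exact ⟨𝒟, h𝒟⟩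

/-- The ultrafilter `𝒟` on `α`-tuples concentrates on tuples from `Ms`; such ultrafilters
represent global types finitely satisfiable in `Ms`. -/
def Coh (Ms : Set 𝕄) (𝒟 : Ultrafilter (α → 𝕄)) : Prop :=
  {m : α → 𝕄 | ∀ i, m i ∈ Ms} ∈ 𝒟

/-- `a` realizes the restriction to `C` of the global type given by `𝒟`. -/
def Rlz (L : FirstOrder.Language.{u, u}) {𝕄 : Type u} [L.Structure 𝕄] {α : Type v}
    (𝒟 : Ultrafilter (α → 𝕄)) (a : α → 𝕄) (C : Set 𝕄) : Prop :=
  ∀ S : Set (α → 𝕄), C.Definable L S → S ∈ 𝒟 → a ∈ S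

theorem Rlz.mem_iff {𝒟 : Ultrafilter (α → 𝕄)} {a : α → 𝕄} {C : Set 𝕄} (h : Rlz L 𝒟 a C)
    {S : Set (α → 𝕄)} (hS : C.Definable L S) : a ∈ S ↔ S ∈ 𝒟 := by
  refine ⟨fun ha => ?_, h S hS⟩
  by_contra hS'
  exact h _ hS.compl (Ultrafilter.compl_mem_iff_notMem.2 hS') ha

theorem Rlz.mono {𝒟 : Ultrafilter (α → 𝕄)} {a : α → 𝕄} {C D : Set 𝕄} (h : Rlz L 𝒟 a D)
    (hCD : C ⊆ D) : Rlz L 𝒟 a C :=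
  fun S hS => h S (hS.mono hCD)

theorem Rlz.eqTp {𝒟 : Ultrafilter (α → 𝕄)} {a b : α → 𝕄} {C : Set 𝕄} (h : Rlz L 𝒟 a C)
    (h' : Rlz L 𝒟 b C) : EqTpOver L C a b :=
  eqTpOver_iff.2 fun _ hS => (h.mem_iff hS).trans (h'.mem_iff hS).symm

theorem Rlz.of_eqTp {𝒟 : Ultrafilter (α → 𝕄)} {a b : α → 𝕄} {C : Set 𝕄} (h : Rlz L 𝒟 a C)
    (h' : EqTpOver L C a b) : Rlz L 𝒟 b C :=
  fun S hS hSD => (eqTpOver_iff.1 h' S hS).1 (h S hS hSD)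

theorem Rlz.equiv {𝒟 : Ultrafilter (α → 𝕄)} {a : α → 𝕄} {C Ms : Set 𝕄} (h : Rlz L 𝒟 a C)
    (h𝒟 : Coh Ms 𝒟) {σ : 𝕄 ≃[L] 𝕄} (hσ : ∀ x ∈ Ms, σ x = x) : Rlz L 𝒟 (σ ∘ a) (σ '' C) := by
  intro S hS hSD
  refine h _ (Definable.comap_equiv hS) ?_
  filter_upwards [hSD, h𝒟] with m hmS hm
  have : σ ∘ m = m := funext fun i => hσ _ (hm i)
  simpa [this] using hmS

theorem Rlz.finSat {𝒟 : Ultrafilter (α → 𝕄)} {a : α → 𝕄} {C Ms : Set 𝕄} (h : Rlz L 𝒟 a C)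
    (h𝒟 : Coh Ms 𝒟) : FinSatIn L Ms a C := by
  rw [finSatIn_iff]
  intro S hS ha
  obtain ⟨m, hm, hm'⟩ := 𝒟.nonempty_of_mem (Filter.inter_mem h𝒟 ((h.mem_iff hS).1 ha))
  exact ⟨m, hm, hm'⟩

theorem Rlz.of_map {𝒟 : Ultrafilter (α → 𝕄)} {𝓔 : Ultrafilter (β → 𝕄)} {z : β → 𝕄} {C : Set 𝕄}
    (h : Rlz L 𝓔 z C) {f : α → β}
    (hf : ∀ S : Set (α → 𝕄), (Set.univ : Set 𝕄).Definable L S → S ∈ 𝒟 → {x | x ∘ f ∈ S} ∈ 𝓔) :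
    Rlz L 𝒟 (z ∘ f) C :=
  fun S hS hSD => h {x | x ∘ f ∈ S} (hS.preimage_comp f) (hf S (hS.mono (Set.subset_univ _)) hSD)

theorem Coh.map {Ms : Set 𝕄} {𝓔 : Ultrafilter (β → 𝕄)} (h : Coh Ms 𝓔) (f : α → β) :
    Coh Ms (𝓔.map fun x => x ∘ f) := by
  change {x | ∀ i, (x ∘ f) i ∈ Ms} ∈ 𝓔
  filter_upwards [h] with m hm i using hm (f i)

theorem exists_coh_of_finSat {a : α → 𝕄} {C Ms : Set 𝕄} (h : FinSatIn L Ms a C) :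
    ∃ 𝒟 : Ultrafilter (α → 𝕄), Coh Ms 𝒟 ∧ Rlz L 𝒟 a C := by
  rw [finSatIn_iff] at h
  let K : Set (α → 𝕄) := {m | ∀ i, m i ∈ Ms}
  obtain ⟨𝒟, h𝒟⟩ := exists_ultrafilter_of_directed
    {T : Set (α → 𝕄) | ∃ S, C.Definable L S ∧ a ∈ S ∧ S ∩ K ⊆ T}
    ⟨Set.univ, Set.definable_univ, trivial, Set.subset_univ _⟩
    (by
      rintro T ⟨S, hS, ha, hT⟩ T' ⟨S', hS', ha', hT'⟩
      exact ⟨S ∩ S', hS.inter hS', ⟨ha, ha'⟩, fun x hx =>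
        ⟨hT ⟨hx.1.1, hx.2⟩, hT' ⟨hx.1.2, hx.2⟩⟩⟩)
    (by
      rintro T ⟨S, hS, ha, hT⟩
      obtain ⟨m, hm, hmS⟩ := h S hS ha
      exact ⟨m, hT ⟨hmS, hm⟩⟩)
  refine ⟨𝒟, h𝒟 K ⟨Set.univ, Set.definable_univ, trivial, Set.inter_subset_right⟩, ?_⟩
  intro S hS hSD
  by_contra ha
  exact Ultrafilter.compl_mem_iff_notMem.1 (h𝒟 Sᶜ ⟨Sᶜ, hS.compl, ha, Set.inter_subset_left⟩) hSD

theorem IsMonster.exists_rlz (hm : IsMonster L 𝕄 κ) (hα : Small κ α) (𝒟 : Ultrafilter (α → 𝕄))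
    {C : Set 𝕄} (hC : Small κ C) : ∃ a, Rlz L 𝒟 a C := by
  obtain ⟨x, hx⟩ := hm.exists_mem_of_directed hα hC {S | C.Definable L S ∧ S ∈ 𝒟}
    (fun S hS => hS.1) (fun S hS T hT => ⟨hS.1.inter hT.1, Filter.inter_mem hS.2 hT.2⟩)
    ⟨Set.definable_univ, Filter.univ_mem⟩ (fun S hS => 𝒟.nonempty_of_mem hS.2)
  exact ⟨x, fun S hS hSD => hx S ⟨hS, hSD⟩⟩

/-- Left extension of coheirs: if `c ∘ f` realizes `𝒟` over `Ms` then `𝒟` extends to a coheir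
of `tp(c/Ms)`. -/
theorem exists_coh_extension {Ms : Set 𝕄} (hMs : IsElemSubmodel L Ms) {𝒟 : Ultrafilter (α → 𝕄)}
    (h𝒟 : Coh Ms 𝒟) {c : β → 𝕄} {f : α → β} (hc : Rlz L 𝒟 (c ∘ f) Ms)
    (hf : ∀ S : Set (β → 𝕄), Ms.Definable L S →
      Ms.Definable L ((fun x : β → 𝕄 => x ∘ f) '' S)) :
    ∃ 𝓔 : Ultrafilter (β → 𝕄), Coh Ms 𝓔 ∧ Rlz L 𝓔 c Ms ∧ ∀ A ∈ 𝒟, {x | x ∘ f ∈ A} ∈ 𝓔 := by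
  let K : Set (β → 𝕄) := {m | ∀ i, m i ∈ Ms}
  obtain ⟨𝓔, h𝓔⟩ := exists_ultrafilter_of_directed
    {T : Set (β → 𝕄) | ∃ S, Ms.Definable L S ∧ c ∈ S ∧ ∃ A ∈ 𝒟, S ∩ {x | x ∘ f ∈ A} ∩ K ⊆ T}
    ⟨Set.univ, Set.definable_univ, trivial, Set.univ, Filter.univ_mem, Set.subset_univ _⟩
    (by
      rintro T ⟨S, hS, ha, A, hA, hT⟩ T' ⟨S', hS', ha', A', hA', hT'⟩
      exact ⟨S ∩ S', hS.inter hS', ⟨ha, ha'⟩, A ∩ A', Filter.inter_mem hA hA', fun x hx =>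
        ⟨hT ⟨⟨hx.1.1.1, hx.1.2.1⟩, hx.2⟩, hT' ⟨⟨hx.1.1.2, hx.1.2.2⟩, hx.2⟩⟩⟩)
    (by
      rintro T ⟨S, hS, hcS, A, hA, hT⟩
      have h1 := (hc.mem_iff (hf S hS)).1 ⟨c, hcS, rfl⟩
      obtain ⟨m, ⟨hmA, ⟨x₀, hx₀, hx₀m⟩⟩, hmM⟩ :=
        𝒟.nonempty_of_mem (Filter.inter_mem (Filter.inter_mem hA h1) h𝒟)
      obtain ⟨x, hx, hxM, hxe⟩ := hMs.exists_mem hS hx₀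
      have : x ∘ f = m := by
        rw [← hx₀m]
        funext i
        refine hxe _ ?_
        have := congrFun hx₀m i
        simp only [Function.comp] at this
        rw [this]
        exact hmM i
      exact ⟨x, hT ⟨⟨hx, by simpa [this] using hmA⟩, hxM⟩⟩)
  refine ⟨𝓔, h𝓔 K ⟨Set.univ, Set.definable_univ, trivial, Set.univ, Filter.univ_mem,
    Set.inter_subset_right⟩, ?_, fun A hA => h𝓔 _ ⟨Set.univ, Set.definable_univ, trivial, A, hA,
    fun x hx => hx.1.2⟩⟩
  intro S hS hSD
  by_contra ha
  exact Ultrafilter.compl_mem_iff_notMem.1 (h𝓔 Sᶜ ⟨Sᶜ, hS.compl, ha, Set.univ, Filter.univ_mem,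
    fun x hx => hx.1.1⟩) hSD

end Ultra

section Morley

variable {L : FirstOrder.Language.{u, u}} {𝕄 : Type u} [L.Structure 𝕄] {κ : Cardinal.{u}}
  {α : Type v} {β : Type w}

/-- The set of entries of a list of tuples. -/
def params (l : List (α → 𝕄)) : Set 𝕄 := {x | ∃ a ∈ l, x ∈ Set.range a}

@[simp] theorem params_nil : params ([] : List (α → 𝕄)) = ∅ := by
  ext x; simp [params]

@[simp] theorem params_cons (a : α → 𝕄) (l : List (α → 𝕄)) :
    params (a :: l) = Set.range a ∪ params l := by
  ext x; simp [params]

theorem image_params (σ : 𝕄 ≃[L] 𝕄) (l : List (α → 𝕄)) :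
    σ '' params l = params (l.map fun a => σ ∘ a) := by
  ext x
  constructor
  · rintro ⟨_, ⟨a, ha, i, rfl⟩, rfl⟩
    exact ⟨σ ∘ a, List.mem_map_of_mem ha, i, rfl⟩
  · rintro ⟨b, hb, i, rfl⟩
    obtain ⟨a, ha, rfl⟩ := List.mem_map.1 hb
    exact ⟨a i, ⟨a, ha, i, rfl⟩, rfl⟩

theorem Small.params (hκ : Cardinal.aleph0 < κ) (hα : Small κ α) (l : List (α → 𝕄)) :
    Small κ (params l) := by
  induction l with
  | nil => rw [params_nil]; exact .of_countable hκ _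
  | cons a l ih => rw [params_cons]; exact (hα.range a).union hκ ih

theorem image_eq_of_fix {C : Set 𝕄} {σ : 𝕄 ≃[L] 𝕄} (hσ : ∀ x ∈ C, σ x = x) : σ '' C = C := by
  ext x
  constructor
  · rintro ⟨y, hy, rfl⟩
    rwa [hσ y hy]
  · exact fun hx => ⟨x, hx, hσ x hx⟩

/-- Finite Morley sequences over `C` of the type given by `𝒟`, latest element first. -/
def MorleyList (L : FirstOrder.Language.{u, u}) {𝕄 : Type u} [L.Structure 𝕄] {α : Type v}
    (𝒟 : Ultrafilter (α → 𝕄)) (C : Set 𝕄) : List (α → 𝕄) → Prop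
  | [] => True
  | a :: l => Rlz L 𝒟 a (C ∪ params l) ∧ MorleyList L 𝒟 C l

/-- Finite Morley sequences of the same length are conjugate. -/
theorem MorleyList.exists_equiv (hm : IsMonster L 𝕄 κ) (hα : Small κ α) {Ms C : Set 𝕄}
    (hC : Small κ C) (hMC : Ms ⊆ C) {𝒟 : Ultrafilter (α → 𝕄)} (h𝒟 : Coh Ms 𝒟) :
    ∀ {l l' : List (α → 𝕄)}, MorleyList L 𝒟 C l → MorleyList L 𝒟 C l' → l.length = l'.length →
      ∃ σ : 𝕄 ≃[L] 𝕄, (∀ x ∈ C, σ x = x) ∧ (l.map fun a => σ ∘ a) = l'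
  | [], [], _, _, _ => ⟨FirstOrder.Language.Equiv.refl L 𝕄, fun x _ => rfl, rfl⟩
  | a :: l, a' :: l', h, h', hl => by
    obtain ⟨σ, hσ, rfl⟩ := exists_equiv hm hα hC hMC h𝒟 h.2 h'.2 (by simpa using hl)
    have h1 := h.1.equiv h𝒟 (σ := σ) fun x hx => hσ x (hMC hx)
    rw [Set.image_union, image_eq_of_fix hσ, image_params] at h1
    obtain ⟨τ, hτ, hτa⟩ := hm.exists_equiv hα (hC.union hm.1 (Small.params hm.1 hα _))
      (h1.eqTp h'.1)
    let ρ : 𝕄 ≃[L] 𝕄 := τ.comp σ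
    have hρ : ∀ x, ρ x = τ (σ x) := fun x => rfl
    refine ⟨ρ, fun x hx => ?_, ?_⟩
    · rw [hρ, hσ x hx, hτ x (Or.inl hx)]
    · rw [List.map_cons]
      congr 1
      refine List.map_congr_left fun b hb => funext fun i => ?_
      exact hτ _ (Or.inr ⟨σ ∘ b, List.mem_map_of_mem hb, i, rfl⟩)

/-- `Y` is a Morley sequence over `C` of the type given by `𝒟`. -/
def MorleySeq (L : FirstOrder.Language.{u, u}) {𝕄 : Type u} [L.Structure 𝕄] {α : Type v}
    (𝒟 : Ultrafilter (α → 𝕄)) (C : Set 𝕄) (Y : ℕ → α → 𝕄) : Prop :=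
  ∀ i, Rlz L 𝒟 (Y i) (C ∪ ⋃ (j : ℕ) (_ : j < i), Set.range (Y j))

theorem MorleySeq.mono {𝒟 : Ultrafilter (α → 𝕄)} {C D : Set 𝕄} {Y : ℕ → α → 𝕄}
    (h : MorleySeq L 𝒟 D Y) (hCD : C ⊆ D) : MorleySeq L 𝒟 C Y :=
  fun i => (h i).mono (Set.union_subset_union_left _ hCD)

theorem MorleySeq.rlz {𝒟 : Ultrafilter (α → 𝕄)} {C : Set 𝕄} {Y : ℕ → α → 𝕄}
    (h : MorleySeq L 𝒟 C Y) (i : ℕ) : Rlz L 𝒟 (Y i) C :=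
  (h i).mono Set.subset_union_left

theorem MorleySeq.comp {𝒟 : Ultrafilter (α → 𝕄)} {C : Set 𝕄} {Y : ℕ → α → 𝕄}
    (h : MorleySeq L 𝒟 C Y) {f : ℕ → ℕ} (hf : StrictMono f) : MorleySeq L 𝒟 C (Y ∘ f) := by
  refine fun i => (h (f i)).mono (Set.union_subset_union_right _ ?_)
  refine Set.iUnion₂_subset fun j hj => ?_
  exact Set.subset_iUnion₂_of_subset (f j) (hf hj) subset_rfl

theorem MorleySeq.equiv {𝒟 : Ultrafilter (α → 𝕄)} {Ms C : Set 𝕄} (h𝒟 : Coh Ms 𝒟) {Y : ℕ → α → 𝕄}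
    (h : MorleySeq L 𝒟 C Y) {σ : 𝕄 ≃[L] 𝕄} (hσ : ∀ x ∈ Ms, σ x = x) :
    MorleySeq L 𝒟 (σ '' C) (fun i => σ ∘ Y i) := by
  intro i
  have := (h i).equiv h𝒟 hσ
  simpa only [Set.image_union, Set.image_iUnion, Set.range_comp] using this

theorem small_iUnion_range (hκ : Cardinal.aleph0 < κ) (hα : Small κ α) (Y : ℕ → α → 𝕄) :
    Small κ ↥(⋃ i, Set.range (Y i)) := by
  have : (⋃ i, Set.range (Y i)) = Set.range (flatSeq Y) := by
    ext x
    simp [flatSeq]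
  rw [this]
  exact ((Small.of_countable hκ ℕ).prod hκ hα).range _

theorem small_iUnion_range_lt (hκ : Cardinal.aleph0 < κ) (hα : Small κ α) (Y : ℕ → α → 𝕄) (n : ℕ) :
    Small κ ↥(⋃ (j : ℕ) (_ : j < n), Set.range (Y j)) :=
  (small_iUnion_range hκ hα Y).mono
    (Set.iUnion₂_subset fun j _ => Set.subset_iUnion (fun i => Set.range (Y i)) j)

/-- Recursive construction of a sequence, each step depending on the set of earlier entries. -/
def seqOfStep (step : Set 𝕄 → α → 𝕄) (C : Set 𝕄) (Y₀ : α → 𝕄) : ℕ → α → 𝕄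
  | 0 => Y₀
  | n + 1 => step (C ∪ ⋃ j : Fin (n + 1), Set.range (seqOfStep step C Y₀ j))

theorem IsMonster.exists_morleySeq (hm : IsMonster L 𝕄 κ) (hα : Small κ α)
    (𝒟 : Ultrafilter (α → 𝕄)) {C : Set 𝕄} (hC : Small κ C) {Y₀ : α → 𝕄} (hY₀ : Rlz L 𝒟 Y₀ C) :
    ∃ Y, MorleySeq L 𝒟 C Y ∧ Y 0 = Y₀ := by
  classical
  have : Nonempty (α → 𝕄) := ⟨Y₀⟩
  choose! step hstep using fun (D : Set 𝕄) (hD : Small κ D) => hm.exists_rlz hα 𝒟 hD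
  refine ⟨seqOfStep step C Y₀, fun i => ?_, by rw [seqOfStep]⟩
  rcases i with _ | n
  · simpa [seqOfStep] using hY₀
  · have h1 : (⋃ j : Fin (n + 1), Set.range (seqOfStep step C Y₀ j)) =
        ⋃ (j : ℕ) (_ : j < n + 1), Set.range (seqOfStep step C Y₀ j) := by
      ext x
      simp only [Set.mem_iUnion, Fin.exists_iff]
    rw [show seqOfStep step C Y₀ (n + 1) = step (C ∪ ⋃ j : Fin (n + 1),
      Set.range (seqOfStep step C Y₀ j)) by rw [seqOfStep], h1]
    exact hstep _ (hC.union hm.1 (small_iUnion_range_lt hm.1 hα _ _))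

theorem IsMonster.exists_morleySeq_of_small (hm : IsMonster L 𝕄 κ) (hα : Small κ α)
    (𝒟 : Ultrafilter (α → 𝕄)) {C : Set 𝕄} (hC : Small κ C) :
    ∃ Y, MorleySeq L 𝒟 C Y := by
  obtain ⟨a, ha⟩ := hm.exists_rlz hα 𝒟 hC
  obtain ⟨Y, hY, -⟩ := hm.exists_morleySeq hα 𝒟 hC ha
  exact ⟨Y, hY⟩

/-- The first `n` elements of a sequence, latest first. -/
def initList (Y : ℕ → α → 𝕄) : ℕ → List (α → 𝕄)
  | 0 => []
  | n + 1 => Y n :: initList Y n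

theorem mem_initList {Y : ℕ → α → 𝕄} {n : ℕ} {a : α → 𝕄} :
    a ∈ initList Y n ↔ ∃ i < n, a = Y i := by
  induction n with
  | zero => simp [initList]
  | succ n ih =>
    rw [initList, List.mem_cons, ih]
    constructor
    · rintro (rfl | ⟨i, hi, rfl⟩)
      · exact ⟨n, by omega, rfl⟩
      · exact ⟨i, by omega, rfl⟩
    · rintro ⟨i, hi, rfl⟩
      rcases Nat.lt_succ_iff_lt_or_eq.1 hi with h | rfl
      · exact Or.inr ⟨i, h, rfl⟩
      · exact Or.inl rfl

@[simp] theorem length_initList (Y : ℕ → α → 𝕄) (n : ℕ) : (initList Y n).length = n := by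
  induction n with
  | zero => rfl
  | succ n ih => simp [initList, ih]

theorem params_initList (Y : ℕ → α → 𝕄) (n : ℕ) :
    params (initList Y n) = ⋃ (j : ℕ) (_ : j < n), Set.range (Y j) := by
  ext x
  simp only [params, mem_initList, Set.mem_iUnion]
  constructor
  · rintro ⟨_, ⟨i, hi, rfl⟩, hx⟩
    exact ⟨i, hi, hx⟩
  · rintro ⟨i, hi, hx⟩
    exact ⟨_, ⟨i, hi, rfl⟩, hx⟩

theorem MorleySeq.morleyList {𝒟 : Ultrafilter (α → 𝕄)} {C : Set 𝕄} {Y : ℕ → α → 𝕄}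
    (h : MorleySeq L 𝒟 C Y) (n : ℕ) : MorleyList L 𝒟 C (initList Y n) := by
  induction n with
  | zero => trivial
  | succ n ih => exact ⟨by rw [params_initList]; exact h n, ih⟩

theorem initList_map_eq {Y Y' : ℕ → α → 𝕄} {g : (α → 𝕄) → α → 𝕄} {n : ℕ}
    (h : (initList Y n).map g = initList Y' n) : ∀ i < n, g (Y i) = Y' i := by
  induction n with
  | zero => simp
  | succ n ih =>
    simp only [initList, List.map_cons, List.cons.injEq] at h
    intro i hi
    rcases Nat.lt_succ_iff_lt_or_eq.1 hi with h' | rfl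
    · exact ih h.2 i h'
    · exact h.1

theorem MorleySeq.eqTp (hm : IsMonster L 𝕄 κ) (hα : Small κ α) {Ms C : Set 𝕄}
    (hC : Small κ C) (hMC : Ms ⊆ C) {𝒟 : Ultrafilter (α → 𝕄)} (h𝒟 : Coh Ms 𝒟) {Y Y' : ℕ → α → 𝕄}
    (h : MorleySeq L 𝒟 C Y) (h' : MorleySeq L 𝒟 C Y') :
    EqTpOver L C (flatSeq Y) (flatSeq Y') := by
  refine EqTpOver.of_finset fun F => ?_
  obtain ⟨n, hn⟩ : ∃ n, ∀ p ∈ F, p.1 < n :=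
    ⟨F.sup Prod.fst + 1, fun p hp => Nat.lt_succ_of_le (Finset.le_sup (f := Prod.fst) hp)⟩
  obtain ⟨σ, hσ, hσl⟩ := MorleyList.exists_equiv hm hα hC hMC h𝒟 (h.morleyList n)
    (h'.morleyList n) (by simp)
  have h1 := initList_map_eq hσl
  have h2 : (fun p : F => flatSeq Y' p) = σ ∘ fun p : F => flatSeq Y p := by
    funext p
    exact congrFun (h1 _ (hn _ p.2)).symm _
  rw [h2]
  exact (EqTpOver.of_equiv hσ _).symm

theorem MorleySeq.exists_equiv (hm : IsMonster L 𝕄 κ) (hα : Small κ α) {Ms C : Set 𝕄}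
    (hC : Small κ C) (hMC : Ms ⊆ C) {𝒟 : Ultrafilter (α → 𝕄)} (h𝒟 : Coh Ms 𝒟) {Y Y' : ℕ → α → 𝕄}
    (h : MorleySeq L 𝒟 C Y) (h' : MorleySeq L 𝒟 C Y') :
    ∃ σ : 𝕄 ≃[L] 𝕄, (∀ x ∈ C, σ x = x) ∧ ∀ i, σ ∘ Y i = Y' i := by
  obtain ⟨σ, hσ, hσY⟩ := hm.exists_equiv ((Small.of_countable hm.1 ℕ).prod hm.1 hα) hC
    (MorleySeq.eqTp hm hα hC hMC h𝒟 h h')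
  exact ⟨σ, hσ, fun i => funext fun j => congrFun hσY (i, j)⟩

theorem MorleySeq.of_eqTp (hm : IsMonster L 𝕄 κ) (hα : Small κ α) {Ms C : Set 𝕄}
    (hC : Small κ C) (hMC : Ms ⊆ C) {𝒟 : Ultrafilter (α → 𝕄)} (h𝒟 : Coh Ms 𝒟) {Y Y' : ℕ → α → 𝕄}
    (h : MorleySeq L 𝒟 C Y) (h' : EqTpOver L C (flatSeq Y) (flatSeq Y')) :
    MorleySeq L 𝒟 C Y' := by
  obtain ⟨σ, hσ, hσY⟩ := hm.exists_equiv ((Small.of_countable hm.1 ℕ).prod hm.1 hα) hC h'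
  have h1 := h.equiv h𝒟 (σ := σ) fun x hx => hσ x (hMC hx)
  rw [image_eq_of_fix hσ] at h1
  convert h1 using 1
  funext i j
  exact (congrFun hσY (i, j)).symm

/-- A Morley sequence of a coheir is itself finitely satisfiable. -/
theorem MorleySeq.finSat {Ms C : Set 𝕄} (hne : Ms.Nonempty) (hMC : Ms ⊆ C)
    {𝒟 : Ultrafilter (α → 𝕄)} (h𝒟 : Coh Ms 𝒟) {Y : ℕ → α → 𝕄} (h : MorleySeq L 𝒟 C Y) :
    FinSatIn L Ms (flatSeq Y) C := by
  classical
  rw [finSatIn_iff]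
  intro S hS hY
  have key : ∀ k : ℕ, ∀ w ∈ S, (∀ p : ℕ × α, p.1 < k → w p = Y p.1 p.2) →
      (∀ p : ℕ × α, k ≤ p.1 → w p ∈ Ms) → ∃ m : ℕ × α → 𝕄, (∀ i, m i ∈ Ms) ∧ m ∈ S := by
    intro k
    induction k with
    | zero => exact fun w hw _ h2 => ⟨w, fun p => h2 p (Nat.zero_le _), hw⟩
    | succ k ih =>
      intro w hw h1 h2
      let t : ℕ × α → α ⊕ 𝕄 := fun p => if p.1 = k then Sum.inl p.2 else Sum.inr (w p)
      have hS' := Definable.subst (C := C ∪ ⋃ (j : ℕ) (_ : j < k), Set.range (Y j))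
        (hS.mono Set.subset_union_left) t (by
          intro p c hp
          by_cases hpk : p.1 = k
          · simp [t, hpk] at hp
          · simp only [t, hpk, if_false, Sum.inr.injEq] at hp
            rcases Nat.lt_or_ge p.1 k with h' | h'
            · right
              rw [← hp, h1 p (by omega)]
              exact Set.mem_iUnion₂.2 ⟨p.1, h', p.2, rfl⟩
            · left
              rw [← hp]
              exact hMC (h2 p (by omega)))
      obtain ⟨m, hm, hmS⟩ := finSatIn_iff.1 ((h k).finSat h𝒟) _ hS' (by
        simp only [Set.mem_ofPred_eq]
        convert hw using 1
        funext p
        by_cases hpk : p.1 = k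
        · simp [t, hpk, h1 p (by omega)]
        · simp [t, hpk])
      refine ih _ hmS (fun p hp => ?_) (fun p hp => ?_)
      · have : p.1 ≠ k := by omega
        simp [t, this, h1 p (by omega)]
      · by_cases hpk : p.1 = k
        · simp [t, hpk, hm]
        · simp only [t, hpk, if_false, Sum.elim_inr, id]
          exact h2 p (by omega)
  obtain ⟨F, S', hS', hSS⟩ := Definable.exists_finset hS
  obtain ⟨n, hn⟩ : ∃ n, ∀ p ∈ F, p.1 < n :=
    ⟨F.sup Prod.fst + 1, fun p hp => Nat.lt_succ_of_le (Finset.le_sup (f := Prod.fst) hp)⟩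
  refine key n (fun p => if p.1 < n then Y p.1 p.2 else hne.some) ?_ (fun p hp => by simp [hp])
    (fun p hp => by simpa [not_lt.2 hp] using hne.some_mem)
  rw [hSS] at hY ⊢
  convert hY using 1
  funext p
  simp [hn p p.2, flatSeq]

/-- The `ω`-th power of a coheir. -/
theorem exists_coh_power (hm : IsMonster L 𝕄 κ) (hα : Small κ α) {Ms : Set 𝕄}
    (hne : Ms.Nonempty) (hMs : Small κ Ms) {𝒟 : Ultrafilter (α → 𝕄)} (h𝒟 : Coh Ms 𝒟) :
    ∃ 𝒟ω : Ultrafilter (ℕ × α → 𝕄), Coh Ms 𝒟ω ∧ ∀ (C : Set 𝕄), Small κ C → Ms ⊆ C →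
      ∀ Y : ℕ → α → 𝕄, Rlz L 𝒟ω (flatSeq Y) C ↔ MorleySeq L 𝒟 C Y := by
  classical
  let K : Set (ℕ × α → 𝕄) := {m | ∀ i, m i ∈ Ms}
  have hsm : ∀ F : Finset 𝕄, Small κ ↥(Ms ∪ (F : Set 𝕄)) := fun F =>
    hMs.union hm.1 (.of_countable hm.1 _)
  obtain ⟨𝓔, h𝓔⟩ := exists_ultrafilter_of_directed
    {T : Set (ℕ × α → 𝕄) | ∃ S, ∃ F : Finset 𝕄, (Ms ∪ (F : Set 𝕄)).Definable L S ∧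
      (∀ Y, MorleySeq L 𝒟 (Ms ∪ (F : Set 𝕄)) Y → flatSeq Y ∈ S) ∧ S ∩ K ⊆ T}
    ⟨Set.univ, ∅, Set.definable_univ, fun _ _ => trivial, Set.subset_univ _⟩
    (by
      rintro T ⟨S, F, hS, ha, hT⟩ T' ⟨S', F', hS', ha', hT'⟩
      have h1 : Ms ∪ (F : Set 𝕄) ⊆ Ms ∪ ((F ∪ F' : Finset 𝕄) : Set 𝕄) :=
        Set.union_subset_union_right _ (by simp)
      have h2 : Ms ∪ (F' : Set 𝕄) ⊆ Ms ∪ ((F ∪ F' : Finset 𝕄) : Set 𝕄) :=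
        Set.union_subset_union_right _ (by simp)
      exact ⟨S ∩ S', F ∪ F', (hS.mono h1).inter (hS'.mono h2),
        fun Y hY => ⟨ha Y (hY.mono h1), ha' Y (hY.mono h2)⟩, fun x hx =>
        ⟨hT ⟨hx.1.1, hx.2⟩, hT' ⟨hx.1.2, hx.2⟩⟩⟩)
    (by
      rintro T ⟨S, F, hS, ha, hT⟩
      obtain ⟨Y, hY⟩ := hm.exists_morleySeq_of_small hα 𝒟 (hsm F)
      obtain ⟨m, hmM, hmS⟩ := finSatIn_iff.1
        (hY.finSat hne Set.subset_union_left h𝒟) S hS (ha Y hY)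
      exact ⟨m, hT ⟨hmS, hmM⟩⟩)
  have hto : ∀ C : Set 𝕄, Small κ C → Ms ⊆ C → ∀ Y, MorleySeq L 𝒟 C Y →
      Rlz L 𝓔 (flatSeq Y) C := by
    intro C hC hMC Y hY S hS hSE
    by_contra hYS
    obtain ⟨F, hF, hSF⟩ := Set.definable_iff_finitely_definable.1 hS
    have hSF' : (Ms ∪ (F : Set 𝕄)).Definable L S := hSF.mono Set.subset_union_right
    have hYF : MorleySeq L 𝒟 (Ms ∪ (F : Set 𝕄)) Y := hY.mono (Set.union_subset hMC hF)
    refine Ultrafilter.compl_mem_iff_notMem.1 (h𝓔 Sᶜ ⟨Sᶜ, F, hSF'.compl, fun Y' hY' => ?_,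
      Set.inter_subset_left⟩) hSE
    exact (eqTpOver_iff.1 (MorleySeq.eqTp hm hα (hsm F) Set.subset_union_left h𝒟 hYF hY') _
      hSF'.compl).1 hYS
  refine ⟨𝓔, h𝓔 K ⟨Set.univ, ∅, Set.definable_univ, fun _ _ => trivial,
    Set.inter_subset_right⟩, fun C hC hMC Y => ⟨fun hY => ?_, hto C hC hMC Y⟩⟩
  obtain ⟨Y', hY'⟩ := hm.exists_morleySeq_of_small hα 𝒟 hC
  exact MorleySeq.of_eqTp hm hα hC hMC h𝒟 hY' ((hto C hC hMC Y' hY').eqTp hY)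

end Morley

section GlobalTypes

variable {L : FirstOrder.Language.{u, u}} {𝕄 : Type u} [L.Structure 𝕄] {κ : Cardinal.{u}}
  {α : Type v}

/-- The global type of definable sets in an ultrafilter. -/
def globalTypeOf (L : FirstOrder.Language.{u, u}) {𝕄 : Type u} [L.Structure 𝕄] {α : Type v}
    (𝒟 : Ultrafilter (α → 𝕄)) : GlobalType L 𝕄 α where
  carrier := {p | {a | p.2.1.Realize (Sum.elim a p.2.2)} ∈ 𝒟}
  consistent t ht := by
    have : (⋂ p ∈ t, {a : α → 𝕄 | p.2.1.Realize (Sum.elim a p.2.2)}) ∈ 𝒟 :=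
      (Filter.biInter_finset_mem t).2 fun p hp => ht hp
    obtain ⟨a, ha⟩ := 𝒟.nonempty_of_mem this
    exact ⟨a, fun p hp => Set.mem_iInter₂.1 ha p hp⟩
  complete n φ c := by
    simp only [Set.mem_ofPred_eq]
    rw [or_iff_not_imp_left, ← Ultrafilter.compl_mem_iff_notMem]
    intro h
    convert h using 1
    ext a
    simp

theorem realizesType_globalTypeOf {𝒟 : Ultrafilter (α → 𝕄)} {a : α → 𝕄} {C : Set 𝕄} :
    RealizesType (globalTypeOf L 𝒟) a C ↔ Rlz L 𝒟 a C := by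
  constructor
  · intro h S hS hSD
    obtain ⟨n, φ, c, hc, hφ⟩ := exists_formula_of_definable hS
    rw [hφ]
    refine h n φ c hc ?_
    have : S = {a | φ.Realize (Sum.elim a c)} := Set.ext hφ
    rwa [this] at hSD
  · exact fun h n φ c hc hp => h _ (definable_of_formula φ c hc) hp

theorem Coh.globalTypeOf {Ms : Set 𝕄} {𝒟 : Ultrafilter (α → 𝕄)} (h : Coh Ms 𝒟) :
    (globalTypeOf L 𝒟).FinSatInM Ms := by
  intro t ht
  have : (⋂ p ∈ t, {a : α → 𝕄 | p.2.1.Realize (Sum.elim a p.2.2)}) ∈ 𝒟 :=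
    (Filter.biInter_finset_mem t).2 fun p hp => ht hp
  obtain ⟨a, ha, haM⟩ := 𝒟.nonempty_of_mem (Filter.inter_mem this h)
  exact ⟨a, haM, fun p hp => Set.mem_iInter₂.1 ha p hp⟩

theorem GlobalType.FinSatInM.exists_coh {Ms : Set 𝕄} {q : GlobalType L 𝕄 α}
    (hq : q.FinSatInM Ms) : ∃ 𝒟 : Ultrafilter (α → 𝕄), Coh Ms 𝒟 ∧
      ∀ a C, RealizesType q a C ↔ Rlz L 𝒟 a C := by
  classical
  let K : Set (α → 𝕄) := {m | ∀ i, m i ∈ Ms}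
  obtain ⟨𝒟, h𝒟⟩ := exists_ultrafilter_of_directed
    {T : Set (α → 𝕄) | ∃ t : Finset (FmlP L 𝕄 α), ↑t ⊆ q.carrier ∧
      {a | ∀ p ∈ t, p.2.1.Realize (Sum.elim a p.2.2)} ∩ K ⊆ T}
    ⟨∅, by simp, Set.subset_univ _⟩
    (by
      rintro T ⟨t, ht, hT⟩ T' ⟨t', ht', hT'⟩
      refine ⟨t ∪ t', by simp [ht, ht'], fun x hx => ⟨hT ⟨fun p hp => hx.1 p ?_, hx.2⟩,
        hT' ⟨fun p hp => hx.1 p ?_, hx.2⟩⟩⟩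
      · exact Finset.mem_union_left _ hp
      · exact Finset.mem_union_right _ hp)
    (by
      rintro T ⟨t, ht, hT⟩
      obtain ⟨m, hmM, hm⟩ := hq t ht
      exact ⟨m, hT ⟨hm, hmM⟩⟩)
  have hmem : ∀ p ∈ q.carrier, {a | p.2.1.Realize (Sum.elim a p.2.2)} ∈ 𝒟 := fun p hp =>
    h𝒟 _ ⟨{p}, by simpa using hp, fun x hx => hx.1 p (by simp)⟩
  refine ⟨𝒟, h𝒟 K ⟨∅, by simp, Set.inter_subset_right⟩, fun a C => ⟨fun h S hS hSD => ?_,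
    fun h n φ c hc hp => h _ (definable_of_formula φ c hc) (hmem _ hp)⟩⟩
  obtain ⟨n, φ, c, hc, hφ⟩ := exists_formula_of_definable hS
  rcases q.complete n φ c with h1 | h1
  · exact (hφ a).2 (h n φ c hc h1)
  · refine absurd hSD (Ultrafilter.compl_mem_iff_notMem.1 ?_)
    have h2 := hmem _ h1
    convert h2 using 1
    ext x
    simp [hφ]

theorem coheirMorley_iff {Ms : Set 𝕄} {B : ℕ → α → 𝕄} :
    CoheirMorley L Ms B ↔ ∃ 𝒟 : Ultrafilter (α → 𝕄), Coh Ms 𝒟 ∧ MorleySeq L 𝒟 Ms B := by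
  constructor
  · rintro ⟨q, hq, h⟩
    obtain ⟨𝒟, h𝒟, h𝒟q⟩ := hq.exists_coh
    exact ⟨𝒟, h𝒟, fun i => (h𝒟q _ _).1 (h i)⟩
  · rintro ⟨𝒟, h𝒟, h⟩
    exact ⟨globalTypeOf L 𝒟, h𝒟.globalTypeOf, fun i => realizesType_globalTypeOf.2 (h i)⟩

theorem ExtendsTpOver.realizesType {q : GlobalType L 𝕄 α} {C : Set 𝕄} {a : α → 𝕄}
    (h : ExtendsTpOver q C a) : RealizesType q a C := by
  classical
  intro n φ c hc hp
  by_contra h1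
  have h2 := h n φ.not c hc (by simpa using h1)
  obtain ⟨x, hx⟩ := q.consistent {⟨n, φ, c⟩, ⟨n, φ.not, c⟩} (by
    intro p hp'
    simp only [Finset.coe_insert, Finset.coe_singleton, Set.mem_insert_iff,
      Set.mem_singleton_iff] at hp'
    rcases hp' with rfl | rfl <;> assumption)
  have h3 := hx ⟨n, φ, c⟩ (by simp)
  have h4 := hx ⟨n, φ.not, c⟩ (by simp)
  simp only [Formula.realize_not] at h4
  exact h4 h3

end GlobalTypes


section Gen

/-- For ultrafilter-many `i₀`, for ultrafilter-many `i₁`, …, the list `[i₀, …, i_{n-1}]` satisfies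
`P`. -/
def Gen : ℕ → (List ℕ → Prop) → Prop
  | 0, P => P []
  | n + 1, P => ∀ᶠ i in (Filter.hyperfilter ℕ : Filter ℕ), Gen n fun l => P (i :: l)

theorem Gen.mono {n : ℕ} {P Q : List ℕ → Prop} (h : Gen n P)
    (hPQ : ∀ l, l.length = n → P l → Q l) : Gen n Q := by
  induction n generalizing P Q with
  | zero => exact hPQ [] rfl h
  | succ n ih =>
    exact Filter.Eventually.mono h fun i hi => ih hi fun l hl => hPQ _ (by simp [hl])

theorem Gen.and {n : ℕ} {P Q : List ℕ → Prop} (h : Gen n P) (h' : Gen n Q) :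
    Gen n fun l => P l ∧ Q l := by
  induction n generalizing P Q with
  | zero => exact ⟨h, h'⟩
  | succ n ih => exact (Filter.Eventually.and h h').mono fun i hi => ih hi.1 hi.2

theorem gen_not {n : ℕ} {P : List ℕ → Prop} : Gen n (fun l => ¬ P l) ↔ ¬ Gen n P := by
  induction n generalizing P with
  | zero => rfl
  | succ n ih =>
    simp only [Gen, ih]
    exact Ultrafilter.eventually_not

theorem gen_of_forall {n : ℕ} {P : List ℕ → Prop} (h : ∀ l, P l) : Gen n P := by
  induction n generalizing P with
  | zero => exact h []
  | succ n ih => exact Filter.Eventually.of_forall fun i => ih fun l => h _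

theorem gen_forall_mem {n : ℕ} {ι : Type v} {s : Set ι} (hs : s.Finite) {P : ι → List ℕ → Prop}
    (h : ∀ i ∈ s, Gen n (P i)) : Gen n fun l => ∀ i ∈ s, P i l := by
  induction s, hs using Set.Finite.induction_on with
  | empty => exact gen_of_forall (by simp)
  | @insert a s _ _ ih =>
    refine ((h a (Set.mem_insert _ _)).and
      (ih fun i hi => h i (Set.mem_insert_of_mem _ hi))).mono fun l _ hl i hi => ?_
    rcases hi with rfl | hi
    · exact hl.1
    · exact hl.2 i hi

theorem Gen.exists {n : ℕ} {P : List ℕ → Prop} (h : Gen n P) : ∃ l, l.length = n ∧ P l := by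
  induction n generalizing P with
  | zero => exact ⟨[], rfl, h⟩
  | succ n ih =>
    obtain ⟨i, hi⟩ := Filter.Eventually.exists h
    obtain ⟨l, hl, hP⟩ := ih hi
    exact ⟨i :: l, by simp [hl], hP⟩

theorem gen_add {m n : ℕ} {P : List ℕ → Prop} :
    Gen (m + n) P ↔ Gen m fun l => Gen n fun l' => P (l ++ l') := by
  induction m generalizing P with
  | zero => simp [Gen]
  | succ m ih =>
    rw [Nat.succ_add]
    simp only [Gen, ih, List.cons_append]

theorem gen_lt (n K : ℕ) : Gen n fun l => ∀ x ∈ l, K < x := by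
  induction n with
  | zero => simp [Gen]
  | succ n ih =>
    have : ∀ᶠ i in (Filter.hyperfilter ℕ : Filter ℕ), K < i :=
      Nat.hyperfilter_le_atTop (Filter.eventually_gt_atTop K)
    refine this.mono fun i hi => ih.mono fun l _ hl x hx => ?_
    rcases List.mem_cons.1 hx with rfl | hx
    · exact hi
    · exact hl x hx

/-- A level-preserving embedding of `ω^{<ω}` respecting the order of immediate successors. -/
def Emb (f : List ℕ → List ℕ) : Prop :=
  f [] = [] ∧ ∃ g : List ℕ → ℕ → ℕ, (∀ ν, StrictMono (g ν)) ∧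
    ∀ ν c, f (ν ++ [c]) = f ν ++ [g ν c]

theorem Gen.exists_emb {n : ℕ} {P : List ℕ → Prop} (h : Gen n P) :
    ∃ f, Emb f ∧ ∀ σ, σ.length = n → P (f σ) := by
  induction n generalizing P with
  | zero =>
    refine ⟨id, ⟨rfl, fun _ c => c, fun _ => strictMono_id, fun _ _ => rfl⟩, fun σ hσ => ?_⟩
    rw [List.length_eq_zero_iff.1 hσ]
    exact h
  | succ n ih =>
    have hfreq : ∃ᶠ i in Filter.atTop, Gen n fun l => P (i :: l) :=
      (Filter.Eventually.frequently h).filter_mono Nat.hyperfilter_le_atTop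
    obtain ⟨g, hg, hgP⟩ := Filter.extraction_of_frequently_atTop hfreq
    choose f hf hfP using fun c => ih (hgP c)
    choose gg hgg hfg using fun c => (hf c).2
    refine ⟨fun l => match l with
      | [] => []
      | c :: l => g c :: f c l, ⟨rfl, fun l => match l with
      | [] => g
      | c :: l => gg c l, ?_, ?_⟩, ?_⟩
    · rintro (_ | ⟨c, l⟩)
      · exact hg
      · exact hgg c l
    · rintro (_ | ⟨c, l⟩) d
      · simp [(hf d).1]
      · simp [hfg]
    · rintro (_ | ⟨c, l⟩) hl
      · simp at hl
      · exact hfP c l (by simpa using hl)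

theorem Emb.length {f : List ℕ → List ℕ} (hf : Emb f) (l : List ℕ) : (f l).length = l.length := by
  obtain ⟨h0, g, _, h⟩ := hf
  induction l using List.reverseRecOn with
  | nil => simp [h0]
  | append_singleton l a ih => simp [h, ih]

theorem Emb.isPrefix {f : List ℕ → List ℕ} (hf : Emb f) {l l' : List ℕ} (hl : l <+: l') :
    f l <+: f l' := by
  obtain ⟨h0, g, _, h⟩ := hf
  obtain ⟨t, rfl⟩ := hl
  induction t using List.reverseRecOn with
  | nil => simp
  | append_singleton t a ih =>
    rw [← List.append_assoc, h]
    exact ih.trans (List.prefix_append _ _)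

theorem Emb.append_left {f : List ℕ → List ℕ} (hf : Emb f) (t η σ : List ℕ) (h : η <+: σ) :
    t ++ f η = (t ++ f σ).take ((t ++ f σ).length - (σ.length - η.length)) := by
  have hp : t ++ f η <+: t ++ f σ := (List.prefix_append_right_inj t).2 (hf.isPrefix h)
  have hl := h.length_le
  rw [List.prefix_iff_eq_take.1 hp]
  congr 1
  simp only [List.length_append, hf.length]
  omega

end Gen

section Comb

/-- Descending combs: each node branches off to the right of all the later ones. -/
def Comb : List (List ℕ) → Prop
  | [] => True
  | η :: rest => Comb rest ∧ ∃ ν c, ν ++ [c] <+: η ∧ ∀ ζ ∈ rest, ∃ c' < c, ν ++ [c'] <+: ζ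

theorem Comb.map {l : List (List ℕ)} (h : Comb l) {f : List ℕ → List ℕ} (hf : Emb f)
    (t : List ℕ) : Comb (l.map fun η => t ++ f η) := by
  have hfm := hf
  obtain ⟨h0, g, hg, hfg⟩ := hf
  induction l with
  | nil => trivial
  | cons η l ih =>
    obtain ⟨h, ν, c, hη, hl⟩ := h
    have key : ∀ c ζ, ν ++ [c] <+: ζ → (t ++ f ν) ++ [g ν c] <+: t ++ f ζ := by
      intro c ζ hζ
      rw [List.append_assoc, ← hfg]
      exact (List.prefix_append_right_inj t).2 (hfm.isPrefix hζ)
    refine ⟨ih h, t ++ f ν, g ν c, key _ _ hη, fun ζ hζ => ?_⟩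
    obtain ⟨ξ, hξ, rfl⟩ := List.mem_map.1 hζ
    obtain ⟨c', hc', h'⟩ := hl ξ hξ
    exact ⟨_, hg ν hc', key _ _ h'⟩

theorem Comb.ne_nil {l : List (List ℕ)} (h : Comb l) : ∀ η ∈ l, η ≠ [] := by
  induction l with
  | nil => simp
  | cons η l ih =>
    obtain ⟨h, ν, c, hη, hl⟩ := h
    intro ζ hζ
    rcases List.mem_cons.1 hζ with rfl | hζ
    · rintro rfl
      simp at hη
    · exact ih h ζ hζ

end Comb


section BinaryTree

/-- Relation `inc` holds generically between blocks above any node. -/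
def GenInc (n : ℕ) (inc : List ℕ → List ℕ → Prop) : Prop :=
  ∀ v a b, Gen ((a + 1) * n) fun ρ => Gen ((b + 1) * n) fun ρ' => inc (v ++ ρ) (v ++ ρ')

theorem GenInc.exists_tree {n : ℕ} {inc : List ℕ → List ℕ → Prop} (hinc : GenInc n inc) (h : ℕ) :
    ∀ (v : List ℕ) (A : List ℕ → Prop), (∀ m < h, Gen ((m + 1) * n) A) →
      ∃ F : List Bool → List ℕ, (∀ u, u.length < h → A (F u) ∧ (F u).length = (u.length + 1) * n) ∧
        (∀ u u', u <+: u' → u'.length < h → F u <+: F u') ∧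
        ∀ w u u', (w ++ false :: u).length < h → (w ++ true :: u').length < h →
          inc (v ++ F (w ++ false :: u)) (v ++ F (w ++ true :: u')) := by
  induction h with
  | zero => exact fun v A _ => ⟨fun _ => [], by simp, by simp, by simp⟩
  | succ h ih =>
    intro v A hA
    have h0 : Gen n A := by simpa using hA 0 (by omega)
    have h1 : Gen n fun ρ => ∀ m ∈ Set.Iio h, Gen ((m + 1) * n) fun l => A (ρ ++ l) := by
      refine gen_forall_mem (Set.finite_Iio h) fun m hm => ?_
      have := hA (m + 1) (by simpa using hm)
      rw [show (m + 1 + 1) * n = n + (m + 1) * n by ring, gen_add] at this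
      exact this
    obtain ⟨ρ₀, hρ₀, hAρ, hρ⟩ := (h0.and h1).exists
    obtain ⟨FL, hL, hLp, hLi⟩ := ih (v ++ ρ₀)
      (fun ρ => A (ρ₀ ++ ρ) ∧ ∀ b ∈ Set.Iio h,
        Gen ((b + 1) * n) fun ρ' => inc (v ++ ρ₀ ++ ρ) (v ++ ρ₀ ++ ρ'))
      (fun m hm => (hρ m hm).and
        (gen_forall_mem (Set.finite_Iio h) fun b _ => hinc (v ++ ρ₀) m b))
    obtain ⟨FR, hR, hRp, hRi⟩ := ih (v ++ ρ₀)
      (fun ρ' => A (ρ₀ ++ ρ') ∧ ∀ u ∈ {u : List Bool | u.length < h},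
        inc (v ++ ρ₀ ++ FL u) (v ++ ρ₀ ++ ρ'))
      (fun m hm => (hρ m hm).and
        (gen_forall_mem (List.finite_length_lt Bool h) fun u hu => (hL u hu).1.2 m hm))
    refine ⟨fun u => match u with
      | [] => ρ₀
      | false :: u => ρ₀ ++ FL u
      | true :: u => ρ₀ ++ FR u, ?_, ?_, ?_⟩
    · rintro (_ | ⟨c, u⟩) hu
      · exact ⟨hAρ, by simp [hρ₀]⟩
      · have hu' : u.length < h := by simpa using hu
        cases c
        · exact ⟨(hL u hu').1.1, by simp [hρ₀, (hL u hu').2]; ring⟩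
        · exact ⟨(hR u hu').1.1, by simp [hρ₀, (hR u hu').2]; ring⟩
    · rintro (_ | ⟨c, u⟩) (_ | ⟨c', u'⟩) hp hu
      · exact List.prefix_rfl
      · cases c' <;> exact List.prefix_append _ _
      · simp at hp
      · have hu' : u'.length < h := by simpa using hu
        obtain ⟨rfl, hp'⟩ := List.cons_prefix_cons.1 hp
        cases c
        · exact (List.prefix_append_right_inj _).2 (hLp _ _ hp' hu')
        · exact (List.prefix_append_right_inj _).2 (hRp _ _ hp' hu')
    · rintro (_ | ⟨c, w⟩) u u' hu hu'
      · have h1 : u.length < h := by simpa using hu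
        have h2 : u'.length < h := by simpa using hu'
        simpa using (hR u' h2).1.2 u h1
      · have h1 : (w ++ false :: u).length < h := by simpa using hu
        have h2 : (w ++ true :: u').length < h := by simpa using hu'
        cases c
        · simpa using hLi w u u' h1 h2
        · simpa using hRi w u u' h1 h2

end BinaryTree

section Abstract

variable {V : Type v}

/-- All the entries of the nodes of `b` in `s`. -/
def nodes {N : Type*} {P : Type*} (b : N → P → V) (s : Set N) : Set V :=
  {x | ∃ η ∈ s, ∃ i, b η i = x}

theorem nodes_mono {N P : Type*} (b : N → P → V) {s t : Set N} (h : s ⊆ t) :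
    nodes b s ⊆ nodes b t := fun _ ⟨η, hη, i, hi⟩ => ⟨η, h hη, i, hi⟩

/-- The tree `b`, restricted to the nodes in `A`, has consistent paths and `k`-inconsistent
descending combs. -/
def Good (Cns : Set V → Prop) {P : Type*} (k : ℕ) (A : List ℕ → Prop) (b : List ℕ → P → V) :
    Prop :=
  (∀ σ, A σ → Cns (nodes b {η | η <+: σ ∧ η ≠ []})) ∧
    ∀ l, Comb l → l.length = k → (∀ η ∈ l, A η) → ¬ Cns (nodes b {η | η ∈ l})

/-- Compactness for a notion of consistency. -/
def CompactCns (Cns : Set V → Prop) : Prop :=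
  ∀ (I : Type) [Countable I] (Pos Neg : Set (Finset I)),
    (∀ J : Finset I, ∃ v : I → V, (∀ s ∈ Pos, s ⊆ J → Cns (v '' s)) ∧
      ∀ s ∈ Neg, s ⊆ J → ¬ Cns (v '' s)) →
    ∃ v : I → V, (∀ s ∈ Pos, Cns (v '' s)) ∧ ∀ s ∈ Neg, ¬ Cns (v '' s)

theorem nodes_eq_image {N P : Type*} (v : N × P → V) (s : Set N) :
    nodes (fun η i => v (η, i)) s = v '' (s ×ˢ Set.univ) := by
  ext x
  constructor
  · rintro ⟨η, hη, i, rfl⟩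
    exact ⟨(η, i), ⟨hη, trivial⟩, rfl⟩
  · rintro ⟨⟨η, i⟩, ⟨hη, -⟩, rfl⟩
    exact ⟨η, hη, i, rfl⟩

/-- The pair of conditions of a tree notion can be checked on finite sets of nodes. -/
theorem CompactCns.exists_tree {Cns : Set V → Prop} (hc : CompactCns Cns)
    {N P : Type} [Countable N] [Finite P] [Nonempty P]
    (Pos Neg : Set (Set N)) (hPos : ∀ s ∈ Pos, s.Finite) (hNeg : ∀ s ∈ Neg, s.Finite)
    (h : ∀ J : Finset N, ∃ b : N → P → V, (∀ s ∈ Pos, s ⊆ J → Cns (nodes b s)) ∧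
      ∀ s ∈ Neg, s ⊆ J → ¬ Cns (nodes b s)) :
    ∃ b : N → P → V, (∀ s ∈ Pos, Cns (nodes b s)) ∧ ∀ s ∈ Neg, ¬ Cns (nodes b s) := by
  classical
  have fin : ∀ s : Set N, s.Finite → ∃ t : Finset (N × P), (t : Set (N × P)) = s ×ˢ Set.univ :=
    fun s hs => (hs.prod Set.finite_univ).exists_finset_coe
  obtain ⟨v, hv, hv'⟩ := hc (N × P)
    {t | ∃ s ∈ Pos, (t : Set (N × P)) = s ×ˢ Set.univ}
    {t | ∃ s ∈ Neg, (t : Set (N × P)) = s ×ˢ Set.univ} (by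
      intro J
      obtain ⟨b, hb, hb'⟩ := h (J.image Prod.fst)
      have sub : ∀ (s : Set N) (t : Finset (N × P)), (t : Set (N × P)) = s ×ˢ Set.univ → t ⊆ J →
          s ⊆ (J.image Prod.fst : Finset N) := by
        intro s t hst htJ η hη
        have i : P := Classical.arbitrary P
        have : (η, i) ∈ t := by
          rw [← Finset.mem_coe, hst]
          exact ⟨hη, trivial⟩
        exact Finset.mem_coe.2 (Finset.mem_image.2 ⟨_, htJ this, rfl⟩)
      refine ⟨fun p => b p.1 p.2, ?_, ?_⟩
      · rintro t ⟨s, hs, hst⟩ htJ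
        rw [hst, ← nodes_eq_image]
        exact hb s hs (sub s t hst htJ)
      · rintro t ⟨s, hs, hst⟩ htJ
        rw [hst, ← nodes_eq_image]
        exact hb' s hs (sub s t hst htJ))
  refine ⟨fun η i => v (η, i), fun s hs => ?_, fun s hs => ?_⟩
  · obtain ⟨t, ht⟩ := fin s (hPos s hs)
    rw [nodes_eq_image, ← ht]
    exact hv t ⟨s, hs, ht⟩
  · obtain ⟨t, ht⟩ := fin s (hNeg s hs)
    rw [nodes_eq_image, ← ht]
    exact hv' t ⟨s, hs, ht⟩

theorem finite_prefixes {A : Type*} (σ : List A) : {η : List A | η <+: σ}.Finite := by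
  refine (List.finite_toSet σ.inits).subset fun η hη => ?_
  exact (List.mem_inits _ _).2 hη

/-- Nodes of length at most `n` with entries at most `w`. -/
def BddNode (n w : ℕ) (η : List ℕ) : Prop := η.length ≤ n ∧ ∀ x ∈ η, x ≤ w

theorem finite_bddNode (n w : ℕ) : {η | BddNode n w η}.Finite := by
  have : {η : List ℕ | BddNode n w η} ⊆
      (List.map fun i : Fin (w + 1) => (i : ℕ)) '' {l | l.length ≤ n} := by
    intro η hη
    refine ⟨η.pmap (fun x hx => ⟨x, Nat.lt_succ_of_le hx⟩) hη.2, by simpa using hη.1, ?_⟩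
    rw [List.map_pmap]
    simp
  exact ((List.finite_length_le _ n).image _).subset this

theorem exists_good_of_bdd {Cns : Set V → Prop} (hc : CompactCns Cns) {P : Type} [Finite P] [Nonempty P] {k n : ℕ}
    (h : ∀ w, ∃ b : List ℕ → P → V, Good Cns k (BddNode n w) b) :
    ∃ b : List ℕ → P → V, Good Cns k (fun η => η.length ≤ n) b := by
  obtain ⟨b, hb, hb'⟩ := hc.exists_tree (N := List ℕ) (P := P)
    {s | ∃ σ : List ℕ, σ.length ≤ n ∧ s = {η | η <+: σ ∧ η ≠ []}}
    {s | ∃ l, Comb l ∧ l.length = k ∧ (∀ η ∈ l, η.length ≤ n) ∧ s = {η | η ∈ l}}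
    (by
      rintro s ⟨σ, -, rfl⟩
      exact (finite_prefixes σ).subset fun η hη => hη.1)
    (by
      rintro s ⟨l, -, -, -, rfl⟩
      exact List.finite_toSet l)
    (by
      intro J
      obtain ⟨w, hw⟩ := (J.finite_toSet.biUnion fun η _ => List.finite_toSet η).bddAbove
      have hw' : ∀ η ∈ J, ∀ x ∈ η, x ≤ w := fun η hη x hx =>
        hw (Set.mem_iUnion₂.2 ⟨η, hη, hx⟩)
      obtain ⟨b, hb, hb'⟩ := h w
      refine ⟨b, ?_, ?_⟩
      · rintro s ⟨σ, hσ, rfl⟩ hJ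
        refine hb σ ⟨hσ, fun x hx => ?_⟩
        exact hw' σ (hJ ⟨List.prefix_rfl, List.ne_nil_of_mem hx⟩) x hx
      · rintro s ⟨l, hl, hlk, hln, rfl⟩ hJ
        exact hb' l hl hlk fun η hη => ⟨hln η hη, hw' η (hJ hη)⟩)
  exact ⟨b, fun σ hσ => hb _ ⟨σ, hσ, rfl⟩, fun l hl hlk hln => hb' _ ⟨l, hl, hlk, hln, rfl⟩⟩

/-- The last `n` nodes of the path up to `p`. -/
def blk {P : Type*} (n : ℕ) (b : List ℕ → P → V) (p : List ℕ) : Fin n × P → V :=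
  fun j => b (p.take (p.length - j.1)) j.2

/-- Two blocks inside the first `N` levels are inconsistent. -/
def BlkInc (Cns : Set V → Prop) {P : Type*} (n N : ℕ) (b : List ℕ → P → V) (p p' : List ℕ) :
    Prop :=
  p.length ≤ N → p'.length ≤ N → ¬ Cns (Set.range (blk n b p) ∪ Set.range (blk n b p'))

/-- A tree witnessing `SOP₂` for finite heights, using tuples of size `Q`. -/
def FinSOP2 (Cns : Set V → Prop) (Q : Type) : Prop :=
  ∀ h : ℕ, ∃ F : List Bool → Q → V,
    (∀ σ, σ.length < h → Cns (nodes F {η | η <+: σ})) ∧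
      ∀ η η', η.length < h → η'.length < h → ¬ η <+: η' → ¬ η' <+: η →
        ¬ Cns (nodes F {η, η'})

theorem exists_split {η η' : List Bool} (h : ¬ η <+: η') (h' : ¬ η' <+: η) :
    ∃ w u u', (η = w ++ false :: u ∧ η' = w ++ true :: u') ∨
      (η' = w ++ false :: u ∧ η = w ++ true :: u') := by
  induction η generalizing η' with
  | nil => simp at h
  | cons a η ih =>
    rcases η' with _ | ⟨a', η'⟩
    · simp at h'
    · by_cases haa : a = a'
      · subst haa
        obtain ⟨w, u, u', hw⟩ := ih (fun hh => h (by simpa using hh)) (fun hh => h' (by simpa using hh))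
        refine ⟨a :: w, u, u', ?_⟩
        rcases hw with ⟨rfl, rfl⟩ | ⟨rfl, rfl⟩ <;> simp
      · cases a <;> cases a' <;> simp at haa
        · exact ⟨[], η, η', Or.inl ⟨rfl, rfl⟩⟩
        · exact ⟨[], η', η, Or.inr ⟨rfl, rfl⟩⟩

theorem finSOP2_of_genInc {Cns : Set V → Prop} (hmono : ∀ s t, s ⊆ t → Cns t → Cns s)
    {P : Type} {k n : ℕ}
    (hgood : ∀ N, ∃ b : List ℕ → P → V, Good Cns k (fun η => η.length ≤ N) b)
    (hinc : ∀ N (b : List ℕ → P → V), Good Cns k (fun η => η.length ≤ N) b →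
      GenInc n (BlkInc Cns n N b)) : FinSOP2 Cns (Fin n × P) := by
  intro h
  obtain ⟨b, hb⟩ := hgood (h * n)
  obtain ⟨F, hF, hFp, hFi⟩ := (hinc _ b hb).exists_tree h [] (fun _ => True)
    (fun _ _ => gen_of_forall fun _ => trivial)
  have hlen : ∀ u, u.length < h → (F u).length ≤ h * n := fun u hu => by
    rw [(hF u hu).2]
    exact Nat.mul_le_mul_right _ hu
  refine ⟨fun u => blk n b (F u), fun σ hσ => ?_, fun η η' hη hη' h1 h2 => ?_⟩
  · refine hmono _ _ ?_ (hb.1 (F σ) (hlen σ hσ))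
    rintro x ⟨u, hu, ⟨j, i⟩, rfl⟩
    have hu' : u.length < h := hu.length_le.trans_lt hσ
    refine ⟨_, ⟨(List.take_prefix _ _).trans (hFp u σ hu hσ), ?_⟩, i, rfl⟩
    have h1 : n ≤ (F u).length := by
      rw [(hF u hu').2]
      exact Nat.le_mul_of_pos_left _ (Nat.succ_pos _)
    have h2 := j.2
    intro h0
    have := congrArg List.length h0
    simp only [List.length_take, List.length_nil] at this
    omega
  · have key : ∀ w u u', (w ++ false :: u).length < h → (w ++ true :: u').length < h →
        ¬ Cns (Set.range (blk n b (F (w ++ false :: u))) ∪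
          Set.range (blk n b (F (w ++ true :: u')))) :=
      fun w u u' hu hu' => hFi w u u' hu hu' (hlen _ hu) (hlen _ hu')
    obtain ⟨w, u, u', ⟨rfl, rfl⟩ | ⟨rfl, rfl⟩⟩ := exists_split h1 h2
    all_goals
      refine fun hC => key w u u' (by assumption) (by assumption) (hmono _ _ ?_ hC)
      rintro x (⟨j, rfl⟩ | ⟨j, rfl⟩)
      · exact ⟨_, by simp, j, rfl⟩
      · exact ⟨_, by simp, j, rfl⟩

/-- If two generic blocks are consistent, then one can halve the inconsistency of combs by pairing
the nodes. -/
theorem genInc_of_bad {Cns : Set V → Prop} (hmono : ∀ s t, s ⊆ t → Cns t → Cns s)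
    {P : Type} {k n w N : ℕ} (hbad : ¬ ∃ b : List ℕ → P ⊕ P → V, Good Cns (k + 1) (BddNode n w) b)
    {b : List ℕ → P → V} (hb : Good Cns (k + 2) (fun η => η.length ≤ N) b) :
    GenInc n (BlkInc Cns n N b) := by
  intro v a a'
  by_contra hcon
  rw [← gen_not] at hcon
  simp only [← gen_not] at hcon
  rw [Nat.succ_mul a n, gen_add] at hcon
  obtain ⟨ρ, hρ, hcon⟩ := hcon.exists
  obtain ⟨f, hf, hcon⟩ := hcon.exists_emb
  let Sg : Set (List ℕ) := {σ | BddNode n w σ ∧ σ.length = n}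
  have hSg : Sg.Finite := (finite_bddNode n w).subset fun σ hσ => hσ.1
  obtain ⟨K, hK⟩ := (hSg.biUnion fun σ _ => List.finite_toSet (ρ ++ f σ)).bddAbove
  have hK' : ∀ σ ∈ Sg, ∀ x ∈ ρ ++ f σ, x ≤ K := fun σ hσ x hx =>
    hK (Set.mem_iUnion₂.2 ⟨σ, hσ, hx⟩)
  have hcon := (gen_forall_mem hSg fun σ hσ => hcon σ hσ.2).and (gen_lt _ K)
  rw [Nat.succ_mul a' n, gen_add] at hcon
  obtain ⟨ρ', hρ', hcon⟩ := hcon.exists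
  obtain ⟨f', hf', hcon⟩ := hcon.exists_emb
  have hpad : ∀ σ, BddNode n w σ → ∃ τ ∈ Sg, σ <+: τ := fun σ hσ =>
    ⟨σ ++ List.replicate (n - σ.length) 0, ⟨⟨by simp [hσ.1], fun x hx => by
      rcases List.mem_append.1 hx with hx | hx
      · exact hσ.2 x hx
      · simp [List.eq_of_mem_replicate hx]⟩, by simp [hσ.1]⟩, List.prefix_append _ _⟩
  have hblk : ∀ (t : List ℕ) (f : List ℕ → List ℕ), Emb f → ∀ η τ, η <+: τ → η ≠ [] →
      τ.length = n → ∀ i, b (t ++ f η) i ∈ Set.range (blk n b (t ++ f τ)) := by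
    intro t f hf η τ hη hη0 hτ i
    have := hη.length_le
    have := List.length_pos_iff.2 hη0
    refine ⟨(⟨τ.length - η.length, by omega⟩, i), ?_⟩
    rw [hf.append_left t η τ hη]
    rfl
  have hfail : ∀ τ ∈ Sg, (v ++ ρ ++ f τ).length ≤ N ∧ (v ++ ρ' ++ f' τ).length ≤ N ∧
      Cns (Set.range (blk n b (v ++ ρ ++ f τ)) ∪ Set.range (blk n b (v ++ ρ' ++ f' τ))) := by
    intro τ hτ
    have h1 := (hcon τ hτ.2).1 τ hτ
    simp only [BlkInc, not_forall, not_not, exists_prop, ← List.append_assoc] at h1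
    exact h1
  refine hbad ⟨fun η => Sum.elim (b (v ++ ρ ++ f η)) (b (v ++ ρ' ++ f' η)), ?_, ?_⟩
  · intro σ hσ
    obtain ⟨τ, hτ, hστ⟩ := hpad σ hσ
    refine hmono _ _ ?_ (hfail τ hτ).2.2
    rintro x ⟨η, ⟨hη, hη0⟩, i | i, rfl⟩
    · exact Or.inl (hblk _ f hf η τ (hη.trans hστ) hη0 hτ.2 i)
    · exact Or.inr (hblk _ f' hf' η τ (hη.trans hστ) hη0 hτ.2 i)
  · intro l hl hlk hlA hC
    rcases l with _ | ⟨η₀, l⟩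
    · simp at hlk
    have hlen : ∀ ζ ∈ η₀ :: l, (v ++ ρ ++ f ζ).length ≤ N ∧ (v ++ ρ' ++ f' ζ).length ≤ N := by
      intro ζ hζ
      obtain ⟨τ, hτ, hζτ⟩ := hpad ζ (hlA ζ hζ)
      have h1 := hfail τ hτ
      have h2 := hζτ.length_le
      have h3 := h1.1
      have h4 := h1.2.1
      simp only [List.length_append, hf.length, hf'.length] at h3 h4 ⊢
      omega
    have hη₀ : η₀ ≠ [] := hl.ne_nil η₀ (by simp)
    have hlast : ∃ c s, ρ' ++ f' η₀ = c :: s ∧ K < c := by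
      obtain ⟨τ, hτ, hζτ⟩ := hpad η₀ (hlA η₀ (by simp))
      rcases h : ρ' ++ f' η₀ with _ | ⟨c, s⟩
      · have := congrArg List.length h
        simp only [List.length_append, hf'.length, List.length_nil] at this
        have := List.length_pos_iff.2 hη₀
        omega
      · refine ⟨c, s, rfl, (hcon τ hτ.2).2 c ?_⟩
        have : ρ' ++ f' η₀ <+: ρ' ++ f' τ := (List.prefix_append_right_inj _).2 (hf'.isPrefix hζτ)
        exact this.subset (by simp [h])
    obtain ⟨c, s, hcs, hKc⟩ := hlast
    refine hb.2 ((v ++ ρ' ++ f' η₀) :: (η₀ :: l).map fun η => v ++ ρ ++ f η)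
      ⟨hl.map hf _, v, c, ?_, ?_⟩ ?_ ?_ (hmono _ _ ?_ hC)
    · rw [List.append_assoc, hcs]
      simp
    · intro ζ hζ
      obtain ⟨ξ, hξ, rfl⟩ := List.mem_map.1 hζ
      obtain ⟨τ, hτ, hξτ⟩ := hpad ξ (hlA ξ hξ)
      have hp : ρ ++ f ξ <+: ρ ++ f τ := (List.prefix_append_right_inj _).2 (hf.isPrefix hξτ)
      have hξ0 : ξ ≠ [] := hl.ne_nil ξ hξ
      rcases h : ρ ++ f ξ with _ | ⟨c', s'⟩
      · have := congrArg List.length h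
        simp only [List.length_append, hf.length, List.length_nil] at this
        have := List.length_pos_iff.2 hξ0
        omega
      · refine ⟨c', (hK' τ hτ c' (hp.subset (by simp [h]))).trans_lt hKc, ?_⟩
        rw [List.append_assoc, h]
        simp
    · simpa using hlk
    · intro ζ hζ
      rcases List.mem_cons.1 hζ with rfl | hζ
      · exact (hlen η₀ (by simp)).2
      · obtain ⟨ξ, hξ, rfl⟩ := List.mem_map.1 hζ
        exact (hlen ξ hξ).1
    · rintro x ⟨ζ, hζ, i, rfl⟩
      rcases List.mem_cons.1 hζ with rfl | hζ
      · exact ⟨η₀, by simp, Sum.inr i, rfl⟩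
      · obtain ⟨ξ, hξ, rfl⟩ := List.mem_map.1 hζ
        exact ⟨ξ, hξ, Sum.inl i, rfl⟩

theorem exists_finSOP2 {Cns : Set V → Prop} (hc : CompactCns Cns)
    (hmono : ∀ s t, s ⊆ t → Cns t → Cns s) (k : ℕ) :
    ∀ (P : Type) [Finite P] [Nonempty P],
      (∀ N, ∃ b : List ℕ → P → V, Good Cns k (fun η => η.length ≤ N) b) →
      ∃ Q : Type, Finite Q ∧ FinSOP2 Cns Q := by
  have base : ∀ (P : Type) (b : List ℕ → P → V), Good Cns 1 (fun η => η.length ≤ 1) b → False := by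
    intro P b hb
    refine hb.2 [ [0] ] ⟨trivial, [], 0, by simp, by simp⟩ rfl (by simp) ?_
    refine hmono _ _ (nodes_mono b ?_) (hb.1 [0] (by simp))
    rintro η hη
    simp only [List.mem_singleton, Set.mem_ofPred_eq] at hη
    simp [hη]
  rcases k with _ | k
  · intro P _ _ h
    obtain ⟨b, hb⟩ := h 0
    refine absurd (hmono _ _ ?_ (hb.1 [] (by simp))) (hb.2 [] trivial rfl (by simp))
    rintro x ⟨η, hη, -⟩
    simp at hη
  induction k with
  | zero =>
    intro P _ _ h
    obtain ⟨b, hb⟩ := h 1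
    exact (base P b hb).elim
  | succ k ih =>
    intro P _ _ h
    by_cases hbad : ∀ n w, ∃ b : List ℕ → P ⊕ P → V, Good Cns (k + 1) (BddNode n w) b
    · exact ih (P ⊕ P) fun n => exists_good_of_bdd hc (hbad n)
    · push Not at hbad
      obtain ⟨n, w, hbad⟩ := hbad
      refine ⟨Fin n × P, inferInstance, finSOP2_of_genInc hmono h fun N b hb =>
        genInc_of_bad hmono (n := n) (w := w) (k := k) ?_ hb⟩
      push Not
      exact hbad

end Abstract


variable {L : FirstOrder.Language.{u, u}} {𝕄 : Type u} [L.Structure 𝕄] {κ : Cardinal.{u}}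
  {α : Type v}

/-- The instances of `φ(x, y)` at the tuples in `s` are simultaneously satisfiable. -/
def FCns {m : ℕ} (φ : L.Formula (α ⊕ Fin m)) (s : Set (Fin m → 𝕄)) : Prop :=
  ∃ x : α → 𝕄, ∀ y ∈ s, φ.Realize (Sum.elim x y)

theorem FCns.mono {m : ℕ} {φ : L.Formula (α ⊕ Fin m)} {s t : Set (Fin m → 𝕄)} (h : FCns φ t)
    (hst : s ⊆ t) : FCns φ s := by
  obtain ⟨x, hx⟩ := h
  exact ⟨x, fun y hy => hx y (hst hy)⟩

theorem definable_fcns [Nonempty 𝕄] {m : ℕ} (φ : L.Formula (α ⊕ Fin m)) {I : Type w}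
    (s : Finset I) :
    (∅ : Set 𝕄).Definable L
      {v : I × Fin m → 𝕄 | FCns φ ((fun i j => v (i, j)) '' (s : Set I))} := by
  have h1 : ∀ i : I, (∅ : Set 𝕄).Definable L
      {w : α ⊕ (I × Fin m) → 𝕄 | φ.Realize (Sum.elim (w ∘ Sum.inl) fun j => w (Sum.inr (i, j)))} := by
    intro i
    have h0 : (∅ : Set 𝕄).Definable L {x : α ⊕ Fin m → 𝕄 | φ.Realize x} :=
      (Set.empty_definable_iff).2 ⟨φ, rfl⟩
    have := h0.preimage_comp (Sum.map id fun j => (i, j) : α ⊕ Fin m → α ⊕ (I × Fin m))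
    convert this using 1
    ext w
    simp only [Set.mem_ofPred_eq, Set.mem_preimage]
    congr! 1
    funext j
    rcases j with j | j <;> rfl
  have h2 := Set.definable_biInter_finset h1 s
  have h3 := Definable.image_comp_of_injective h2
    (f := (Sum.inr : I × Fin m → α ⊕ (I × Fin m))) Sum.inr_injective
  convert h3 using 1
  ext v
  simp only [Set.mem_ofPred_eq, Set.mem_image, Set.mem_iInter]
  constructor
  · rintro ⟨x, hx⟩
    exact ⟨Sum.elim x v, fun i hi => hx _ ⟨i, hi, rfl⟩, rfl⟩
  · rintro ⟨w, hw, rfl⟩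
    refine ⟨w ∘ Sum.inl, ?_⟩
    rintro y ⟨i, hi, rfl⟩
    exact hw i hi

theorem IsMonster.compactCns [Nonempty 𝕄] (hm : IsMonster L 𝕄 κ) {m : ℕ}
    (φ : L.Formula (α ⊕ Fin m)) : CompactCns (FCns (𝕄 := 𝕄) φ) := by
  intro I _ Pos Neg h
  classical
  obtain ⟨v, hv⟩ := hm.exists_mem (α := I × Fin m) (Small.of_countable hm.1 _) (C := ∅)
    (Small.of_countable hm.1 _)
    (fun s : Pos ⊕ Neg => Sum.elim
      (fun s : Pos => {v : I × Fin m → 𝕄 | FCns φ ((fun i j => v (i, j)) '' (s.1 : Set I))})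
      (fun s : Neg => {v : I × Fin m → 𝕄 | FCns φ ((fun i j => v (i, j)) '' (s.1 : Set I))}ᶜ) s)
    (by
      rintro (s | s)
      · exact definable_fcns φ s.1
      · exact (definable_fcns φ s.1).compl)
    (by
      intro t
      obtain ⟨v, hv, hv'⟩ := h (t.biUnion (Sum.elim (fun s : Pos => s.1) fun s : Neg => s.1))
      refine ⟨fun p => v p.1 p.2, ?_⟩
      rintro (s | s) hs
      · exact hv s.1 s.2 (Finset.subset_biUnion_of_mem
          (Sum.elim (fun s : Pos => s.1) fun s : Neg => s.1) hs)
      · exact hv' s.1 s.2 (Finset.subset_biUnion_of_mem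
          (Sum.elim (fun s : Pos => s.1) fun s : Neg => s.1) hs))
  exact ⟨fun i j => v (i, j), fun s hs => hv (Sum.inl ⟨s, hs⟩), fun s hs => hv (Sum.inr ⟨s, hs⟩)⟩

/-- Only finitely many of the object variables of a formula matter. -/
theorem exists_formula_fin [Nonempty 𝕄] {m : ℕ} (φ : L.Formula (α ⊕ Fin m)) :
    ∃ (r : ℕ) (ψ : L.Formula (Fin r ⊕ Fin m)),
      ∀ s : Set (Fin m → 𝕄), FCns ψ s ↔ FCns φ s := by
  classical
  rcases isEmpty_or_nonempty α with hα | ⟨⟨a₀⟩⟩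
  · refine ⟨0, φ.relabel (Sum.map (fun a => isEmptyElim a) id), fun s => ?_⟩
    simp only [FCns, Formula.realize_relabel]
    refine ⟨fun ⟨x, hx⟩ => ⟨fun a => isEmptyElim a, fun y hy => ?_⟩,
      fun ⟨x, hx⟩ => ⟨fun a => a.elim0, fun y hy => ?_⟩⟩
    · convert hx y hy using 1
      funext j
      rcases j with j | j
      · exact isEmptyElim j
      · rfl
    · convert hx y hy using 1
      funext j
      rcases j with j | j
      · exact isEmptyElim j
      · rfl
  obtain ⟨F, S', -, hS'⟩ := Definable.exists_finset
    ((Set.empty_definable_iff (L := L)).2 ⟨φ, rfl⟩ :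
      (∅ : Set 𝕄).Definable L {x : α ⊕ Fin m → 𝕄 | φ.Realize x})
  let G : Finset α := insert a₀ (F.preimage Sum.inl Sum.inl_injective.injOn)
  let e := G.equivFin
  let t : α → Fin G.card := fun a =>
    if h : a ∈ G then e ⟨a, h⟩ else e ⟨a₀, Finset.mem_insert_self _ _⟩
  refine ⟨G.card, φ.relabel (Sum.map t id), fun s => ?_⟩
  simp only [FCns, Formula.realize_relabel]
  constructor
  · rintro ⟨x, hx⟩
    refine ⟨x ∘ t, fun y hy => ?_⟩
    convert hx y hy using 1
    funext j
    rcases j with j | j <;> rfl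
  · rintro ⟨x, hx⟩
    refine ⟨fun j => x (e.symm j), fun y hy => ?_⟩
    have h1 := hx y hy
    change _ ∈ {x : α ⊕ Fin m → 𝕄 | φ.Realize x} at h1
    change _ ∈ {x : α ⊕ Fin m → 𝕄 | φ.Realize x}
    rw [hS'] at h1 ⊢
    convert h1 using 1
    funext ⟨j, hj⟩
    rcases j with j | j
    · have hjG : j ∈ G := Finset.mem_insert_of_mem (Finset.mem_preimage.2 hj)
      simp [t, hjG]
    · rfl

theorem hasSOP2_of_finSOP2 [Nonempty 𝕄] (hm : IsMonster L 𝕄 κ) {r m : ℕ}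
    (φ : L.Formula (Fin r ⊕ Fin m)) {Q : Type} [Finite Q] (h : FinSOP2 (FCns (𝕄 := 𝕄) φ) Q) :
    HasSOP2 L 𝕄 := by
  classical
  rcases isEmpty_or_nonempty Q with hQ | hQ
  · obtain ⟨F, h1, h2⟩ := h 2
    refine absurd ?_ (h2 [true] [false] (by simp) (by simp) (by simp) (by simp))
    exact (h1 [] (by simp)).mono fun x ⟨_, _, i, _⟩ => isEmptyElim i
  obtain ⟨F, hF, hF'⟩ := (hm.compactCns φ).exists_tree (N := List Bool) (P := Q)
    {s | ∃ σ, s = {η | η <+: σ}}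
    {s | ∃ η η', ¬ η <+: η' ∧ ¬ η' <+: η ∧ s = {η, η'}}
    (by
      rintro s ⟨σ, rfl⟩
      exact finite_prefixes σ)
    (by
      rintro s ⟨η, η', -, -, rfl⟩
      exact Set.toFinite _)
    (by
      intro J
      obtain ⟨F, h1, h2⟩ := h (J.sup List.length + 1)
      have hJ : ∀ η ∈ J, η.length < J.sup List.length + 1 := fun η hη =>
        Nat.lt_succ_of_le (Finset.le_sup (f := List.length) hη)
      refine ⟨F, ?_, ?_⟩
      · rintro s ⟨σ, rfl⟩ hs
        exact h1 σ (hJ σ (hs List.prefix_rfl))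
      · rintro s ⟨η, η', hη, hη', rfl⟩ hs
        exact h2 η η' (hJ _ (hs (by simp))) (hJ _ (hs (by simp))) hη hη')
  obtain ⟨M, ⟨e⟩⟩ := Finite.exists_equiv_fin (Q × Fin m)
  have : Finite Q := inferInstance
  let ψ : L.Formula (Fin r ⊕ Fin M) :=
    Formula.iInf fun q : Q => φ.relabel (Sum.map id fun i => e (q, i))
  have hψ : ∀ (x : Fin r → 𝕄) (η : List Bool),
      ψ.Realize (Sum.elim x fun j => F η (e.symm j).1 (e.symm j).2) ↔
        ∀ q, φ.Realize (Sum.elim x (F η q)) := by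
    intro x η
    simp only [ψ, Formula.realize_iInf, Formula.realize_relabel]
    refine forall_congr' fun q => ?_
    congr! 1
    funext j
    rcases j with j | j <;> simp
  refine ⟨r, M, ψ, fun η j => F η (e.symm j).1 (e.symm j).2, fun σ => ?_, fun η η' hη hη' => ?_⟩
  · have hdef : ∀ n : ℕ, (⋃ η, ⋃ q, Set.range (F η q)).Definable L
        {x : Fin r → 𝕄 | ∀ q : Q, φ.Realize (Sum.elim x (F (List.ofFn fun i : Fin n => σ i) q))} := by
      intro n
      have := Set.definable_biInter_finset (L := L) (A := ⋃ η, ⋃ q, Set.range (F η q))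
        (f := fun q : Q =>
          {x : Fin r → 𝕄 | φ.Realize (Sum.elim x (F (List.ofFn fun i : Fin n => σ i) q))})
        (fun q => definable_of_formula φ _ fun i =>
          Set.mem_iUnion₂.2 ⟨_, q, Set.mem_range_self i⟩)
        (Set.toFinite (Set.univ : Set Q)).toFinset
      convert this using 1
      ext x
      simp
    obtain ⟨x, hx⟩ := hm.exists_mem (α := Fin r) (Small.of_countable hm.1 _)
      (C := ⋃ η, ⋃ q, Set.range (F η q)) (by
        have : (⋃ η, ⋃ q, Set.range (F η q)).Countable :=
          Set.countable_iUnion fun η => Set.countable_iUnion fun q => Set.countable_range _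
        have := this.to_subtype
        exact Small.of_countable hm.1 _) _ hdef (by
        intro t
        obtain ⟨x, hx⟩ := hF _ ⟨List.ofFn fun i : Fin (t.sup id) => σ i, rfl⟩
        refine ⟨x, fun n hn q => hx _ ⟨_, ?_, q, rfl⟩⟩
        have hle : n ≤ t.sup id := Finset.le_sup (f := id) hn
        simp only [Set.mem_ofPred_eq]
        rw [List.prefix_iff_eq_take]
        refine List.ext_getElem (by simp [hle]) fun i h1 h2 => by simp)
    exact ⟨x, fun n => (hψ x _).2 (hx n)⟩
  · rintro ⟨x, hx, hx'⟩
    refine hF' _ ⟨η, η', hη, hη', rfl⟩ ⟨x, ?_⟩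
    rintro y ⟨ζ, hζ, q, rfl⟩
    rcases hζ with rfl | rfl
    · exact (hψ x _).1 hx q
    · exact (hψ x _).1 hx' q

/-- In an `NSOP₂` theory there are no trees of arbitrarily large finite height with consistent paths
and `k`-inconsistent descending combs. -/
theorem not_forall_exists_comb_tree [Nonempty 𝕄] (hm : IsMonster L 𝕄 κ) (hN : ¬ HasSOP2 L 𝕄)
    {m : ℕ} (φ : L.Formula (α ⊕ Fin m)) (k : ℕ)
    (h : ∀ N, ∃ b : List ℕ → Fin m → 𝕄,
      (∀ σ, σ.length = N → ∃ x : α → 𝕄, ∀ η, η <+: σ → φ.Realize (Sum.elim x (b η))) ∧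
      ∀ l, Comb l → l.length = k → (∀ η ∈ l, η.length ≤ N) →
        ¬ ∃ x : α → 𝕄, ∀ η ∈ l, φ.Realize (Sum.elim x (b η))) : False := by
  obtain ⟨r, ψ, hψ⟩ := exists_formula_fin (𝕄 := 𝕄) φ
  obtain ⟨Q, _, hQ⟩ := exists_finSOP2 (hm.compactCns ψ) (fun s t hst ht => ht.mono hst) k Unit
    (by
      intro N
      obtain ⟨b, hb, hb'⟩ := h N
      refine ⟨fun η _ => b η, fun σ hσ => ?_, fun l hl hlk hlN => ?_⟩
      · obtain ⟨x, hx⟩ := hb (σ ++ List.replicate (N - σ.length) 0) (by simp [hσ])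
        rw [hψ]
        refine ⟨x, ?_⟩
        rintro y ⟨η, ⟨hη, -⟩, -, rfl⟩
        exact hx η (hη.trans (List.prefix_append _ _))
      · rw [hψ]
        rintro ⟨x, hx⟩
        exact hb' l hl hlk hlN ⟨x, fun η hη => hx _ ⟨η, hη, (), rfl⟩⟩)
  exact hN (hasSOP2_of_finSOP2 hm ψ hQ)


section Dividing

variable {L : FirstOrder.Language.{u, u}} {𝕄 : Type u} [L.Structure 𝕄] {κ : Cardinal.{u}}
  {α : Type v} {β : Type w} {γ : Type x} {Ms : Set 𝕄}

theorem MorleySeq.of_map {𝒟 : Ultrafilter (β → 𝕄)} {𝓔 : Ultrafilter (γ → 𝕄)} {C : Set 𝕄}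
    {Y : ℕ → γ → 𝕄} (h : MorleySeq L 𝓔 C Y) {f : β → γ}
    (hf : ∀ S : Set (β → 𝕄), (Set.univ : Set 𝕄).Definable L S → S ∈ 𝒟 → {x | x ∘ f ∈ S} ∈ 𝓔) :
    MorleySeq L 𝒟 C fun i => Y i ∘ f := fun i =>
  ((h i).of_map hf).mono (Set.union_subset_union_right _ (Set.iUnion₂_mono fun _ _ =>
    Set.range_comp_subset_range _ _))

theorem MorleySeq.map {𝓔 : Ultrafilter (γ → 𝕄)} {C : Set 𝕄} {Y : ℕ → γ → 𝕄}
    (h : MorleySeq L 𝓔 C Y) (f : β → γ) :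
    MorleySeq L (𝓔.map fun x => x ∘ f) C fun i => Y i ∘ f :=
  h.of_map fun _ _ hS => hS

/-- The fibre at `b` of the definable relation `S` Conant-divides. -/
def CDiv (L : FirstOrder.Language.{u, u}) {𝕄 : Type u} [L.Structure 𝕄] (Ms : Set 𝕄)
    {α : Type v} {β : Type w} (S : Set (α ⊕ β → 𝕄)) (b : β → 𝕄) : Prop :=
  ∀ (𝒟 : Ultrafilter (β → 𝕄)) (Y : ℕ → β → 𝕄), Coh Ms 𝒟 → MorleySeq L 𝒟 Ms Y → Y 0 = b →
    ¬ ∃ x : α → 𝕄, ∀ i, Sum.elim x (Y i) ∈ S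

/-- No fibre at `b` of an `Ms`-definable relation holding at `a` Conant-divides. -/
def ND (L : FirstOrder.Language.{u, u}) {𝕄 : Type u} [L.Structure 𝕄] (Ms : Set 𝕄)
    {α : Type v} {β : Type w} (a : α → 𝕄) (b : β → 𝕄) : Prop :=
  ∀ S : Set (α ⊕ β → 𝕄), Ms.Definable L S → Sum.elim a b ∈ S → ¬ CDiv L Ms S b

theorem conantDivides_iff {n : ℕ} {φ : L.Formula (α ⊕ Fin n)} {d : Fin n → 𝕄} :
    ConantDivides L Ms φ d ↔ CDiv L Ms {z | φ.Realize z} d := by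
  constructor
  · intro h 𝒟 Y h𝒟 hY h0
    exact h Y (coheirMorley_iff.2 ⟨𝒟, h𝒟, hY⟩) h0
  · intro h Y hY h0
    obtain ⟨𝒟, h𝒟, hY⟩ := coheirMorley_iff.1 hY
    exact h 𝒟 Y h𝒟 hY h0

/-- Moving the first variables of a relation, as well as its parameters, by an automorphism. -/
theorem Definable.elim_equiv_iff {S : Set (α ⊕ β → 𝕄)} (hS : Ms.Definable L S) {σ : 𝕄 ≃[L] 𝕄}
    (hσ : ∀ x ∈ Ms, σ x = x) (x : α → 𝕄) (y : β → 𝕄) :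
    Sum.elim (σ ∘ x) (σ ∘ y) ∈ S ↔ Sum.elim x y ∈ S := by
  rw [← Sum.comp_elim]
  exact Definable.mem_equiv_iff hS hσ _

theorem not_cDiv_of_morleySeq (hm : IsMonster L 𝕄 κ) (hβ : Small κ β) (hMs : Small κ Ms)
    {𝒟 : Ultrafilter (γ → 𝕄)} (h𝒟 : Coh Ms 𝒟) {Y : ℕ → γ → 𝕄} (hY : MorleySeq L 𝒟 Ms Y)
    {g : β → γ} {S : Set (α ⊕ β → 𝕄)} (hS : Ms.Definable L S) {x : α → 𝕄}
    (hx : ∀ i, Sum.elim x (Y i ∘ g) ∈ S) {d : β → 𝕄} (hd : EqTpOver L Ms (Y 0 ∘ g) d) :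
    ¬ CDiv L Ms S d := by
  obtain ⟨σ, hσ, hσd⟩ := hm.exists_equiv hβ hMs hd
  intro h
  have h1 := ((hY.map g).equiv (h𝒟.map g) hσ)
  rw [image_eq_of_fix hσ] at h1
  exact h _ _ (h𝒟.map g) h1 hσd ⟨σ ∘ x, fun i => (Definable.elim_equiv_iff hS hσ _ _).2 (hx i)⟩

theorem CDiv.of_eqTp (hm : IsMonster L 𝕄 κ) (hβ : Small κ β) (hMs : Small κ Ms)
    {S : Set (α ⊕ β → 𝕄)} (hS : Ms.Definable L S) {b c : β → 𝕄} (h : CDiv L Ms S b)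
    (hbc : EqTpOver L Ms b c) : CDiv L Ms S c := by
  rintro 𝒟 Y h𝒟 hY rfl ⟨x, hx⟩
  exact not_cDiv_of_morleySeq hm hβ hMs h𝒟 hY (g := id) hS hx hbc.symm h

theorem ND.of_eqTp (hm : IsMonster L 𝕄 κ) (hβ : Small κ β) (hMs : Small κ Ms)
    {a a' : α → 𝕄} {b b' : β → 𝕄} (h : ND L Ms a b)
    (h' : EqTpOver L Ms (Sum.elim a b) (Sum.elim a' b')) : ND L Ms a' b' := by
  intro S hS hab hd
  refine h S hS ((eqTpOver_iff.1 h' S hS).2 hab) (hd.of_eqTp hm hβ hMs hS ?_)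
  exact (h'.comp Sum.inr).symm

theorem CDiv.comap (hm : IsMonster L 𝕄 κ) (hβ : Small κ β) (hMs : Small κ Ms)
    {S : Set (α ⊕ β → 𝕄)} (hS : Ms.Definable L S) {c : γ → 𝕄} {g : β → γ}
    (h : CDiv L Ms S (c ∘ g)) : CDiv L Ms {z | z ∘ Sum.map id g ∈ S} c := by
  rintro 𝒟 Y h𝒟 hY rfl ⟨x, hx⟩
  refine not_cDiv_of_morleySeq hm hβ hMs h𝒟 hY (g := g) hS (x := x) (fun i => ?_)
    (EqTpOver.refl _) h
  have := hx i
  simpa only [Set.mem_ofPred_eq, Sum.elim_comp_map, Function.comp_id] using this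

theorem exists_not_cDiv [Nonempty 𝕄] (hm : IsMonster L 𝕄 κ) (hβ : Small κ β) (hγ : Small κ γ)
    (hMe : IsElemSubmodel L Ms) (hMs : Small κ Ms) {ι : Type} [Finite ι]
    {S : Set (α ⊕ β → 𝕄)} (hS : Ms.Definable L S) {b : β → 𝕄} {T : ι → Set (α ⊕ γ → 𝕄)}
    (hT : ∀ j, Ms.Definable L (T j)) {c : γ → 𝕄} (hSb : ¬ CDiv L Ms S b)
    (hST : ∀ x : α → 𝕄, Sum.elim x b ∈ S → ∃ j, Sum.elim x c ∈ T j) :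
    ∃ j, ¬ CDiv L Ms (T j) c := by
  simp only [CDiv, not_forall, not_not] at hSb
  obtain ⟨𝒟, Y, h𝒟, hY, rfl, x₀, hx₀⟩ := hSb
  obtain ⟨𝓔, h𝓔, hc, h𝒟𝓔⟩ := exists_coh_extension hMe h𝒟 (c := Sum.elim (Y 0) c)
    (f := Sum.inl) (by simpa using hY.rlz 0)
    fun S hS => Definable.image_comp_of_injective hS Sum.inl_injective
  obtain ⟨Z, hZ, hZ0⟩ := hm.exists_morleySeq (hβ.sum hm.1 hγ) 𝓔 hMs hc
  have hZ' : MorleySeq L 𝒟 Ms fun i => Z i ∘ Sum.inl := hZ.of_map fun S _ hS => h𝒟𝓔 S hS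
  obtain ⟨σ, hσ, hσY⟩ := hY.exists_equiv hm hβ hMs subset_rfl h𝒟 hZ'
  let W : Set (β ⊕ γ → 𝕄) := ((fun z : α ⊕ (β ⊕ γ) → 𝕄 => z ∘ Sum.inr) ''
    ({z | z ∘ Sum.map id Sum.inl ∈ S} ∩ ⋂ j ∈ (Set.univ : Set ι), {z | z ∘ Sum.map id Sum.inr ∈ T j}ᶜ))ᶜ
  have hW : Ms.Definable L W := by
    cases nonempty_fintype ι
    refine (Definable.image_comp_of_injective (Set.Definable.inter (hS.preimage_comp _) ?_)
      Sum.inr_injective).compl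
    have := Set.definable_biInter_finset (A := Ms) (L := L)
      (f := fun j => {z : α ⊕ (β ⊕ γ) → 𝕄 | z ∘ Sum.map id Sum.inr ∈ T j}ᶜ)
      (fun j => ((hT j).preimage_comp _).compl) (Finset.univ : Finset ι)
    simpa using this
  have hcW : Z 0 ∈ W := by
    rw [hZ0]
    rintro ⟨z, ⟨hz, hz'⟩, hze⟩
    have hz1 : z = Sum.elim (z ∘ Sum.inl) (Sum.elim (Y 0) c) := by
      rw [← hze]; exact (Sum.elim_comp_inl_inr z).symm
    rw [hz1] at hz hz'
    simp only [Set.mem_ofPred_eq, Sum.elim_comp_map, Function.comp_id, Sum.elim_comp_inl] at hz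
    obtain ⟨j, hj⟩ := hST _ hz
    refine Set.mem_iInter₂.1 hz' j trivial ?_
    simpa only [Set.mem_ofPred_eq, Sum.elim_comp_map, Function.comp_id, Sum.elim_comp_inr] using hj
  have hj : ∀ i, ∃ j, Sum.elim (σ ∘ x₀) (Z i ∘ Sum.inr) ∈ T j := by
    intro i
    have hiW : Z i ∈ W := (eqTpOver_iff.1 ((hZ.rlz 0).eqTp (hZ.rlz i)) W hW).1 hcW
    by_contra hcon
    push Not at hcon
    refine hiW ⟨Sum.elim (σ ∘ x₀) (Z i), ⟨?_, ?_⟩, Sum.elim_comp_inr _ _⟩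
    · simp only [Set.mem_ofPred_eq, Sum.elim_comp_map, Function.comp_id]
      have := (Definable.elim_equiv_iff hS hσ x₀ (Y i)).2 (hx₀ i)
      rwa [hσY i] at this
    · refine Set.mem_iInter₂.2 fun j _ h => hcon j ?_
      simpa only [Set.mem_ofPred_eq, Sum.elim_comp_map, Function.comp_id] using h
  classical
  choose J hJ using hj
  obtain ⟨j, hj⟩ := Finite.exists_infinite_fiber J
  have hmono := (Nat.orderEmbeddingOfSet (J ⁻¹' {j})).strictMono
  refine ⟨j, not_cDiv_of_morleySeq hm hγ hMs h𝓔 (hZ.comp hmono) (g := Sum.inr) (hT j)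
    (x := σ ∘ x₀) (fun i => ?_) ?_⟩
  · have h1 : J (Nat.orderEmbeddingOfSet (J ⁻¹' {j}) i) = j :=
      (Nat.Subtype.ofNat (J ⁻¹' {j}) i).2
    have h2 := hJ (Nat.orderEmbeddingOfSet (J ⁻¹' {j}) i)
    rw [h1] at h2
    exact h2
  · have := ((hZ.rlz (Nat.orderEmbeddingOfSet (J ⁻¹' {j}) 0)).eqTp (hZ.rlz 0)).comp Sum.inr
    rw [hZ0, Sum.elim_comp_inr] at this
    exact this

theorem definable_realize {C : Set 𝕄} (φ : L.Formula α) : C.Definable L {z | φ.Realize z} := by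
  have := definable_of_formula (C := C) (φ.relabel (Sum.inl : α → α ⊕ Fin 0)) Fin.elim0
    fun i => i.elim0
  simpa [Formula.realize_relabel] using this

/-- A fibre of a definable relation is given by a formula. -/
theorem exists_formula_fibre {S : Set (α ⊕ β → 𝕄)} (hS : Ms.Definable L S) {b : β → 𝕄}
    {C : Set 𝕄} (hMC : Ms ⊆ C) (hb : Set.range b ⊆ C) :
    ∃ (n : ℕ) (φ : L.Formula (α ⊕ Fin n)) (d : Fin n → 𝕄), (∀ i, d i ∈ C) ∧
      ∀ x, Sum.elim x b ∈ S ↔ φ.Realize (Sum.elim x d) :=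
  exists_formula_of_definable (Definable.elim_const (hS.mono hMC) b fun i => hb ⟨i, rfl⟩)

/-- A formula with parameters gives a fibre of a definable relation. -/
theorem exists_fibre_of_formula {n : ℕ} (φ : L.Formula (α ⊕ Fin n)) {d : Fin n → 𝕄} {b : β → 𝕄}
    (hd : ∀ i, d i ∈ Ms ∪ Set.range b) :
    ∃ S : Set (α ⊕ β → 𝕄), Ms.Definable L S ∧
      ∀ x, φ.Realize (Sum.elim x d) ↔ Sum.elim x b ∈ S :=
  Definable.unparam (definable_of_formula φ d hd)

/-- Conant-division of a fibre passes to any formula implying it. -/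
theorem CDiv.conantDivides [Nonempty 𝕄] (hm : IsMonster L 𝕄 κ) (hβ : Small κ β)
    (hMe : IsElemSubmodel L Ms) (hMs : Small κ Ms) {S : Set (α ⊕ β → 𝕄)} (hS : Ms.Definable L S)
    {b : β → 𝕄} (h : CDiv L Ms S b) {n : ℕ} {φ : L.Formula (α ⊕ Fin n)} {d : Fin n → 𝕄}
    (hφ : ∀ x : α → 𝕄, φ.Realize (Sum.elim x d) → Sum.elim x b ∈ S) : ConantDivides L Ms φ d := by
  by_contra hc
  rw [conantDivides_iff] at hc
  obtain ⟨-, hj⟩ := exists_not_cDiv hm (Small.of_countable hm.1 _) hβ hMe hMs (ι := Unit)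
    (definable_realize φ) (T := fun _ => S) (fun _ => hS) (c := b) hc fun x hx => ⟨(), hφ x hx⟩
  exact hj h

theorem ND.of_conantIndep [Nonempty 𝕄] (hm : IsMonster L 𝕄 κ) (hβ : Small κ β)
    (hMe : IsElemSubmodel L Ms) (hMs : Small κ Ms) {a : α → 𝕄} {b : β → 𝕄}
    (h : ConantIndep L Ms a b) : ND L Ms a b := by
  intro S hS hab hd
  obtain ⟨n, φ, d, hdC, hφ⟩ := exists_formula_fibre hS (b := b) Set.subset_union_left
    Set.subset_union_right
  refine h n φ d hdC ((hφ a).1 hab) ⟨1, fun _ => n, fun _ => φ, fun _ => d, fun _ => ?_,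
    fun _ hx => ⟨0, hx⟩⟩
  exact hd.conantDivides hm hβ hMe hMs hS fun x => (hφ x).2

theorem ND.conantIndep [Nonempty 𝕄] (hm : IsMonster L 𝕄 κ) (hβ : Small κ β)
    (hMe : IsElemSubmodel L Ms) (hMs : Small κ Ms) {a : α → 𝕄} {b : β → 𝕄}
    (h : ND L Ms a b) : ConantIndep L Ms a b := by
  rintro n φ d hd hφ ⟨N, m, ψ, c, hψ, hφψ⟩
  obtain ⟨S, hS, hSφ⟩ := exists_fibre_of_formula φ hd
  let g : ∀ j : Fin N, Fin (m j) → Σ j : Fin N, Fin (m j) := fun j i => ⟨j, i⟩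
  obtain ⟨j, hj⟩ := exists_not_cDiv hm hβ (Small.of_countable hm.1 _) hMe hMs (ι := Fin N) hS
    (T := fun j => {z | z ∘ Sum.map id (g j) ∈ {z | (ψ j).Realize z}})
    (fun j => (definable_realize (ψ j)).preimage_comp _)
    (c := fun p : Σ j : Fin N, Fin (m j) => c p.1 p.2) (h S hS ((hSφ a).1 hφ)) (by
      intro x hx
      obtain ⟨j, hj⟩ := hφψ x ((hSφ x).2 hx)
      refine ⟨j, ?_⟩
      simp only [Set.mem_ofPred_eq, Sum.elim_comp_map, Function.comp_id]
      exact hj)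
  exact hj (CDiv.comap hm (Small.of_countable hm.1 _) hMs (definable_realize (ψ j))
    (conantDivides_iff.1 (hψ j)))

/-- A partial type with no Conant-dividing formula extends to a type without one. -/
theorem exists_nd [Nonempty 𝕄] (hm : IsMonster L 𝕄 κ) (hα : Small κ α) (hβ : Small κ β)
    (hMe : IsElemSubmodel L Ms) (hMs : Small κ Ms) {b : β → 𝕄} {𝓢 : Set (Set (α ⊕ β → 𝕄))}
    (hdef : ∀ S ∈ 𝓢, Ms.Definable L S) (huniv : Set.univ ∈ 𝓢)
    (hinter : ∀ S ∈ 𝓢, ∀ T ∈ 𝓢, S ∩ T ∈ 𝓢) (hnd : ∀ S ∈ 𝓢, ¬ CDiv L Ms S b) :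
    ∃ x : α → 𝕄, (∀ S ∈ 𝓢, Sum.elim x b ∈ S) ∧ ND L Ms x b := by
  let ι := {S : Set (α ⊕ β → 𝕄) // Ms.Definable L S ∧ (S ∈ 𝓢 ∨ CDiv L Ms Sᶜ b)}
  obtain ⟨x, hx⟩ := hm.exists_mem hα (hMs.union hm.1 (hβ.range b))
    (fun S : ι => {x | Sum.elim x b ∈ S.1})
    (fun S => Definable.elim_const (S.2.1.mono Set.subset_union_left) b fun i =>
      Or.inr ⟨i, rfl⟩) (by
      intro t
      have key : ∃ S ∈ 𝓢, ∀ T ∈ t, T.1 ∈ 𝓢 → S ⊆ T.1 := by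
        classical
        induction t using Finset.induction_on with
        | empty => exact ⟨_, huniv, by simp⟩
        | insert T t _ ih =>
          obtain ⟨S, hS, hSt⟩ := ih
          by_cases hT : T.1 ∈ 𝓢
          · refine ⟨S ∩ T.1, hinter _ hS _ hT, ?_⟩
            intro T' hT' hT'S
            rcases Finset.mem_insert.1 hT' with rfl | h
            · exact Set.inter_subset_right
            · exact Set.inter_subset_left.trans (hSt T' h hT'S)
          · refine ⟨S, hS, ?_⟩
            intro T' hT' hT'S
            rcases Finset.mem_insert.1 hT' with rfl | h
            · exact absurd hT'S hT
            · exact hSt T' h hT'S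
      obtain ⟨S, hS, hSt⟩ := key
      by_contra! hcon
      let e := t.equivFin
      obtain ⟨j, hj⟩ := exists_not_cDiv hm hβ hβ hMe hMs (ι := {j : Fin t.card // (e.symm j).1.1 ∉ 𝓢})
        (hdef S hS) (b := b) (T := fun j => (e.symm j.1).1.1ᶜ) (fun j => (e.symm j.1).1.2.1.compl)
        (c := b) (hnd S hS) (by
          intro x hx
          obtain ⟨T, hT, hxT⟩ := hcon x
          refine ⟨⟨e ⟨T, hT⟩, ?_⟩, ?_⟩
          · rw [e.symm_apply_apply]
            exact fun h => hxT (hSt T hT h hx)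
          · rw [e.symm_apply_apply]
            exact hxT)
      exact hj ((e.symm j.1).1.2.2.resolve_left j.2))
  refine ⟨x, fun S hS => hx ⟨S, hdef S hS, Or.inl hS⟩, fun S hS hxS hd => ?_⟩
  exact hx ⟨Sᶜ, hS.compl, Or.inr (by rwa [_root_.compl_compl])⟩ hxS

end Dividing


section Canonical

variable {L : FirstOrder.Language.{u, u}} {𝕄 : Type u} [L.Structure 𝕄] {κ : Cardinal.{u}}
  {α : Type v} {β : Type w} {Ms : Set 𝕄}

theorem FinSatIn.comp {a : α → 𝕄} {C : Set 𝕄} (h : FinSatIn L Ms a C) (f : β → α) :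
    FinSatIn L Ms (a ∘ f) C := by
  rw [finSatIn_iff] at h ⊢
  intro S hS ha
  obtain ⟨m, hm, hmS⟩ := h {x | x ∘ f ∈ S} (hS.preimage_comp f) ha
  exact ⟨m ∘ f, fun i => hm _, hmS⟩

theorem FinSatIn.mono {a : α → 𝕄} {C D : Set 𝕄} (h : FinSatIn L Ms a D) (hCD : C ⊆ D) :
    FinSatIn L Ms a C := fun n φ c hc => h n φ c fun i => hCD (hc i)

/-- A list of realizations of the type of `d` over `Ms`, each finitely satisfiable in `Ms` over the
later entries of the list. -/
def FSL (L : FirstOrder.Language.{u, u}) {𝕄 : Type u} [L.Structure 𝕄] (Ms : Set 𝕄)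
    {β : Type w} (d : β → 𝕄) : List (β → 𝕄) → Prop
  | [] => True
  | a :: t => FSL L Ms d t ∧ EqTpOver L Ms a d ∧ FinSatIn L Ms a (Ms ∪ params t)

theorem params_comp_subset (g : β → α) (l : List (α → 𝕄)) :
    params (l.map fun a => a ∘ g) ⊆ params l := by
  induction l with
  | nil => simp
  | cons a t ih =>
    simp only [List.map_cons, params_cons]
    exact Set.union_subset_union (Set.range_comp_subset_range _ _) ih

theorem MorleyList.fsl {𝒟 : Ultrafilter (α → 𝕄)} (h𝒟 : Coh Ms 𝒟) {d : α → 𝕄}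
    (hd : Rlz L 𝒟 d Ms) (g : β → α) :
    ∀ {l : List (α → 𝕄)}, MorleyList L 𝒟 Ms l → FSL L Ms (d ∘ g) (l.map fun a => a ∘ g)
  | [], _ => trivial
  | _ :: t, h => ⟨h.2.fsl h𝒟 hd g,
      ((h.1.mono Set.subset_union_left).eqTp hd).comp g,
      ((h.1.finSat h𝒟).comp g).mono (Set.union_subset_union_right _ (params_comp_subset g t))⟩



/-- An ultrafilter giving a canonical global type over `Ms` whose realizations contain `Ms`. -/
structure Canon (R : IndRel L 𝕄) (κ : Cardinal.{u}) (Ms : Set 𝕄) {γ : Type w}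
    (𝒬 : Ultrafilter (γ → 𝕄)) : Prop where
  coh : Coh Ms 𝒬
  exists_rel : ∀ N : Set 𝕄, Small κ N → Ms ⊆ N → ∃ c, Rlz L 𝒬 c N ∧ R.rel N Ms (Set.range c)
  subset_range : ∀ c, Rlz L 𝒬 c Ms → Ms ⊆ Set.range c

theorem EqTpOver.subset_range {a b : α → 𝕄} (h : EqTpOver L Ms a b) (ha : Ms ⊆ Set.range a) :
    Ms ⊆ Set.range b := by
  intro m hm
  obtain ⟨i, rfl⟩ := ha hm
  exact ⟨i, (eqTpOver_iff.1 h {x | x i = a i} (definable_coord_eq i hm)).1 rfl⟩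

theorem IndRel.StrongerThanH.finSatIn {R : IndRel L 𝕄} (hR : R.StrongerThanH)
    (hMs : IsElemSubmodel L Ms) {A : Set 𝕄} {b : α → 𝕄} (h : R.rel A Ms (Set.range b)) :
    FinSatIn L Ms b (Ms ∪ A) :=
  FinSatIn.comp (hR A Ms _ hMs h) (Set.rangeFactorization b)

/-- A canonical type over a model contained in its realizations is given by a canonical
ultrafilter. -/
theorem IsCanonicalGlobal.exists_canon (hm : IsMonster L 𝕄 κ) {R : IndRel L 𝕄}
    (hR : R.StrongerThanH) (hMe : IsElemSubmodel L Ms) (hMs : Small κ Ms) (hα : Small κ α)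
    {q : GlobalType L 𝕄 α} (hq : IsCanonicalGlobal R κ Ms q) {c : α → 𝕄}
    (hc : RealizesType q c Ms) (hMc : Ms ⊆ Set.range c) :
    ∃ 𝒬 : Ultrafilter (α → 𝕄), Canon R κ Ms 𝒬 ∧ ∀ a C, RealizesType q a C ↔ Rlz L 𝒬 a C := by
  have hex : ∀ N : Set 𝕄, Small κ N → Ms ⊆ N →
      ∃ c, RealizesType q c N ∧ R.rel N Ms (Set.range c) := by
    intro N hN hMN
    obtain ⟨c, hc⟩ := hm.exists_mem hα hN
      (fun p : {p : FmlP L 𝕄 α // p ∈ q.carrier ∧ ∀ i, p.2.2 i ∈ N} =>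
        {a | p.1.2.1.Realize (Sum.elim a p.1.2.2)})
      (fun p => definable_of_formula _ _ p.2.2) (by
        intro t
        classical
        obtain ⟨a, ha⟩ := q.consistent (t.image Subtype.val) (by
          intro p hp
          obtain ⟨p, -, rfl⟩ := Finset.mem_image.1 (Finset.mem_coe.1 hp)
          exact p.2.1)
        exact ⟨a, fun p hp => ha _ (Finset.mem_image_of_mem _ hp)⟩)
    have hc' : RealizesType q c N := fun n φ d hd hφ => hc ⟨⟨n, φ, d⟩, hφ, hd⟩
    refine ⟨c, hc', ?_⟩
    have := hq N hN.lt (fun x => (x : 𝕄)) c (by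
      rwa [Subtype.range_coe, Set.union_eq_self_of_subset_left hMN])
    rwa [Subtype.range_coe] at this
  have hfs : q.FinSatInM Ms := by
    intro t ht
    let P : Set 𝕄 := ⋃ p ∈ t, Set.range p.2.2
    have hP : P.Finite := t.finite_toSet.biUnion fun p _ => Set.finite_range _
    have : Countable P := hP.countable
    obtain ⟨c, hc, hcR⟩ := hex (Ms ∪ P) (hMs.union hm.1 (Small.of_countable hm.1 _))
      Set.subset_union_left
    have hpP : ∀ p ∈ t, ∀ i, p.2.2 i ∈ P := fun p hp i =>
      Set.mem_biUnion (Finset.mem_coe.2 hp) ⟨i, rfl⟩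
    have hfin := finSatIn_iff.1 (hR.finSatIn hMe hcR)
      (⋂ p ∈ t, {a | p.2.1.Realize (Sum.elim a p.2.2)}) (by
        have : ∀ s : Finset (FmlP L 𝕄 α), s ⊆ t → (Ms ∪ (Ms ∪ P)).Definable L
            (⋂ p ∈ s, {a : α → 𝕄 | p.2.1.Realize (Sum.elim a p.2.2)}) := by
          classical
          intro s
          induction s using Finset.induction_on with
          | empty => intro _; simp
          | insert p s _ ih =>
            intro hs
            rw [Finset.set_biInter_insert]
            exact Set.Definable.inter (definable_of_formula _ _ fun i => Set.mem_union_right _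
              (Set.mem_union_right _ (hpP p (hs (Finset.mem_insert_self _ _)) i)))
              (ih fun x hx => hs (Finset.mem_insert_of_mem hx))
        exact this t subset_rfl)
      (Set.mem_iInter₂.2 fun p hp => hc _ _ _ (fun i => Or.inr (hpP p hp i)) (ht hp))
    obtain ⟨m, hmM, hmS⟩ := hfin
    exact ⟨m, hmM, fun p hp => Set.mem_iInter₂.1 hmS p hp⟩
  obtain ⟨𝒬, hcoh, h𝒬⟩ := hfs.exists_coh
  refine ⟨𝒬, ⟨hcoh, fun N hN hMN => ?_, fun c' hc' => ?_⟩, h𝒬⟩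
  · obtain ⟨c, hc, hcR⟩ := hex N hN hMN
    exact ⟨c, (h𝒬 _ _).1 hc, hcR⟩
  · exact (((h𝒬 _ _).1 hc).eqTp hc').subset_range hMc

theorem IsStrongCanonical.exists_canon (hm : IsMonster L 𝕄 κ) {R : IndRel L 𝕄}
    (hR : R.StrongerThanH) (hMe : IsElemSubmodel L Ms) (hMs : Small κ Ms) {α β γ : Type u}
    (hα : Small κ α) (hβ : Small κ β) (hγ : Small κ γ)
    {q : GlobalType L 𝕄 α} (hq : IsStrongCanonical R κ Ms q) {b : β → 𝕄} {c : α → 𝕄}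
    (hc : RealizesType q c (Ms ∪ Set.range b)) (a : γ → 𝕄) :
    ∃ (𝒬 : Ultrafilter ((γ ⊕ Ms) ⊕ α → 𝕄)) (a' : γ → 𝕄),
      EqTpOver L (Ms ∪ Set.range c) a' a ∧ Canon R κ Ms 𝒬 ∧
      Rlz L 𝒬 (Sum.elim (Sum.elim a' (fun x : Ms => (x : 𝕄))) c) (Ms ∪ Set.range b) := by
  obtain ⟨e, he, q', hq', hqe⟩ := hq β hβ.lt b c hc (γ ⊕ Ms) (hγ.sum hm.1 hMs).lt
    (Sum.elim a (fun x : Ms => (x : 𝕄)))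
  have he' : e ∘ Sum.inr = fun x : Ms => (x : 𝕄) := by
    funext x
    exact ((eqTpOver_iff.1 he {y | y (Sum.inr x) = x}
      (definable_coord_eq _ (Or.inl x.2))).2 rfl)
  have he2 : e = Sum.elim (e ∘ Sum.inl) (fun x : Ms => (x : 𝕄)) := by
    rw [← he', Sum.elim_comp_inl_inr]
  have hqe' := hqe.realizesType
  obtain ⟨𝒬, h𝒬, hq𝒬⟩ := hq'.exists_canon hm hR hMe hMs ((hγ.sum hm.1 hMs).sum hm.1 hα)
    (c := Sum.elim e c) (fun n φ d hd => hqe' n φ d fun i => Or.inl (hd i))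
    (fun x hx => ⟨Sum.inl (Sum.inr ⟨x, hx⟩), congrFun he' ⟨x, hx⟩⟩)
  refine ⟨𝒬, e ∘ Sum.inl, ?_, h𝒬, ?_⟩
  · simpa using he.comp Sum.inl
  · rw [← he2]
    exact (hq𝒬 _ _).1 hqe'

/-- Every small tuple is part of a realization of a canonical type. -/
def HasCanon (R : IndRel L 𝕄) (κ : Cardinal.{u}) (Ms : Set 𝕄) : Prop :=
  ∀ (γ : Type u), Small κ γ → ∀ e : γ → 𝕄, ∃ (δ : Type u) (𝒬 : Ultrafilter (δ → 𝕄)) (c : δ → 𝕄)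
    (f : γ → δ), Small κ δ ∧ Canon R κ Ms 𝒬 ∧ Rlz L 𝒬 c Ms ∧ c ∘ f = e

theorem HasCanon.exists_canon {R : IndRel L 𝕄} (h : HasCanon R κ Ms) (hβ : Small κ β)
    (e : β → 𝕄) : ∃ (δ : Type u) (𝒬 : Ultrafilter (δ → 𝕄)) (c : δ → 𝕄)
    (f : β → δ), Small κ δ ∧ Canon R κ Ms 𝒬 ∧ Rlz L 𝒬 c Ms ∧ c ∘ f = e := by
  obtain ⟨γ, hγ, ⟨i⟩⟩ := hβ.exists_equiv
  obtain ⟨δ, 𝒬, c, f, hδ, h𝒬, hc, hcf⟩ := h γ (Small.of_lt hγ) (e ∘ i.symm)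
  refine ⟨δ, 𝒬, c, f ∘ i, hδ, h𝒬, hc, ?_⟩
  rw [← Function.comp_assoc, hcf, Function.comp_assoc, i.symm_comp_self, Function.comp_id]

theorem IsStrongCanonical.hasCanon (hm : IsMonster L 𝕄 κ) {R : IndRel L 𝕄}
    (hR : R.StrongerThanH) (hMe : IsElemSubmodel L Ms) (hMs : Small κ Ms) {α : Type u}
    (hα : Small κ α) {q : GlobalType L 𝕄 α} (hq : IsStrongCanonical R κ Ms q) {c : α → 𝕄}
    (hc : RealizesType q c Ms) : HasCanon R κ Ms := by
  intro γ hγ e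
  obtain ⟨𝒬, a', ha', h𝒬, hrlz⟩ := hq.exists_canon hm hR hMe hMs hα
    (Small.of_countable hm.1 PEmpty) hγ (b := PEmpty.elim) (c := c) (by
      rw [Set.range_eq_empty, Set.union_empty]
      exact hc) e
  obtain ⟨σ, hσ, hσa⟩ := hm.exists_equiv hγ hMs (ha'.mono Set.subset_union_left)
  refine ⟨_, 𝒬, σ ∘ Sum.elim (Sum.elim a' (fun x : Ms => (x : 𝕄))) c, Sum.inl ∘ Sum.inl,
    (hγ.sum hm.1 hMs).sum hm.1 hα, h𝒬, ?_, ?_⟩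
  · have := (hrlz.mono Set.subset_union_left).equiv h𝒬.coh hσ
    rwa [image_eq_of_fix hσ] at this
  · exact hσa

end Canonical


section CanonicalTrees

variable {L : FirstOrder.Language.{u, u}} {𝕄 : Type u} [L.Structure 𝕄] {κ : Cardinal.{u}}
  {β : Type w} {γ : Type u} {Ms : Set 𝕄} {R : IndRel L 𝕄} {𝒬 : Ultrafilter (γ → 𝕄)}

/-- The tuple at a node of a tree of tuples. -/
def node {J : Type x} (X : List ℕ × J → 𝕄) (η : List ℕ) : J → 𝕄 := fun i => X (η, i)

/-- The subtuples along the nodes from the root to `σ`. -/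
def treePath (g : β → γ) : (List ℕ × γ → 𝕄) → List ℕ → List (β → 𝕄)
  | X, [] => [node X [] ∘ g]
  | X, i :: σ => (node X [] ∘ g) :: treePath g (fun p => X (i :: p.1, p.2)) σ

/-- The entries of the tree in the cones to the left of the `c`-th cone above `ν`. -/
def leftCones {J : Type x} (X : List ℕ × J → 𝕄) (ν : List ℕ) (c : ℕ) : Set 𝕄 :=
  {x | ∃ c' < c, ∃ ζ, ν ++ [c'] <+: ζ ∧ x ∈ Set.range (node X ζ)}

theorem treePath_equiv (g : β → γ) (τ : 𝕄 ≃[L] 𝕄) (X : List ℕ × γ → 𝕄) (σ : List ℕ) :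
    treePath g (τ ∘ X) σ = (treePath g X σ).map fun a => τ ∘ a := by
  induction σ generalizing X with
  | nil => rfl
  | cons i σ ih =>
    simp only [treePath, List.map_cons]
    rw [← ih]
    rfl

theorem mem_treePath (g : β → γ) {η σ : List ℕ} (h : η <+: σ) (X : List ℕ × γ → 𝕄) :
    node X η ∘ g ∈ treePath g X σ := by
  induction σ generalizing X η with
  | nil =>
    obtain rfl := List.prefix_nil.1 h
    exact List.mem_singleton.2 rfl
  | cons i σ ih =>
    rcases η with _ | ⟨j, η⟩
    · exact List.mem_cons_self
    · obtain ⟨rfl, h'⟩ := List.cons_prefix_cons.1 h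
      exact List.mem_cons_of_mem _ (ih h' fun p => X (j :: p.1, p.2))

theorem params_treePath_subset (g : β → γ) (X : List ℕ × γ → 𝕄) (σ : List ℕ) :
    params (treePath g X σ) ⊆ Set.range X := by
  induction σ generalizing X with
  | nil =>
    rintro _ h
    simp only [treePath, params_cons, params_nil, Set.union_empty] at h
    obtain ⟨i, rfl⟩ := h
    exact ⟨_, rfl⟩
  | cons i σ ih =>
    simp only [treePath, params_cons]
    rintro _ (⟨j, rfl⟩ | h)
    · exact ⟨_, rfl⟩
    · obtain ⟨p, rfl⟩ := ih _ h
      exact ⟨_, rfl⟩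

/-- Paths of the tree look like `r` over `Ms`, and each node realizes `𝒬` over the cones to its
left. -/
structure TreeCond (Ms : Set 𝕄) (𝒬 : Ultrafilter (γ → 𝕄)) (g : β → γ) (r : List (β → 𝕄))
    (X : List ℕ × γ → 𝕄) : Prop where
  path : ∀ σ : List ℕ, σ.length + 1 = r.length → ∃ τ : 𝕄 ≃[L] 𝕄, (∀ x ∈ Ms, τ x = x) ∧
    (r.map fun a => τ ∘ a) = treePath g X σ
  fork : ∀ (ν : List ℕ) (c : ℕ) (ζ : List ℕ), ν.length + 1 < r.length → ν ++ [c] <+: ζ →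
    Rlz L 𝒬 (node X ζ) (Ms ∪ leftCones X ν c)

theorem image_leftCones {J : Type x} (τ : 𝕄 ≃[L] 𝕄) (X : List ℕ × J → 𝕄) (ν : List ℕ) (c : ℕ) :
    τ '' leftCones X ν c = leftCones (τ ∘ X) ν c := by
  ext x
  constructor
  · rintro ⟨_, ⟨c', hc', ζ, hζ, ⟨i, rfl⟩⟩, rfl⟩
    exact ⟨c', hc', ζ, hζ, ⟨i, rfl⟩⟩
  · rintro ⟨c', hc', ζ, hζ, ⟨i, rfl⟩⟩
    exact ⟨_, ⟨c', hc', ζ, hζ, ⟨i, rfl⟩⟩, rfl⟩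

theorem TreeCond.equiv (h𝒬 : Coh Ms 𝒬) {g : β → γ} {r : List (β → 𝕄)} {X : List ℕ × γ → 𝕄}
    (h : TreeCond (L := L) Ms 𝒬 g r X) {ρ : 𝕄 ≃[L] 𝕄} (hρ : ∀ x ∈ Ms, ρ x = x) :
    TreeCond (L := L) Ms 𝒬 g r (ρ ∘ X) where
  path σ hσ := by
    obtain ⟨τ, hτ, hr⟩ := h.path σ hσ
    refine ⟨ρ.comp τ, fun x hx => ?_, ?_⟩
    · rw [Equiv.comp_apply, hτ x hx, hρ x hx]
    · rw [treePath_equiv, ← hr, List.map_map]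
      rfl
  fork ν c ζ hν hζ := by
    have := (h.fork ν c ζ hν hζ).equiv h𝒬 hρ
    rwa [Set.image_union, image_eq_of_fix hρ, image_leftCones] at this

/-- The tree is `R`-independent from `N`, and its nodes realize `𝒬` over `N`. -/
def TreeAt (R : IndRel L 𝕄) (Ms : Set 𝕄) (𝒬 : Ultrafilter (γ → 𝕄)) (N : Set 𝕄)
    (X : List ℕ × γ → 𝕄) : Prop :=
  R.rel N Ms (Set.range X) ∧ ∀ η, Rlz L 𝒬 (node X η) N

theorem Canon.subset_range_tree (h𝒬 : Canon R κ Ms 𝒬) {X : List ℕ × γ → 𝕄}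
    (h : Rlz L 𝒬 (node X []) Ms) : Ms ⊆ Set.range X :=
  (h𝒬.subset_range _ h).trans (by rintro _ ⟨i, rfl⟩; exact ⟨_, rfl⟩)

theorem TreeAt.mono (hR : GoodRel R κ) (hMe : IsElemSubmodel L Ms) (h𝒬 : Canon R κ Ms 𝒬)
    {N N' : Set 𝕄} {X : List ℕ × γ → 𝕄} (h : TreeAt R Ms 𝒬 N' X) (hM : Ms ⊆ N) (hN : N ⊆ N') :
    TreeAt R Ms 𝒬 N X :=
  ⟨hR.2.2.1 _ _ _ _ _ hMe h.1 hM hN (h𝒬.subset_range_tree ((h.2 []).mono (hM.trans hN)))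
    subset_rfl, fun η => (h.2 η).mono hN⟩

theorem exists_tree_ultrafilter (hm : IsMonster L 𝕄 κ) (hR : GoodRel R κ)
    (hMe : IsElemSubmodel L Ms) (hMs : Small κ Ms) (h𝒬 : Canon R κ Ms 𝒬)
    {X₀ : List ℕ × γ → 𝕄} (hX₀ : ∀ N : Set 𝕄, Small κ N → Ms ⊆ N →
      ∃ X, EqTpOver L Ms X X₀ ∧ TreeAt R Ms 𝒬 N X) :
    ∃ 𝒟 : Ultrafilter (List ℕ × γ → 𝕄), Coh Ms 𝒟 ∧ Rlz L 𝒟 X₀ Ms ∧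
      ∀ (η : List ℕ) (S : Set (γ → 𝕄)), (Set.univ : Set 𝕄).Definable L S → S ∈ 𝒬 →
        {X | node X η ∈ S} ∈ 𝒟 := by
  let K : Set (List ℕ × γ → 𝕄) := {m | ∀ i, m i ∈ Ms}
  obtain ⟨𝒟, h𝒟⟩ := exists_ultrafilter_of_directed
    {T : Set (List ℕ × γ → 𝕄) | ∃ (N : Set 𝕄) (S : Set (List ℕ × γ → 𝕄)), Small κ N ∧ Ms ⊆ N ∧ N.Definable L S ∧
      (∀ X, EqTpOver L Ms X X₀ → TreeAt R Ms 𝒬 N X → X ∈ S) ∧ S ∩ K ⊆ T}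
    ⟨Ms, Set.univ, hMs, subset_rfl, Set.definable_univ, fun _ _ _ => trivial, Set.subset_univ _⟩
    (by
      rintro T ⟨N, S, hN, hMN, hS, hX, hT⟩ T' ⟨N', S', hN', hMN', hS', hX', hT'⟩
      refine ⟨N ∪ N', S ∩ S', hN.union hm.1 hN', hMN.trans Set.subset_union_left,
        (hS.mono Set.subset_union_left).inter (hS'.mono Set.subset_union_right),
        fun X hX0 hXt => ⟨hX X hX0 (hXt.mono hR hMe h𝒬 hMN Set.subset_union_left),
          hX' X hX0 (hXt.mono hR hMe h𝒬 hMN' Set.subset_union_right)⟩, fun x hx =>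
          ⟨hT ⟨hx.1.1, hx.2⟩, hT' ⟨hx.1.2, hx.2⟩⟩⟩)
    (by
      rintro T ⟨N, S, hN, hMN, hS, hX, hT⟩
      obtain ⟨X, hX0, hXt⟩ := hX₀ N hN hMN
      obtain ⟨m, hmM, hmS⟩ := finSatIn_iff.1 (hR.1.finSatIn hMe hXt.1) S
        (hS.mono Set.subset_union_right) (hX X hX0 hXt)
      exact ⟨m, hT ⟨hmS, hmM⟩⟩)
  refine ⟨𝒟, h𝒟 _ ⟨Ms, Set.univ, hMs, subset_rfl, Set.definable_univ, fun _ _ _ => trivial,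
    Set.inter_subset_right⟩, ?_, ?_⟩
  · intro S hS hSD
    by_contra hX
    refine Ultrafilter.compl_mem_iff_notMem.1 (h𝒟 Sᶜ ⟨Ms, Sᶜ, hMs, subset_rfl, hS.compl, ?_,
      Set.inter_subset_left⟩) hSD
    intro X hX0 _ hXS
    exact hX ((eqTpOver_iff.1 hX0 S hS).1 hXS)
  · intro η S hS hSQ
    obtain ⟨n, φ, c, -, hφ⟩ := exists_formula_of_definable hS
    have hN : Small κ ↥(Ms ∪ Set.range c) := hMs.union hm.1 (Small.of_countable hm.1 _)
    have hSN : (Ms ∪ Set.range c).Definable L S := by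
      have := definable_of_formula (C := Ms ∪ Set.range c) φ c fun i => Or.inr ⟨i, rfl⟩
      convert this
      ext a
      exact hφ a
    refine h𝒟 _ ⟨_, {X | node X η ∈ S}, hN, Set.subset_union_left,
      hSN.preimage_comp (fun i => (η, i)), fun X _ hX => hX.2 η S hSN hSQ, Set.inter_subset_left⟩

theorem range_flatSeq {J : Type w} (Y : ℕ → J → 𝕄) :
    Set.range (flatSeq Y) = ⋃ i, Set.range (Y i) := by
  ext x
  simp [flatSeq]

theorem exists_independent_morleySeq (hm : IsMonster L 𝕄 κ) (hR : GoodRel R κ)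
    (hMe : IsElemSubmodel L Ms) (hMs : Small κ Ms) {J : Type u} (hJ : Small κ J) {N : Set 𝕄}
    (hN : Small κ N) (hMN : Ms ⊆ N) {X : J → 𝕄} (hX : R.rel N Ms (Set.range X))
    {𝒟 : Ultrafilter (J → 𝕄)} (h𝒟 : Coh Ms 𝒟) {Y : ℕ → J → 𝕄} (hY : MorleySeq L 𝒟 Ms Y)
    (hXY : EqTpOver L Ms X (Y 0)) :
    ∃ Y' : ℕ → J → 𝕄, EqTpOver L Ms (flatSeq Y') (flatSeq Y) ∧
      R.rel N Ms (Set.range (flatSeq Y')) ∧ ∀ i, EqTpOver L N (Y' i) X := by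
  obtain ⟨σ, hσ, hσX⟩ := hm.exists_equiv hJ hMs hXY.symm
  have hI := hY.equiv h𝒟 hσ
  rw [image_eq_of_fix hσ] at hI
  obtain ⟨Y', hY', hR', hN'⟩ := hR.2.2.2.2.2 Ms hMe hMs.lt N J hN.lt hJ.lt (fun x => (x : 𝕄)) X
    (by rwa [Subtype.range_coe]) _ (coheirMorley_iff.2 ⟨𝒟, h𝒟, hI⟩) hσX
  rw [Subtype.range_coe] at hR'
  refine ⟨Y', hY'.trans (EqTpOver.of_equiv hσ (flatSeq Y)), ?_, fun i => ?_⟩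
  · rwa [range_flatSeq]
  · have := hN' i
    rwa [Subtype.range_coe, Set.union_eq_self_of_subset_left hMN] at this



/-- Trees in canonical types whose paths look like a given list. -/
theorem exists_tree [Nonempty 𝕄] (hm : IsMonster L 𝕄 κ) (hR : GoodRel R κ)
    (hMe : IsElemSubmodel L Ms) (hMs : Small κ Ms) (hγ : Small κ γ) (h𝒬 : Canon R κ Ms 𝒬)
    {c : γ → 𝕄} (hc : Rlz L 𝒬 c Ms) [Finite β] (g : β → γ) :
    ∀ (a : β → 𝕄) (t : List (β → 𝕄)), FSL L Ms (c ∘ g) (a :: t) →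
    ∃ X₀ : List ℕ × γ → 𝕄, TreeCond (L := L) Ms 𝒬 g (a :: t) X₀ ∧
      ∀ N : Set 𝕄, Small κ N → Ms ⊆ N → ∃ X, EqTpOver L Ms X X₀ ∧ TreeAt R Ms 𝒬 N X
  | a, [], h => by
    have hβ : Small κ β := Small.of_countable hm.1 _
    refine ⟨fun p => c p.2, ⟨fun σ hσ => ?_, fun ν _ _ hν => ?_⟩, fun N hN hMN => ?_⟩
    · obtain rfl : σ = [] := List.length_eq_zero_iff.1 (by simpa using hσ)
      obtain ⟨τ, hτ, hτa⟩ := hm.exists_equiv hβ hMs h.2.1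
      exact ⟨τ, hτ, by simp only [List.map_cons, List.map_nil, hτa]; rfl⟩
    · simp at hν
    · obtain ⟨c', hc', hc'R⟩ := h𝒬.exists_rel N hN hMN
      refine ⟨fun p => c' p.2, ((hc'.mono hMN).eqTp hc).comp Prod.snd, ?_, fun η => hc'⟩
      convert hc'R
      ext x
      simp
  | a, b :: t, h => by
    have hβ : Small κ β := Small.of_countable hm.1 _
    have hJ : Small κ (List ℕ × γ) := (Small.of_countable hm.1 (List ℕ)).prod hm.1 hγ
    have hJ2 : Small κ (ℕ × List ℕ × γ) := (Small.of_countable hm.1 ℕ).prod hm.1 hJ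
    obtain ⟨X₀, hcond, hX₀⟩ := exists_tree hm hR hMe hMs hγ h𝒬 hc g b t h.1
    obtain ⟨𝒟, h𝒟, hX₀𝒟, h𝒟𝒬⟩ := exists_tree_ultrafilter hm hR hMe hMs h𝒬 hX₀
    obtain ⟨Y, hY, hY0⟩ := hm.exists_morleySeq hJ 𝒟 hMs hX₀𝒟
    obtain ⟨𝓡, h𝓡, ha⟩ := exists_coh_of_finSat h.2.2
    have hnode : ∀ i η, Rlz L 𝒬 (node (Y i) η) (Ms ∪ ⋃ (j : ℕ) (_ : j < i), Set.range (Y j)) :=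
      fun i η => (hY i).of_map (f := fun k => (η, k)) fun S hS hSQ => h𝒟𝒬 η S hS hSQ
    let f : β → ℕ × List ℕ × γ := fun j => (0, [], g j)
    obtain ⟨𝓔, h𝓔, hY𝓔, h𝓡𝓔⟩ := exists_coh_extension hMe h𝓡 (c := flatSeq Y) (f := f)
      ((ha.mono Set.subset_union_left).of_eqTp (h.2.1.trans
        ((hc.eqTp ((hnode 0 []).mono Set.subset_union_left)).comp g)))
      fun S hS => Definable.image_comp_of_finite hS f
    obtain ⟨Z, hZ, hZ0⟩ := hm.exists_morleySeq hJ2 𝓔 hMs hY𝓔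
    have hroot : Rlz L 𝓡 (Z 1 ∘ f) (Ms ∪ Set.range (flatSeq Y)) := by
      refine ((hZ 1).of_map fun S _ hS => h𝓡𝓔 S hS).mono (Set.union_subset_union_right _ ?_)
      intro x hx
      exact Set.mem_iUnion₂.2 ⟨0, one_pos, by rwa [hZ0]⟩
    let r : List ℕ × γ → ℕ × ℕ × List ℕ × γ
      | ([], j) => (1, 0, [], j)
      | (i :: η, j) => (0, i, η, j)
    have hcondY : ∀ i, TreeCond (L := L) Ms 𝒬 g (b :: t) (Y i) := by
      intro i
      obtain ⟨ρ₁, hρ₁, hρ₁Y⟩ := hm.exists_equiv hJ hMs (hX₀𝒟.eqTp (hY.rlz i))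
      have := hcond.equiv h𝒬.coh hρ₁
      rwa [hρ₁Y] at this
    have hsub : ∀ i, (fun p : List ℕ × γ => (flatSeq Z ∘ r) (i :: p.1, p.2)) = Y i := by
      intro i
      funext p
      change Z 0 (i, p) = _
      rw [hZ0]
      rfl
    have hn : ∀ i η, node (flatSeq Z ∘ r) (i :: η) = node (Y i) η := by
      intro i η
      rw [← hsub i]
      rfl
    refine ⟨flatSeq Z ∘ r, ⟨?_, ?_⟩, fun N hN hMN => ?_⟩
    · rintro (_ | ⟨i, σ⟩) hσ
      · simp at hσ
      · obtain ⟨τ, hτ, hτt⟩ := (hcondY i).path σ (by simpa using hσ)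
        have h1 : Rlz L 𝓡 (τ ∘ a) (Ms ∪ params (treePath g (Y i) σ)) := by
          have := ha.equiv h𝓡 hτ
          rwa [Set.image_union, image_eq_of_fix hτ, image_params, hτt] at this
        have h2 : params (treePath g (Y i) σ) ⊆ Set.range (flatSeq Y) := by
          rw [range_flatSeq]
          exact (params_treePath_subset _ _ _).trans (Set.subset_iUnion (fun i => Set.range (Y i)) i)
        obtain ⟨ρ, hρ, hρa⟩ := hm.exists_equiv hβ (hMs.union hm.1 (Small.params hm.1 hβ _))
          (h1.eqTp (hroot.mono (Set.union_subset_union_right _ h2)))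
        refine ⟨ρ.comp τ, fun x hx => ?_, ?_⟩
        · rw [Equiv.comp_apply, hτ x hx, hρ x (Or.inl hx)]
        · simp only [treePath]
          rw [hsub, List.map_cons]
          congr 1
          rw [← hτt] at hρ ⊢
          refine List.map_congr_left fun b' hb' => ?_
          funext k
          exact hρ _ (Or.inr ⟨_, List.mem_map_of_mem hb', k, rfl⟩)
    · rintro (_ | ⟨i, ν⟩) k ζ hν hζ
      · rcases ζ with _ | ⟨i, ζ⟩
        · simp at hζ
        · obtain ⟨rfl, -⟩ := List.cons_prefix_cons.1 hζ
          rw [hn]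
          refine (hnode k ζ).mono (Set.union_subset_union_right _ ?_)
          rintro x ⟨c', hc', ζ', hζ', hx⟩
          rcases ζ' with _ | ⟨i, ζ'⟩
          · simp at hζ'
          · obtain ⟨rfl, -⟩ := List.cons_prefix_cons.1 hζ'
            rw [hn] at hx
            obtain ⟨j, rfl⟩ := hx
            exact Set.mem_iUnion₂.2 ⟨c', hc', _, rfl⟩
      · rcases ζ with _ | ⟨i', ζ⟩
        · simp at hζ
        · obtain ⟨rfl, hkζ⟩ := List.cons_prefix_cons.1 hζ
          rw [hn]
          refine ((hcondY i).fork ν k ζ (by simpa using hν) hkζ).mono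
            (Set.union_subset_union_right _ ?_)
          rintro x ⟨c', hc', ζ', hζ', hx⟩
          rcases ζ' with _ | ⟨i', ζ'⟩
          · simp at hζ'
          · obtain ⟨rfl, hkζ'⟩ := List.cons_prefix_cons.1 hζ'
            rw [hn] at hx
            exact ⟨c', hc', ζ', hkζ', hx⟩
    · obtain ⟨X, hXX₀, hX⟩ := hX₀ N hN hMN
      obtain ⟨Y', hY', hRY', hNY'⟩ := exists_independent_morleySeq hm hR hMe hMs hJ hN hMN hX.1
        h𝒟 hY (by rwa [hY0])
      obtain ⟨Z', hZ', hRZ', hNZ'⟩ := exists_independent_morleySeq hm hR hMe hMs hJ2 hN hMN hRY'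
        h𝓔 hZ (by rwa [hZ0])
      have hZn : ∀ i j η, Rlz L 𝒬 (fun k => Z' i (j, η, k)) N := by
        intro i j η
        refine (hX.2 η).of_eqTp ?_
        have h1 := (hNZ' i).comp (fun k : γ => (j, η, k))
        exact (h1.trans ((hNY' j).comp fun k : γ => (η, k))).symm
      have hnode' : ∀ η, Rlz L 𝒬 (node (flatSeq Z' ∘ r) η) N := by
        rintro (_ | ⟨i, η⟩)
        · exact hZn 1 0 []
        · exact hZn 0 i η
      refine ⟨flatSeq Z' ∘ r, hZ'.comp r, ?_, hnode'⟩
      exact hR.2.2.1 _ _ _ _ _ hMe hRZ' hMN subset_rfl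
        (h𝒬.subset_range_tree ((hnode' []).mono hMN)) (Set.range_comp_subset_range _ _)

end CanonicalTrees


section CanonicalConsistency

variable {L : FirstOrder.Language.{u, u}} {𝕄 : Type u} [L.Structure 𝕄] {κ : Cardinal.{u}}
  {α : Type v} {β : Type w} {γ : Type u} {Ms : Set 𝕄} {R : IndRel L 𝕄} {𝒬 : Ultrafilter (γ → 𝕄)}

theorem EqTpOver.of_forall_mem {C : Set 𝕄} {a b : α → 𝕄}
    (h : ∀ S : Set (α → 𝕄), C.Definable L S → b ∈ S → a ∈ S) : EqTpOver L C a b := by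
  refine eqTpOver_iff.2 fun S hS => ⟨fun ha => ?_, h S hS⟩
  by_contra hb
  exact h Sᶜ hS.compl hb ha

theorem MorleyList.rlz {𝒟 : Ultrafilter (β → 𝕄)} {C : Set 𝕄} :
    ∀ {l : List (β → 𝕄)}, MorleyList L 𝒟 C l → ∀ y ∈ l, Rlz L 𝒟 y C
  | _ :: _, h, _, hy => by
    rcases List.mem_cons.1 hy with rfl | hy
    · exact h.1.mono Set.subset_union_left
    · exact h.2.rlz _ hy

theorem TreeCond.morleyList {g : β → γ} {r : List (β → 𝕄)} {X : List ℕ × γ → 𝕄}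
    (h : TreeCond (L := L) Ms 𝒬 g r X) : ∀ l : List (List ℕ), Comb l →
    (∀ η ∈ l, η.length < r.length) → MorleyList L 𝒬 Ms (l.map (node X))
  | [], _, _ => trivial
  | η :: l, ⟨hl, ν, c, hη, hζ⟩, hlen => by
    refine ⟨(h.fork ν c η ?_ hη).mono (Set.union_subset_union_right _ ?_),
      h.morleyList l hl fun ζ hζl => hlen ζ (List.mem_cons_of_mem _ hζl)⟩
    · have h1 := hη.length_le
      have h2 := hlen η List.mem_cons_self
      simp only [List.length_append, List.length_singleton] at h1
      omega
    · rintro x ⟨a, ha, hx⟩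
      obtain ⟨ζ, hζl, rfl⟩ := List.mem_map.1 ha
      obtain ⟨c', hc', h'⟩ := hζ ζ hζl
      exact ⟨c', hc', ζ, h', hx⟩

/-- If `φ` is consistent along arbitrarily long sequences of conjugates of `c ∘ g`, each finitely
satisfiable over the earlier ones, then it is consistent along canonical Morley sequences. -/
theorem exists_realize_of_forall_fsl [Nonempty 𝕄] (hm : IsMonster L 𝕄 κ) (hN : ¬ HasSOP2 L 𝕄)
    (hR : GoodRel R κ) (hMe : IsElemSubmodel L Ms) (hMs : Small κ Ms) (hγ : Small κ γ)
    (h𝒬 : Canon R κ Ms 𝒬) {c : γ → 𝕄} (hc : Rlz L 𝒬 c Ms) {m : ℕ} (g : Fin m → γ)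
    (φ : L.Formula (α ⊕ Fin m))
    (h : ∀ n, ∃ r, FSL L Ms (c ∘ g) r ∧ r.length = n ∧
      ∃ x : α → 𝕄, ∀ a ∈ r, φ.Realize (Sum.elim x a))
    {l : List (γ → 𝕄)} (hl : MorleyList L 𝒬 Ms l) :
    ∃ x : α → 𝕄, ∀ y ∈ l, φ.Realize (Sum.elim x (y ∘ g)) := by
  by_contra hcon
  refine not_forall_exists_comb_tree hm hN φ l.length fun N => ?_
  obtain ⟨r, hr, hrl, x, hx⟩ := h (N + 1)
  rcases r with _ | ⟨a, t⟩
  · simp at hrl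
  obtain ⟨X, hX, -⟩ := exists_tree hm hR hMe hMs hγ h𝒬 hc g a t hr
  refine ⟨fun η => node X η ∘ g, fun σ hσ => ?_, fun l' hl' hlen hlN => ?_⟩
  · obtain ⟨τ, hτ, hτt⟩ := hX.path σ (by rw [hσ, hrl])
    refine ⟨τ ∘ x, fun η hη => ?_⟩
    have := mem_treePath g hη X
    rw [← hτt] at this
    obtain ⟨b, hb, hbη⟩ := List.mem_map.1 this
    beta_reduce
    rw [← hbη]
    exact (Definable.elim_equiv_iff (definable_realize φ) hτ x b).2 (hx b hb)
  · rintro ⟨x', hx'⟩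
    have hml := hX.morleyList l' hl' fun η hη => by rw [hrl]; exact Nat.lt_succ_of_le (hlN η hη)
    obtain ⟨σ, hσ, hσl⟩ := hml.exists_equiv hm hγ hMs subset_rfl h𝒬.coh hl (by simpa using hlen)
    refine hcon ⟨σ ∘ x', fun y hy => ?_⟩
    rw [← hσl, List.map_map] at hy
    obtain ⟨η, hη, rfl⟩ := List.mem_map.1 hy
    exact (Definable.elim_equiv_iff (definable_realize φ) hσ x' (node X η ∘ g)).2 (hx' η hη)

theorem IsMonster.exists_forall_mem (hm : IsMonster L 𝕄 κ) (hα : Small κ α) (hβ : Small κ β)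
    {C : Set 𝕄} (hC : Small κ C) {ι : Type x} {S : ι → Set (α ⊕ β → 𝕄)}
    (hS : ∀ i, C.Definable L (S i)) (Y : ℕ → β → 𝕄)
    (hfin : ∀ (t : Finset ι) (n : ℕ), ∃ x : α → 𝕄, ∀ i ∈ t, ∀ y ∈ initList Y n,
      Sum.elim x y ∈ S i) : ∃ x : α → 𝕄, ∀ i n, Sum.elim x (Y n) ∈ S i := by
  classical
  obtain ⟨x, hx⟩ := hm.exists_mem hα (hC.union hm.1 (small_iUnion_range hm.1 hβ Y))
    (fun p : ι × ℕ => {x : α → 𝕄 | Sum.elim x (Y p.2) ∈ S p.1})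
    (fun p => Definable.elim_const ((hS p.1).mono Set.subset_union_left) _ fun i =>
      Or.inr (Set.mem_iUnion.2 ⟨p.2, i, rfl⟩))
    (fun t => by
      obtain ⟨x, hx⟩ := hfin (t.image Prod.fst) (t.sup Prod.snd + 1)
      refine ⟨x, fun p hp => hx _ (Finset.mem_image_of_mem _ hp) _
        (mem_initList.2 ⟨p.2, Nat.lt_succ_of_le (Finset.le_sup hp), rfl⟩)⟩)
  exact ⟨x, fun i n => hx (i, n)⟩

theorem Rlz.elim_const {𝒟 : Ultrafilter (β → 𝕄)} {a : β → 𝕄} {C : Set 𝕄} (h : Rlz L 𝒟 a C)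
    (hMC : Ms ⊆ C) : Rlz L (𝒟.map fun y => Sum.elim y fun x : Ms => (x : 𝕄))
      (Sum.elim a fun x : Ms => (x : 𝕄)) C :=
  fun _ hS hSD => h _ (Definable.elim_const hS _ fun x => hMC x.2) hSD

theorem Coh.elim_const {𝒟 : Ultrafilter (β → 𝕄)} (h : Coh Ms 𝒟) :
    Coh Ms (𝒟.map fun y => Sum.elim y fun x : Ms => (x : 𝕄)) := by
  change {y | ∀ i, Sum.elim y (fun x : Ms => (x : 𝕄)) i ∈ Ms} ∈ 𝒟
  filter_upwards [h] with y hy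
  rintro (i | x)
  · exact hy i
  · exact x.2

theorem MorleySeq.elim_const {𝒟 : Ultrafilter (β → 𝕄)} {Y : ℕ → β → 𝕄} (h : MorleySeq L 𝒟 Ms Y) :
    MorleySeq L (𝒟.map fun y => Sum.elim y fun x : Ms => (x : 𝕄)) Ms
      fun i => Sum.elim (Y i) fun x : Ms => (x : 𝕄) := by
  intro i
  refine ((h i).elim_const Set.subset_union_left).mono ?_
  refine Set.union_subset Set.subset_union_left (Set.iUnion₂_subset fun j hj => ?_)
  rintro _ ⟨k | x, rfl⟩
  · exact Or.inr (Set.mem_iUnion₂.2 ⟨j, hj, k, rfl⟩)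
  · exact Or.inl x.2

theorem fibre_equiv_iff {S : Set (α ⊕ β → 𝕄)} (hS : Ms.Definable L S) {b : β → 𝕄} {n : ℕ}
    {φ : L.Formula (α ⊕ Fin n)} {d : Fin n → 𝕄}
    (h : ∀ x, Sum.elim x b ∈ S ↔ φ.Realize (Sum.elim x d)) {σ : 𝕄 ≃[L] 𝕄}
    (hσ : ∀ x ∈ Ms, σ x = x) (x : α → 𝕄) :
    Sum.elim x (σ ∘ b) ∈ S ↔ φ.Realize (Sum.elim x (σ ∘ d)) := by
  have hx : x = σ ∘ (σ.symm ∘ x) := by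
    funext i
    simp
  rw [hx, Definable.elim_equiv_iff hS hσ, h]
  exact (Definable.elim_equiv_iff (definable_realize φ) hσ (σ.symm ∘ x) d).symm

/-- A fibre which does not Conant-divide is consistent along canonical Morley sequences. -/
theorem exists_mem_of_not_cDiv [Nonempty 𝕄] (hm : IsMonster L 𝕄 κ) (hN : ¬ HasSOP2 L 𝕄)
    (hR : GoodRel R κ) (hMe : IsElemSubmodel L Ms) (hMs : Small κ Ms) (hγ : Small κ γ)
    (hβ : Small κ β) (h𝒬 : Canon R κ Ms 𝒬) {c : γ → 𝕄} (hc : Rlz L 𝒬 c Ms) (f : β → γ)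
    {S : Set (α ⊕ β → 𝕄)} (hS : Ms.Definable L S) (hSc : ¬ CDiv L Ms S (c ∘ f))
    {l : List (γ → 𝕄)} (hl : MorleyList L 𝒬 Ms l) :
    ∃ x : α → 𝕄, ∀ y ∈ l, Sum.elim x (y ∘ f) ∈ S := by
  obtain ⟨n, φ, d, hd, hφ⟩ := exists_formula_fibre hS (b := c ∘ f)
    (Set.subset_union_left : Ms ⊆ Ms ∪ Set.range (c ∘ f)) Set.subset_union_right
  have hd' : ∀ i, ∃ p : (β ⊕ Ms) × γ, Sum.elim (c ∘ f) (fun x : Ms => (x : 𝕄)) p.1 = d i ∧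
      c p.2 = d i := by
    intro i
    rcases hd i with h | ⟨j, hj⟩
    · obtain ⟨k, hk⟩ := h𝒬.subset_range c hc h
      exact ⟨(Sum.inr ⟨_, h⟩, k), rfl, hk⟩
    · exact ⟨(Sum.inl j, f j), hj, hj⟩
  choose p hp using hd'
  have hg : c ∘ (fun i => (p i).2) = d := funext fun i => (hp i).2
  have hg' : Sum.elim (c ∘ f) (fun x : Ms => (x : 𝕄)) ∘ (fun i => (p i).1) = d :=
    funext fun i => (hp i).1
  have hcon : ∀ n, ∃ r, FSL L Ms (c ∘ fun i => (p i).2) r ∧ r.length = n ∧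
      ∃ x : α → 𝕄, ∀ a ∈ r, φ.Realize (Sum.elim x a) := by
    intro n
    simp only [CDiv, not_forall, not_not] at hSc
    obtain ⟨𝒟, Y, h𝒟, hY, hY0, x, hx⟩ := hSc
    refine ⟨(initList (fun i => Sum.elim (Y i) fun x : Ms => (x : 𝕄)) n).map
      fun a => a ∘ fun i => (p i).1, ?_, ?_, x, ?_⟩
    · rw [hg, ← hg', ← hY0]
      exact (hY.elim_const.morleyList n).fsl h𝒟.elim_const (hY.elim_const.rlz 0) _
    · rw [List.length_map, length_initList]
    · intro a ha
      obtain ⟨_, hb, rfl⟩ := List.mem_map.1 ha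
      obtain ⟨i, -, rfl⟩ := mem_initList.1 hb
      obtain ⟨σ, hσ, hσY⟩ := hm.exists_equiv hβ hMs ((hY.rlz 0).eqTp (hY.rlz i))
      rw [hY0] at hσY
      have := (fibre_equiv_iff hS hφ hσ x).1 (by rw [hσY]; exact hx i)
      convert this
      rw [← hg', ← hσY]
      funext k
      rcases h : (p k).1 with j | j
      · simp [h]
      · simp [h, hσ _ j.2]
  obtain ⟨x, hx⟩ := exists_realize_of_forall_fsl hm hN hR hMe hMs hγ h𝒬 hc _ φ hcon hl
  refine ⟨x, fun y hy => ?_⟩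
  obtain ⟨σ, hσ, rfl⟩ := hm.exists_equiv hγ hMs (hc.eqTp (hl.rlz y hy))
  refine (fibre_equiv_iff hS hφ hσ x).2 ?_
  rw [← hg]
  exact hx _ hy

/-- Conant-dividing formulas are uniformly inconsistent. -/
theorem exists_bound_of_cDiv [Nonempty 𝕄] (hm : IsMonster L 𝕄 κ) (hN : ¬ HasSOP2 L 𝕄)
    (hR : GoodRel R κ) (hMe : IsElemSubmodel L Ms) (hMs : Small κ Ms) (hγ : Small κ γ)
    (hα : Small κ α) (h𝒬 : Canon R κ Ms 𝒬) {c : γ → 𝕄} (hc : Rlz L 𝒬 c Ms) {m : ℕ}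
    (g : Fin m → γ) (φ : L.Formula (α ⊕ Fin m)) (h : CDiv L Ms {z | φ.Realize z} (c ∘ g)) :
    ∃ k, ∀ r, FSL L Ms (c ∘ g) r → r.length = k →
      ¬ ∃ x : α → 𝕄, ∀ a ∈ r, φ.Realize (Sum.elim x a) := by
  by_contra! hcon
  obtain ⟨Y, hY, hY0⟩ := hm.exists_morleySeq hγ 𝒬 hMs hc
  obtain ⟨x, hx⟩ := hm.exists_forall_mem hα hγ (C := (∅ : Set 𝕄)) (Small.of_countable hm.1 _)
    (ι := Unit) (S := fun _ => {z : α ⊕ γ → 𝕄 | φ.Realize (z ∘ Sum.map id g)})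
    (fun _ => (definable_realize φ).preimage_comp _) Y (fun _ n => by
      obtain ⟨x, hx⟩ := exists_realize_of_forall_fsl hm hN hR hMe hMs hγ h𝒬 hc g φ hcon
        (hY.morleyList n)
      refine ⟨x, fun _ _ y hy => ?_⟩
      simpa only [Set.mem_ofPred_eq, Sum.elim_comp_map, Function.comp_id] using hx y hy)
  refine h _ _ (h𝒬.coh.map g) (hY.map g) (by rw [hY0]) ⟨x, fun n => ?_⟩
  simpa only [Set.mem_ofPred_eq, Sum.elim_comp_map, Function.comp_id] using hx () n

/-- If `a` is independent from `c ∘ f`, then any canonical Morley sequence in `tp(c / Ms)` is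
conjugate over `Ms` to one which looks like `c` over `a` as far as the coordinates `f` go. -/
theorem ND.exists_eqTp_morleySeq [Nonempty 𝕄] (hm : IsMonster L 𝕄 κ) (hN : ¬ HasSOP2 L 𝕄)
    (hR : GoodRel R κ) (hMe : IsElemSubmodel L Ms) (hMs : Small κ Ms) (hγ : Small κ γ)
    (hβ : Small κ β) (hα : Small κ α) (h𝒬 : Canon R κ Ms 𝒬) {c : γ → 𝕄} (hc : Rlz L 𝒬 c Ms)
    (f : β → γ) {a : α → 𝕄} (h : ND L Ms a (c ∘ f)) {Y : ℕ → γ → 𝕄} (hY : MorleySeq L 𝒬 Ms Y) :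
    ∃ x : α → 𝕄, ∀ i, EqTpOver L Ms (Sum.elim x (Y i ∘ f)) (Sum.elim a (c ∘ f)) := by
  obtain ⟨x, hx⟩ := hm.exists_forall_mem hα hγ hMs
    (ι := {S : Set (α ⊕ β → 𝕄) // Ms.Definable L S ∧ Sum.elim a (c ∘ f) ∈ S})
    (S := fun S => {z : α ⊕ γ → 𝕄 | z ∘ Sum.map id f ∈ S.1})
    (fun S => S.2.1.preimage_comp _) Y (fun t n => by
      have hd : Ms.Definable L (⋂ S ∈ t, S.1) := Set.definable_biInter_finset (fun S => S.2.1) t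
      obtain ⟨x, hx⟩ := exists_mem_of_not_cDiv hm hN hR hMe hMs hγ hβ h𝒬 hc f hd
        (h _ hd (Set.mem_iInter₂.2 fun S _ => S.2.2)) (hY.morleyList n)
      refine ⟨x, fun S hS y hy => ?_⟩
      have := Set.mem_iInter₂.1 (hx y hy) S hS
      simpa only [Set.mem_ofPred_eq, Sum.elim_comp_map, Function.comp_id] using this)
  refine ⟨x, fun i => EqTpOver.of_forall_mem fun S hS ha => ?_⟩
  have := hx ⟨S, hS, ha⟩ i
  simpa only [Set.mem_ofPred_eq, Sum.elim_comp_map, Function.comp_id] using this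

end CanonicalConsistency


section SymmetryTrees

variable {L : FirstOrder.Language.{u, u}} {𝕄 : Type u} [L.Structure 𝕄] {κ : Cardinal.{u}}
  {β : Type w} {γ : Type u} {δ : Type x} {J : Type v} {Ms : Set 𝕄}

theorem params_append (l l' : List (J → 𝕄)) : params (l ++ l') = params l ∪ params l' := by
  induction l with
  | nil => simp
  | cons a l ih => rw [List.cons_append, params_cons, ih, params_cons, Set.union_assoc]

theorem MorleyList.append {𝒟 : Ultrafilter (J → 𝕄)} {C : Set 𝕄} {l' : List (J → 𝕄)}
    (h' : MorleyList L 𝒟 C l') : ∀ {l : List (J → 𝕄)}, MorleyList L 𝒟 (C ∪ params l') l →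
    MorleyList L 𝒟 C (l ++ l')
  | [], _ => h'
  | a :: l, h => by
    refine ⟨?_, h'.append h.2⟩
    have := h.1
    rwa [Set.union_assoc, Set.union_comm (params l'), ← params_append] at this

theorem MorleyList.mono {𝒟 : Ultrafilter (J → 𝕄)} {C D : Set 𝕄} (hCD : C ⊆ D) :
    ∀ {l : List (J → 𝕄)}, MorleyList L 𝒟 D l → MorleyList L 𝒟 C l
  | [], _ => trivial
  | _ :: _, h => ⟨h.1.mono (Set.union_subset_union_left _ hCD), h.2.mono hCD⟩

/-- Families which are consistent along Morley sequences of `𝒟` are consistent along Morley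
sequences of Morley sequences of `𝒟`. -/
theorem exists_forall_mem_power (hm : IsMonster L 𝕄 κ) (hδ : Small κ δ) (hJ : Small κ J)
    (hMs : Small κ Ms) {𝒟 : Ultrafilter (J → 𝕄)} {𝒟ω : Ultrafilter (ℕ × J → 𝕄)}
    (hω : ∀ C : Set 𝕄, Small κ C → Ms ⊆ C → ∀ Y : ℕ → J → 𝕄,
      Rlz L 𝒟ω (flatSeq Y) C ↔ MorleySeq L 𝒟 C Y)
    {ι : Type*} {S : ι → Set (δ ⊕ J → 𝕄)} (hS : ∀ i, Ms.Definable L (S i))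
    (h : ∀ l, MorleyList L 𝒟 Ms l → ∃ x : δ → 𝕄, ∀ y ∈ l, ∀ i, Sum.elim x y ∈ S i)
    {W : ℕ → ℕ × J → 𝕄} (hW : MorleySeq L 𝒟ω Ms W) :
    ∃ x : δ → 𝕄, ∀ k i j, Sum.elim x (fun p => W k (i, p)) ∈ S j := by
  classical
  have hNJ : Small κ (ℕ × J) := (Small.of_countable hm.1 ℕ).prod hm.1 hJ
  have hrow : ∀ k, MorleySeq L 𝒟 (Ms ∪ ⋃ (j : ℕ) (_ : j < k), Set.range (W j))
      fun i p => W k (i, p) := fun k =>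
    (hω _ (hMs.union hm.1 (small_iUnion_range_lt hm.1 hNJ W k)) Set.subset_union_left _).1 (hW k)
  have hflat : ∀ n k, ∃ l, MorleyList L 𝒟 Ms l ∧
      params l ⊆ (⋃ (j : ℕ) (_ : j < k), Set.range (W j)) ∧
      ∀ j < k, ∀ i < n, (fun p => W j (i, p)) ∈ l := by
    intro n k
    induction k with
    | zero => exact ⟨[], trivial, by simp, fun j hj => absurd hj (Nat.not_lt_zero _)⟩
    | succ k ih =>
      obtain ⟨l, hl, hlp, hmem⟩ := ih
      refine ⟨initList (fun i p => W k (i, p)) n ++ l, hl.append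
        (((hrow k).morleyList n).mono (Set.union_subset_union_right _ hlp)), ?_, ?_⟩
      · rw [params_append, params_initList]
        refine Set.union_subset (Set.iUnion₂_subset fun j _ => ?_)
          (hlp.trans (Set.iUnion₂_subset fun j hj => ?_))
        · rintro _ ⟨p, rfl⟩
          exact Set.mem_iUnion₂.2 ⟨k, k.lt_succ_self, _, rfl⟩
        · exact fun x hx => Set.mem_iUnion₂.2 ⟨j, hj.trans k.lt_succ_self, hx⟩
      · intro j hj i hi
        rcases Nat.lt_succ_iff_lt_or_eq.1 hj with hj | rfl
        · exact List.mem_append_right _ (hmem j hj i hi)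
        · exact List.mem_append_left _ (mem_initList.2 ⟨i, hi, rfl⟩)
  obtain ⟨x, hx⟩ := hm.exists_forall_mem hδ hNJ hMs (ι := ℕ × ι)
    (S := fun q => {z : δ ⊕ ℕ × J → 𝕄 | z ∘ Sum.map id (fun p => (q.1, p)) ∈ S q.2})
    (fun q => (hS q.2).preimage_comp _) W (fun t n => by
      obtain ⟨l, hl, -, hmem⟩ := hflat (t.sup Prod.fst + 1) n
      obtain ⟨x, hx⟩ := h l hl
      refine ⟨x, fun q hq y hy => ?_⟩
      obtain ⟨k, hk, rfl⟩ := mem_initList.1 hy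
      have := hx _ (hmem k hk q.1 (Nat.lt_succ_of_le (Finset.le_sup hq))) q.2
      rw [Set.mem_ofPred_eq, Sum.elim_comp_map, Function.comp_id]
      exact this)
  refine ⟨x, fun k i j => ?_⟩
  have := hx (i, j) k
  rw [Set.mem_ofPred_eq, Sum.elim_comp_map, Function.comp_id] at this
  exact this

theorem FinSatIn.equiv {a : J → 𝕄} {C : Set 𝕄} (h : FinSatIn L Ms a C) {σ : 𝕄 ≃[L] 𝕄}
    (hσ : ∀ x ∈ Ms, σ x = x) : FinSatIn L Ms (σ ∘ a) (σ '' C) := by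
  obtain ⟨𝒟, h𝒟, ha⟩ := exists_coh_of_finSat h
  exact (ha.equiv h𝒟 hσ).finSat h𝒟

/-- A tree of conjugates of `d` together with a tree of conjugates of `c ∘ f = b`, such that the
latter are conjugate to `b` over the former. -/
structure SymTree (Ms : Set 𝕄) (f : β → γ) (d : δ → 𝕄) (b : β → 𝕄) (n : ℕ)
    (𝒟 : Ultrafilter (List ℕ × γ → 𝕄)) (Y : ℕ → List ℕ × γ → 𝕄) (D : List ℕ × δ → 𝕄) : Prop where
  coh : Coh Ms 𝒟
  morley : MorleySeq L 𝒟 Ms Y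
  exists_root : ∃ x : δ → 𝕄, ∀ i σ, EqTpOver L Ms (Sum.elim x (node (Y i) σ ∘ f)) (Sum.elim d b)
  path : ∀ η σ : List ℕ, η <+: σ →
    EqTpOver L Ms (Sum.elim (node D η) (node (Y 0) σ ∘ f)) (Sum.elim d b)
  fork : ∀ (ν : List ℕ) (c : ℕ) (ζ : List ℕ), ν.length < n → ν ++ [c] <+: ζ →
    FinSatIn L Ms (node D ζ) (Ms ∪ leftCones D ν c)

theorem exists_root_of_morleyList (hm : IsMonster L 𝕄 κ) (hJ : Small κ J) (hMs : Small κ Ms)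
    {𝒟 : Ultrafilter (J → 𝕄)} (h𝒟 : Coh Ms 𝒟) {Y : ℕ → J → 𝕄} (hY : MorleySeq L 𝒟 Ms Y)
    {x : δ → 𝕄} {ι : Type*} {S : ι → Set (δ ⊕ J → 𝕄)} (hS : ∀ j, Ms.Definable L (S j))
    (hx : ∀ i j, Sum.elim x (Y i) ∈ S j) {l : List (J → 𝕄)} (hl : MorleyList L 𝒟 Ms l) :
    ∃ x : δ → 𝕄, ∀ y ∈ l, ∀ j, Sum.elim x y ∈ S j := by
  obtain ⟨τ, hτ, hτl⟩ := (hY.morleyList l.length).exists_equiv hm hJ hMs subset_rfl h𝒟 hl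
    (length_initList _ _)
  refine ⟨τ ∘ x, fun y hy j => ?_⟩
  rw [← hτl] at hy
  obtain ⟨_, hz, rfl⟩ := List.mem_map.1 hy
  obtain ⟨i, -, rfl⟩ := mem_initList.1 hz
  exact (Definable.elim_equiv_iff (hS j) hτ _ _).2 (hx i j)

theorem IsElemSubmodel.nonempty [Nonempty 𝕄] (hMe : IsElemSubmodel L Ms) : Ms.Nonempty := by
  obtain ⟨m, -, hm, -⟩ := hMe.exists_mem (S := (Set.univ : Set (Unit → 𝕄))) Set.definable_univ
    (x₀ := fun _ => Classical.arbitrary 𝕄) trivial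
  exact ⟨_, hm ()⟩

theorem SymTree.exists_succ [Nonempty 𝕄] (hm : IsMonster L 𝕄 κ) (hMe : IsElemSubmodel L Ms)
    (hMs : Small κ Ms) (hγ : Small κ γ) (hδ : Small κ δ) {f : β → γ} {d : δ → 𝕄} {b : β → 𝕄}
    {n : ℕ} {𝒟 : Ultrafilter (List ℕ × γ → 𝕄)} {Y : ℕ → List ℕ × γ → 𝕄} {D : List ℕ × δ → 𝕄}
    (h : SymTree (L := L) Ms f d b n 𝒟 Y D) :
    ∃ 𝒟' Y' D', SymTree (L := L) Ms f d b (n + 1) 𝒟' Y' D' := by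
  have hJ : Small κ (List ℕ × γ) := (Small.of_countable hm.1 _).prod hm.1 hγ
  have hJ' : Small κ (List ℕ × δ) := (Small.of_countable hm.1 _).prod hm.1 hδ
  have hne := hMe.nonempty
  obtain ⟨x, hx⟩ := h.exists_root
  obtain ⟨𝓔, h𝓔, hD, h𝒟𝓔⟩ := exists_coh_extension hMe h.coh (c := Sum.elim (Y 0) D) (f := Sum.inl)
    (by rw [Sum.elim_comp_inl]; exact h.morley.rlz 0)
    fun S hS => Definable.image_comp_of_injective hS Sum.inl_injective
  obtain ⟨Z, hZ, hZ0⟩ := hm.exists_morleySeq (hJ.sum hm.1 hJ') 𝓔 hMs hD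
  have hB : MorleySeq L 𝒟 Ms fun i => Z i ∘ Sum.inl := hZ.of_map fun S _ hS => h𝒟𝓔 S hS
  obtain ⟨τ, hτ, hτB⟩ := h.morley.exists_equiv hm hJ hMs subset_rfl h.coh hB
  have hx' : ∀ i σ, EqTpOver L Ms (Sum.elim (τ ∘ x) (node (Z i ∘ Sum.inl) σ ∘ f))
      (Sum.elim d b) := by
    intro i σ
    refine EqTpOver.trans ?_ (hx i σ)
    rw [← hτB i]
    have := EqTpOver.of_equiv hτ (Sum.elim x (node (Y i) σ ∘ f))
    rwa [Sum.comp_elim] at this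
  obtain ⟨𝒟ω, h𝒟ω, hω⟩ := exists_coh_power hm hJ hne hMs h.coh
  obtain ⟨W, hW, hW0⟩ := hm.exists_morleySeq ((Small.of_countable hm.1 ℕ).prod hm.1 hJ) 𝒟ω hMs
    ((hω Ms hMs subset_rfl _).2 hB)
  let r : List ℕ × γ → ℕ × List ℕ × γ
    | ([], j) => (0, [], j)
    | (i :: η, j) => (i, η, j)
  let D' : List ℕ × δ → 𝕄
    | ([], j) => (τ ∘ x) j
    | (i :: η, j) => Z i (Sum.inr (η, j))
  have hY'c : ∀ i η, node (W 0 ∘ r) (i :: η) = node (Z i ∘ Sum.inl) η := by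
    intro i η
    rw [hW0]
    rfl
  have heq : ∀ i, EqTpOver L Ms (Z i) (Sum.elim (Y 0) D) := fun i => (hZ.rlz i).eqTp hD
  have hD'c : ∀ i η, node D' (i :: η) = node (Z i ∘ Sum.inr) η := fun _ _ => rfl
  refine ⟨𝒟ω.map fun x => x ∘ r, fun k => W k ∘ r, D', h𝒟ω.map r, hW.map r, ?_, ?_, ?_⟩
  · let S : List ℕ × {S : Set (δ ⊕ β → 𝕄) // Ms.Definable L S ∧ Sum.elim d b ∈ S} →
        Set (δ ⊕ List ℕ × γ → 𝕄) :=
      fun q => {z | z ∘ Sum.map id (fun j => (q.1, f j)) ∈ q.2.1}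
    have hS : ∀ q, Ms.Definable L (S q) := fun q => q.2.2.1.preimage_comp _
    have hmem : ∀ (x : δ → 𝕄) (y : List ℕ × γ → 𝕄) q,
        Sum.elim x y ∈ S q ↔ Sum.elim x (node y q.1 ∘ f) ∈ q.2.1 := by
      intro x y q
      rw [Set.mem_ofPred_eq, Sum.elim_comp_map]
      rfl
    obtain ⟨x', hx'⟩ := exists_forall_mem_power hm hδ hJ hMs hω hS
      (fun l hl => exists_root_of_morleyList hm hJ hMs h.coh h.morley hS (x := x)
        (fun i q => (hmem _ _ _).2 ((eqTpOver_iff.1 (hx i q.1) _ q.2.2.1).2 q.2.2.2)) hl) hW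
    refine ⟨x', fun k σ => .of_forall_mem fun T hT hd => ?_⟩
    rcases σ with _ | ⟨i, σ⟩
    · exact (hmem _ _ _).1 (hx' k 0 ([], ⟨T, hT, hd⟩))
    · exact (hmem _ _ _).1 (hx' k i (σ, ⟨T, hT, hd⟩))
  · rintro (_ | ⟨i, η⟩) (_ | ⟨j, σ⟩) hησ
    · change EqTpOver L Ms (Sum.elim (τ ∘ x) _) _
      convert hx' 0 [] using 3
      rw [hW0]
      rfl
    · rw [hY'c]
      exact hx' j σ
    · simp at hησ
    · obtain ⟨rfl, hησ'⟩ := List.cons_prefix_cons.1 hησ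
      rw [hY'c, hD'c]
      refine EqTpOver.trans ?_ (h.path η σ hησ')
      have := (heq i).comp
        (Sum.elim (fun j => Sum.inr (η, j)) (fun j => Sum.inl (σ, f j)) :
          δ ⊕ β → (List ℕ × γ) ⊕ (List ℕ × δ))
      rw [Sum.comp_elim, Sum.comp_elim] at this
      exact this
  · rintro (_ | ⟨i, ν⟩) k ζ hν hζ
    · rcases ζ with _ | ⟨i, ζ⟩
      · simp at hζ
      · obtain ⟨rfl, -⟩ := List.cons_prefix_cons.1 hζ
        rw [hD'c]
        refine (((hZ k).finSat h𝓔).comp fun j => Sum.inr (ζ, j)).mono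
          (Set.union_subset_union_right _ ?_)
        rintro x ⟨c', hc', ζ', hζ', hx⟩
        rcases ζ' with _ | ⟨i, ζ'⟩
        · simp at hζ'
        · obtain ⟨rfl, -⟩ := List.cons_prefix_cons.1 hζ'
          obtain ⟨j, rfl⟩ := hx
          exact Set.mem_iUnion₂.2 ⟨c', hc', _, rfl⟩
    · rcases ζ with _ | ⟨i', ζ⟩
      · simp at hζ
      · obtain ⟨rfl, hkζ⟩ := List.cons_prefix_cons.1 hζ
        obtain ⟨σ, hσ, hσZ⟩ := hm.exists_equiv (hJ.sum hm.1 hJ') hMs (heq i).symm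
        have hσD : σ ∘ D = Z i ∘ Sum.inr := by
          rw [← hσZ]
          rfl
        have := (h.fork ν k ζ (by simpa using hν) hkζ).equiv hσ
        rw [Set.image_union, image_eq_of_fix hσ, image_leftCones, hσD] at this
        rw [hD'c]
        have hnode : node (Z i ∘ Sum.inr) ζ = σ ∘ node D ζ := by
          rw [← hσD]
          rfl
        rw [hnode]
        refine this.mono (Set.union_subset_union_right _ ?_)
        rintro x ⟨c', hc', ζ', hζ', hx⟩
        rcases ζ' with _ | ⟨i', ζ'⟩
        · simp at hζ'
        · obtain ⟨rfl, hkζ'⟩ := List.cons_prefix_cons.1 hζ'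
          exact ⟨c', hc', ζ', hkζ', hx⟩

end SymmetryTrees


section Symmetry

variable {L : FirstOrder.Language.{u, u}} {𝕄 : Type u} [L.Structure 𝕄] {κ : Cardinal.{u}}
  {α : Type v} {β : Type w} {δ : Type x} {Ms : Set 𝕄} {R : IndRel L 𝕄}

theorem ND.exists_symTree [Nonempty 𝕄] (hm : IsMonster L 𝕄 κ) (hN : ¬ HasSOP2 L 𝕄)
    (hR : GoodRel R κ) (hMe : IsElemSubmodel L Ms) (hMs : Small κ Ms) {γ : Type u}
    (hγ : Small κ γ) (hβ : Small κ β) (hδ : Small κ δ) {𝒬 : Ultrafilter (γ → 𝕄)}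
    (h𝒬 : Canon R κ Ms 𝒬) {c : γ → 𝕄} (hc : Rlz L 𝒬 c Ms) (f : β → γ) {d : δ → 𝕄}
    (h : ND L Ms d (c ∘ f)) (n : ℕ) :
    ∃ 𝒟 Y D, SymTree (L := L) Ms f d (c ∘ f) n 𝒟 Y D := by
  induction n with
  | zero =>
    obtain ⟨E, hE, -⟩ := hm.exists_morleySeq hγ 𝒬 hMs hc
    obtain ⟨x, hx⟩ := h.exists_eqTp_morleySeq hm hN hR hMe hMs hγ hβ hδ h𝒬 hc f hE
    exact ⟨𝒬.map fun y => y ∘ Prod.snd, fun i => E i ∘ Prod.snd, x ∘ Prod.snd,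
      h𝒬.coh.map _, hE.map _, ⟨x, fun i _ => hx i⟩, fun _ _ _ => hx 0,
      fun _ _ _ hν => absurd hν (Nat.not_lt_zero _)⟩
  | succ n ih =>
    obtain ⟨𝒟, Y, D, hT⟩ := ih
    exact hT.exists_succ hm hMe hMs hγ hδ

theorem ND.elim_const_comp {a : α → 𝕄} {b : β → 𝕄} (h : ND L Ms a b) (p : δ → α ⊕ Ms) :
    ND L Ms (Sum.elim a (fun x : Ms => (x : 𝕄)) ∘ p) b := by
  intro S hS hmem hdiv
  set r : δ ⊕ β → (α ⊕ β) ⊕ Ms :=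
    Sum.elim (fun i => Sum.map Sum.inl id (p i)) (Sum.inl ∘ Sum.inr) with hr
  have key : ∀ (x : α → 𝕄) (y : β → 𝕄), Sum.elim (Sum.elim x y) (fun m : Ms => (m : 𝕄)) ∘ r =
      Sum.elim (Sum.elim x (fun m : Ms => (m : 𝕄)) ∘ p) y := by
    intro x y
    funext i
    rcases i with i | i
    · rcases hp : p i with j | j <;> simp [hr, hp]
    · rfl
  refine h {z | Sum.elim z (fun m : Ms => (m : 𝕄)) ∘ r ∈ S}
    (Definable.elim_const (hS.preimage_comp r) _ fun m => m.2) ?_ ?_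
  · rw [Set.mem_ofPred_eq, key]
    exact hmem
  · rintro 𝒟 Y h𝒟 hY h0 ⟨x, hx⟩
    exact hdiv 𝒟 Y h𝒟 hY h0 ⟨Sum.elim x (fun m : Ms => (m : 𝕄)) ∘ p, fun i => key x (Y i) ▸ hx i⟩

/-- The nodes of a comb in a symmetric tree form a coheir sequence. -/
theorem SymTree.fsl {γ : Type u} {f : β → γ} {d : δ → 𝕄} {b : β → 𝕄} {n : ℕ}
    {𝒟 : Ultrafilter (List ℕ × γ → 𝕄)} {Y : ℕ → List ℕ × γ → 𝕄} {D : List ℕ × δ → 𝕄}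
    (h : SymTree (L := L) Ms f d b n 𝒟 Y D) : ∀ {l : List (List ℕ)}, Comb l →
    (∀ η ∈ l, η.length ≤ n) → FSL L Ms d (l.map fun η => node D η)
  | [], _, _ => trivial
  | η :: l, hl, hn => by
    refine ⟨h.fsl hl.1 fun ζ hζ => hn ζ (List.mem_cons_of_mem _ hζ), ?_, ?_⟩
    · simpa only [Sum.elim_comp_inl] using (h.path η η List.prefix_rfl).comp Sum.inl
    · obtain ⟨ν, c, hη, hrest⟩ := hl.2
      have hlen : ν.length < n := by
        have h1 := hη.length_le
        have h2 := hn η List.mem_cons_self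
        rw [List.length_append, List.length_singleton] at h1
        omega
      refine (h.fork ν c η hlen hη).mono (Set.union_subset_union_right _ ?_)
      rintro x ⟨_, ha, hx⟩
      obtain ⟨ζ, hζ, rfl⟩ := List.mem_map.1 ha
      obtain ⟨c', hc', hζ'⟩ := hrest ζ hζ
      exact ⟨c', hc', ζ, hζ', hx⟩

theorem ND.symm [Nonempty 𝕄] (hm : IsMonster L 𝕄 κ) (hN : ¬ HasSOP2 L 𝕄)
    (hR : GoodRel R κ) (hMe : IsElemSubmodel L Ms) (hMs : Small κ Ms) (hα : Small κ α)
    (hβ : Small κ β) (hC : HasCanon R κ Ms) {a : α → 𝕄} {b : β → 𝕄} (h : ND L Ms a b) :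
    ND L Ms b a := by
  intro S hS hmem hdiv
  obtain ⟨m, φ, d, hd, hφ⟩ := exists_formula_fibre hS (b := a) (C := Ms ∪ Set.range a)
    Set.subset_union_left Set.subset_union_right
  have hdiv' : CDiv L Ms {z | φ.Realize z} d := conantDivides_iff.1
    (hdiv.conantDivides hm hα hMe hMs hS fun x hx => (hφ x).2 hx)
  have hm' : Small κ (Fin m) := Small.of_countable hm.1 _
  have hdb : ND L Ms d b := by
    have : ∀ i, ∃ j : α ⊕ Ms, Sum.elim a (fun x : Ms => (x : 𝕄)) j = d i := fun i => by
      rcases hd i with hi | ⟨j, hj⟩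
      · exact ⟨Sum.inr ⟨_, hi⟩, rfl⟩
      · exact ⟨Sum.inl j, hj⟩
    choose p hp using this
    rw [← funext hp]
    exact h.elim_const_comp p
  obtain ⟨δ₁, 𝒬₁, c₁, g, hδ₁, h𝒬₁, hc₁, hg⟩ := hC.exists_canon hm' d
  obtain ⟨k, hk⟩ := exists_bound_of_cDiv hm hN hR hMe hMs hδ₁ hβ h𝒬₁ hc₁ g φ
    (by rw [hg]; exact hdiv')
  obtain ⟨γ, 𝒬, c, f, hγ, h𝒬, hc, hf⟩ := hC.exists_canon hβ b
  refine not_forall_exists_comb_tree hm hN φ k fun N => ?_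
  obtain ⟨𝒟, Y, D, hT⟩ := ND.exists_symTree hm hN hR hMe hMs hγ hβ hm' h𝒬 hc f
    (by rw [hf]; exact hdb) N
  refine ⟨fun η => node D η, fun σ _ => ⟨node (Y 0) σ ∘ f, fun η hη => ?_⟩,
    fun l hl hlk hlN => ?_⟩
  · have := (eqTpOver_iff.1 ((hT.path η σ hη).comp Sum.swap) {z | φ.Realize z}
      (definable_realize φ)).2 (by
        rw [Set.mem_ofPred_eq, Sum.elim_swap, hf]
        exact (hφ b).1 hmem)
    rwa [Set.mem_ofPred_eq, Sum.elim_swap] at this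
  · rintro ⟨x, hx⟩
    refine hk _ (by rw [hg]; exact hT.fsl hl hlN) (by rwa [List.length_map]) ⟨x, fun y hy => ?_⟩
    obtain ⟨η, hη, rfl⟩ := List.mem_map.1 hy
    exact hx η hη

end Symmetry


section Independence

variable {L : FirstOrder.Language.{u, u}} {𝕄 : Type u} [L.Structure 𝕄] {κ : Cardinal.{u}}
  {α : Type u} {β γ : Type u} {Ms : Set 𝕄} {R : IndRel L 𝕄}

/-- Types of subtuples over `b` which are consistent along one coheir Morley sequence of `b` have a
common realization which is Conant-independent from `b`. -/
theorem exists_nd_of_morleySeq [Nonempty 𝕄] (hm : IsMonster L 𝕄 κ) (hα : Small κ α)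
    (hβ : Small κ β) (hMe : IsElemSubmodel L Ms) (hMs : Small κ Ms) {b : β → 𝕄} {ι : Type*}
    {J : ι → Type*} (p : ∀ j, J j → α ⊕ β) (t : ∀ j, J j → 𝕄)
    {𝒟 : Ultrafilter (γ → 𝕄)} (h𝒟 : Coh Ms 𝒟) {Y : ℕ → γ → 𝕄} (hY : MorleySeq L 𝒟 Ms Y)
    {g : β → γ} (hb : EqTpOver L Ms (Y 0 ∘ g) b) {x : α → 𝕄}
    (hx : ∀ i j, EqTpOver L Ms (Sum.elim x (Y i ∘ g) ∘ p j) (t j)) :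
    ∃ a : α → 𝕄, ND L Ms a b ∧ ∀ j, EqTpOver L Ms (Sum.elim a b ∘ p j) (t j) := by
  have hYb : ∀ i, EqTpOver L Ms (Y i ∘ g) b := fun i =>
    EqTpOver.trans (((hY.rlz i).eqTp (hY.rlz 0)).comp g) hb
  obtain ⟨a, ha, hab⟩ := exists_nd hm hα hβ hMe hMs (b := b)
    (𝓢 := {U : Set (α ⊕ β → 𝕄) | Ms.Definable L U ∧ ∀ y : α → 𝕄,
      (∀ j, EqTpOver L Ms (Sum.elim y b ∘ p j) (t j)) → Sum.elim y b ∈ U})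
    (fun U hU => hU.1) ⟨Set.definable_univ, fun _ _ => trivial⟩
    (fun S hS T hT => ⟨hS.1.inter hT.1, fun y hy => ⟨hS.2 y hy, hT.2 y hy⟩⟩) (fun U hU => by
      refine not_cDiv_of_morleySeq hm hβ hMs h𝒟 hY hU.1 (x := x) (fun i => ?_) hb
      obtain ⟨σ, hσ, hσb⟩ := hm.exists_equiv hβ hMs (hYb i)
      rw [← Definable.elim_equiv_iff hU.1 hσ, hσb]
      refine hU.2 _ fun j => EqTpOver.trans ?_ (hx i j)
      have := EqTpOver.of_equiv hσ (Sum.elim x (Y i ∘ g) ∘ p j)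
      rwa [← Function.comp_assoc, Sum.comp_elim, hσb] at this)
  refine ⟨a, hab, fun j => EqTpOver.of_forall_mem fun S hS hmem => ?_⟩
  exact ha {z | z ∘ p j ∈ S} ⟨hS.preimage_comp _, fun y hy => (eqTpOver_iff.1 (hy j) S hS).2 hmem⟩

/-- Two tuples independent from `a` can be amalgamated to a pair independent from `a`. -/
theorem ND.exists_nd_pair [Nonempty 𝕄] (hm : IsMonster L 𝕄 κ) (hN : ¬ HasSOP2 L 𝕄)
    (hR : GoodRel R κ) (hMe : IsElemSubmodel L Ms) (hMs : Small κ Ms) (hα : Small κ α)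
    (hβ : Small κ β) (hγ : Small κ γ) (hC : HasCanon R κ Ms) {a : α → 𝕄} {b : β → 𝕄} {c : γ → 𝕄}
    (hb : ND L Ms b a) (hc : ND L Ms c a) :
    ∃ c' : γ → 𝕄, EqTpOver L Ms (Sum.elim c' a) (Sum.elim c a) ∧
      ND L Ms (Sum.elim b c') a := by
  obtain ⟨δ, 𝒬, e, f, hδ, h𝒬, he, rfl⟩ := hC.exists_canon hα a
  obtain ⟨Y, hY, hY0⟩ := hm.exists_morleySeq hδ 𝒬 hMs he
  obtain ⟨y, hy⟩ := hb.exists_eqTp_morleySeq hm hN hR hMe hMs hδ hα hβ h𝒬 he f hY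
  obtain ⟨z, hz⟩ := hc.exists_eqTp_morleySeq hm hN hR hMe hMs hδ hα hγ h𝒬 he f hY
  obtain ⟨w, hw, hwt⟩ := exists_nd_of_morleySeq hm (hβ.sum hm.1 hγ) hα hMe hMs (b := e ∘ f)
    (ι := Bool) (J := fun j => bif j then β ⊕ α else γ ⊕ α)
    (fun j => match j with
      | true => Sum.map Sum.inl id
      | false => Sum.map Sum.inr id)
    (fun j => match j with
      | true => Sum.elim b (e ∘ f)
      | false => Sum.elim c (e ∘ f))
    h𝒬.coh hY (g := f) (by rw [hY0]; exact EqTpOver.refl _) (x := Sum.elim y z)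
    (fun i j => by
      cases j
      · simpa [Sum.elim_comp_map] using hz i
      · simpa [Sum.elim_comp_map] using hy i)
  have h1 : EqTpOver L Ms (Sum.elim (w ∘ Sum.inl) (e ∘ f)) (Sum.elim b (e ∘ f)) := by
    simpa [Sum.elim_comp_map] using hwt true
  have h2 : EqTpOver L Ms (Sum.elim (w ∘ Sum.inr) (e ∘ f)) (Sum.elim c (e ∘ f)) := by
    simpa [Sum.elim_comp_map] using hwt false
  obtain ⟨σ, hσ, hσb⟩ := hm.exists_equiv (hβ.sum hm.1 hα) hMs h1
  rw [Sum.comp_elim] at hσb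
  have hσ1 : σ ∘ w ∘ Sum.inl = b := by simpa using congrArg (· ∘ Sum.inl) hσb
  have hσ2 : σ ∘ e ∘ f = e ∘ f := by simpa using congrArg (· ∘ Sum.inr) hσb
  have hσw : Sum.elim b (σ ∘ w ∘ Sum.inr) = σ ∘ w := by
    rw [← hσ1]
    exact Sum.elim_comp_inl_inr (σ ∘ w)
  refine ⟨σ ∘ w ∘ Sum.inr, ?_, ?_⟩
  · have := EqTpOver.of_equiv hσ (Sum.elim (w ∘ Sum.inr) (e ∘ f))
    rw [Sum.comp_elim, hσ2] at this
    exact this.trans h2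
  · rw [hσw]
    refine hw.of_eqTp hm hα hMs (EqTpOver.symm ?_)
    have := EqTpOver.of_equiv hσ (Sum.elim w (e ∘ f))
    rwa [Sum.comp_elim, hσ2] at this

end Independence


section Amalgamation

variable {L : FirstOrder.Language.{u, u}} {𝕄 : Type u} [L.Structure 𝕄] {κ : Cardinal.{u}}
  {α β₁ β₂ : Type u} {Ms : Set 𝕄} {R : IndRel L 𝕄}

/-- A strong canonical type extending `tp(c'/M)` gives a canonical ultrafilter with a realization
refining `(b, c')`, whose restriction to the second coordinates is realized over `b` by `c`. -/
theorem IsStrongCanonical.exists_canon_pair (hm : IsMonster L 𝕄 κ) (hR : R.StrongerThanH)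
    (hMe : IsElemSubmodel L Ms) (hMs : Small κ Ms) (hβ₁ : Small κ β₁) (hβ₂ : Small κ β₂)
    {q : GlobalType L 𝕄 β₂} (hq : IsStrongCanonical R κ Ms q) {b : β₁ → 𝕄} {c c' : β₂ → 𝕄}
    (hc : RealizesType q c (Ms ∪ Set.range b)) (hcc' : EqTpOver L Ms c' c) :
    ∃ (𝒬 : Ultrafilter ((β₁ ⊕ Ms) ⊕ β₂ → 𝕄)) (e : (β₁ ⊕ Ms) ⊕ β₂ → 𝕄), Canon R κ Ms 𝒬 ∧
      Rlz L 𝒬 e (Ms ∪ Set.range b) ∧ e ∘ Sum.inr = c ∧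
      Rlz L 𝒬 (Sum.elim (Sum.elim b fun x : Ms => (x : 𝕄)) c') Ms := by
  obtain ⟨σ, hσ, hσc⟩ := hm.exists_equiv hβ₂ hMs hcc'
  obtain ⟨𝒬, a, ha, h𝒬, he⟩ := hq.exists_canon hm hR hMe hMs hβ₂ hβ₁ hβ₁ hc (σ ∘ b)
  refine ⟨𝒬, _, h𝒬, he, Sum.elim_comp_inr _ _, ?_⟩
  have h : EqTpOver L Ms (Sum.elim a c) (Sum.elim b c') := by
    refine ha.elim.trans ?_
    rw [← hσc, ← Sum.comp_elim]
    exact EqTpOver.of_equiv hσ _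
  obtain ⟨τ, hτ, hτe⟩ := hm.exists_equiv (hβ₁.sum hm.1 hβ₂) hMs h
  refine (he.mono Set.subset_union_left).of_eqTp ?_
  have h1 : τ ∘ a = b := by simpa [Sum.comp_elim] using congrArg (· ∘ Sum.inl) hτe
  have h2 : τ ∘ c = c' := by simpa [Sum.comp_elim] using congrArg (· ∘ Sum.inr) hτe
  have h3 : (τ ∘ fun x : Ms => (x : 𝕄)) = fun x : Ms => (x : 𝕄) := funext fun x => hτ x x.2
  have := EqTpOver.of_equiv hτ (Sum.elim (Sum.elim a fun x : Ms => (x : 𝕄)) c)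
  rw [Sum.comp_elim, Sum.comp_elim, h1, h2, h3] at this
  exact this.symm

theorem ND.amalgamation [Nonempty 𝕄] (hm : IsMonster L 𝕄 κ) (hN : ¬ HasSOP2 L 𝕄)
    (hR : GoodRel R κ) (hMe : IsElemSubmodel L Ms) (hMs : Small κ Ms) (hα : Small κ α)
    (hβ₁ : Small κ β₁) (hβ₂ : Small κ β₂) {a₁ a₂ : α → 𝕄} {b₁ : β₁ → 𝕄} {b₂ : β₂ → 𝕄}
    (h1 : ND L Ms a₁ b₁) (h2 : ND L Ms a₂ b₂) (h12 : EqTpOver L Ms a₁ a₂)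
    {q : GlobalType L 𝕄 β₂} (hq : IsStrongCanonical R κ Ms q)
    (hqb : RealizesType q b₂ (Ms ∪ Set.range b₁)) :
    ∃ a : α → 𝕄, ND L Ms a (Sum.elim b₁ b₂) ∧
      EqTpOver L Ms (Sum.elim a b₁) (Sum.elim a₁ b₁) ∧
      EqTpOver L Ms (Sum.elim a b₂) (Sum.elim a₂ b₂) := by
  have hC : HasCanon R κ Ms := hq.hasCanon hm hR.1 hMe hMs hβ₂
    (c := b₂) fun n φ c hc => hqb n φ c fun i => Or.inl (hc i)
  have hβ := hβ₁.sum hm.1 hβ₂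
  have h1' := h1.symm hm hN hR hMe hMs hα hβ₁ hC
  have h2' := h2.symm hm hN hR hMe hMs hα hβ₂ hC
  obtain ⟨σ, hσ, hσa⟩ := hm.exists_equiv hα hMs h12.symm
  have hσ2 : EqTpOver L Ms (Sum.elim b₂ a₂) (Sum.elim (σ ∘ b₂) a₁) := by
    rw [← hσa, ← Sum.comp_elim]
    exact (EqTpOver.of_equiv hσ _).symm
  obtain ⟨c, hc, hbc⟩ := h1'.exists_nd_pair hm hN hR hMe hMs hα hβ₁ hβ₂ hC
    (h2'.of_eqTp hm hα hMs hσ2)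
  have hca : EqTpOver L Ms (Sum.elim c a₁) (Sum.elim b₂ a₂) := hc.trans hσ2.symm
  have ha := hbc.symm hm hN hR hMe hMs hβ hα hC
  obtain ⟨𝒬, e, h𝒬, he, hec, hbc𝒬⟩ := hq.exists_canon_pair hm hR.1 hMe hMs hβ₁ hβ₂ hqb
    (by simpa only [Sum.elim_comp_inl] using hca.comp Sum.inl)
  have hJ : Small κ ((β₁ ⊕ Ms) ⊕ β₂) := (hβ₁.sum hm.1 hMs).sum hm.1 hβ₂
  obtain ⟨E, hE, hE0⟩ := hm.exists_morleySeq hJ 𝒬 hMs hbc𝒬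
  obtain ⟨x, hx⟩ := ND.exists_eqTp_morleySeq hm hN hR hMe hMs hJ hβ hα h𝒬 hbc𝒬
    (Sum.map Sum.inl id : β₁ ⊕ β₂ → (β₁ ⊕ Ms) ⊕ β₂) (a := a₁)
    (by rwa [Sum.elim_comp_map, Sum.elim_comp_inl, Function.comp_id]) hE
  rw [Sum.elim_comp_map, Sum.elim_comp_inl, Function.comp_id] at hx
  obtain ⟨𝒟, h𝒟, hω⟩ := exists_coh_power hm hJ hMe.nonempty hMs h𝒬.coh
  obtain ⟨W, hW, hW0⟩ := hm.exists_morleySeq ((Small.of_countable hm.1 ℕ).prod hm.1 hJ) 𝒟 hMs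
    ((hω Ms hMs subset_rfl E).2 hE)
  set f : α ⊕ (β₁ ⊕ β₂) → α ⊕ ((β₁ ⊕ Ms) ⊕ β₂) := Sum.map id (Sum.map Sum.inl id) with hf
  obtain ⟨y, hy⟩ := exists_forall_mem_power hm hα hJ hMs hω
    (ι := {U : Set (α ⊕ (β₁ ⊕ β₂) → 𝕄) // Ms.Definable L U ∧ Sum.elim a₁ (Sum.elim b₁ c) ∈ U})
    (S := fun U => {z | z ∘ f ∈ U.1}) (fun U => U.2.1.preimage_comp f)
    (fun l hl => exists_root_of_morleyList hm hJ hMs h𝒬.coh hE (x := x)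
      (fun U => U.2.1.preimage_comp f) (fun i U => by
        rw [Set.mem_ofPred_eq, hf, Sum.elim_comp_map, Function.comp_id]
        exact (eqTpOver_iff.1 (hx i) _ U.2.1).2 U.2.2) hl) hW
  have hy' : ∀ k i, EqTpOver L Ms
      (Sum.elim y ((fun p => W k (i, p)) ∘ Sum.map Sum.inl id))
      (Sum.elim a₁ (Sum.elim b₁ c)) := fun k i => EqTpOver.of_forall_mem fun U hU hmem => by
    have := hy k i ⟨U, hU, hmem⟩
    rwa [Set.mem_ofPred_eq, hf, Sum.elim_comp_map, Function.comp_id] at this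
  set g : β₁ ⊕ β₂ → ℕ × ((β₁ ⊕ Ms) ⊕ β₂) :=
    Sum.elim (fun i => (0, Sum.inl (Sum.inl i))) (fun i => (1, Sum.inr i)) with hg
  have hWg : EqTpOver L Ms (W 0 ∘ g) (Sum.elim b₁ b₂) := by
    have h3 : W 0 ∘ g = Sum.elim b₁ (E 1 ∘ Sum.inr) := by
      rw [hW0]
      funext i
      rcases i with i | i
      · change E 0 (Sum.inl (Sum.inl i)) = _
        rw [hE0]
        rfl
      · rfl
    have h4 : Rlz L 𝒬 (E 1) (Ms ∪ Set.range b₁) := by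
      refine (hE 1).mono (Set.union_subset_union_right _ ?_)
      rintro _ ⟨i, rfl⟩
      exact Set.mem_iUnion₂.2 ⟨0, Nat.zero_lt_one, Sum.inl (Sum.inl i), by rw [hE0]; rfl⟩
    have h5 := ((h4.eqTp he).comp Sum.inr).elim.comp Sum.swap
    rw [Sum.elim_swap, Sum.elim_swap, hec] at h5
    rwa [h3]
  obtain ⟨a, ha', hat⟩ := exists_nd_of_morleySeq hm hα hβ hMe hMs (b := Sum.elim b₁ b₂)
    (ι := Bool) (J := fun j => bif j then α ⊕ β₁ else α ⊕ β₂)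
    (fun j => match j with
      | true => Sum.map id Sum.inl
      | false => Sum.map id Sum.inr)
    (fun j => match j with
      | true => Sum.elim a₁ b₁
      | false => Sum.elim a₂ b₂)
    h𝒟 hW hWg (x := y)
    (fun k j => by
      cases j
      · have h3 := (hy' k 1).comp (Sum.map id Sum.inr)
        have h4 := hca.comp Sum.swap
        rw [Sum.elim_swap, Sum.elim_swap] at h4
        rw [Sum.elim_comp_map, Sum.elim_comp_map, Sum.elim_comp_inr] at h3
        change EqTpOver L Ms (Sum.elim y (W k ∘ g) ∘ Sum.map id Sum.inr) _
        rw [Sum.elim_comp_map]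
        exact h3.trans h4
      · have h3 := (hy' k 0).comp (Sum.map id Sum.inl)
        rw [Sum.elim_comp_map, Sum.elim_comp_map, Sum.elim_comp_inl] at h3
        change EqTpOver L Ms (Sum.elim y (W k ∘ g) ∘ Sum.map id Sum.inl) _
        rw [Sum.elim_comp_map]
        exact h3)
  exact ⟨a, ha', by simpa [Sum.elim_comp_map] using hat true,
    by simpa [Sum.elim_comp_map] using hat false⟩

end Amalgamation

end NSOP2Paper

namespace NSOP2Paper

/-- **Proposition 5.7 (weak independence theorem).** Let `T` be `NSOP₂`, and
suppose `a₁ ⫝^{K*}_M b₁`, `a₂ ⫝^{K*}_M b₂`, `a₁ ≡_M a₂`, and `tp(b₂/Mb₁)`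
extends to a strong canonical coheir `q` of `tp(b₂/M)`.  Then there is a
realization `a` of `tp(a₁/Mb₁) ∪ tp(a₂/Mb₂)` with `a ⫝^{K*}_M b₁b₂`. -/
theorem weak_independence_theorem (L : FirstOrder.Language.{u, u}) (𝕄 : Type u)
    [L.Structure 𝕄] (κ : Cardinal.{u}) (hmonster : IsMonster L 𝕄 κ)
    (hNSOP2 : ¬ HasSOP2 L 𝕄)
    (R : IndRel L 𝕄) (hCK : IsCK R κ)
    (Ms : Set 𝕄) (hMs : IsElemSubmodel L Ms) (hMssmall : Cardinal.mk Ms < κ)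
    (α β₁ β₂ : Type u) (hα : Cardinal.mk α < κ)
    (hβ₁ : Cardinal.mk β₁ < κ) (hβ₂ : Cardinal.mk β₂ < κ)
    (a₁ a₂ : α → 𝕄) (b₁ : β₁ → 𝕄) (b₂ : β₂ → 𝕄)
    (h1 : ConantIndep L Ms a₁ b₁) (h2 : ConantIndep L Ms a₂ b₂)
    (h12 : EqTpOver L Ms a₁ a₂)
    (q : GlobalType L 𝕄 β₂) (hqstrong : IsStrongCanonical R κ Ms q)
    (hqb₂ : ExtendsTpOver q Ms b₂)
    (hqb₂b₁ : ExtendsTpOver q (Ms ∪ Set.range b₁) b₂) :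
    ∃ a : α → 𝕄, EqTpOver L (Ms ∪ Set.range b₁) a a₁ ∧
      EqTpOver L (Ms ∪ Set.range b₂) a a₂ ∧
      ConantIndep L Ms a (Sum.elim b₁ b₂) := by
  have hs := Small.of_lt hMssmall
  rcases isEmpty_or_nonempty 𝕄 with h𝕄 | h𝕄
  · refine ⟨a₁, EqTpOver.refl _, ?_, fun n φ d hd hφ => h1 n φ d (fun i => isEmptyElim (d i)) hφ⟩
    rw [Subsingleton.elim a₂ a₁]
    exact EqTpOver.refl _
  have hsα := Small.of_lt hα
  have hs₁ := Small.of_lt hβ₁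
  have hs₂ := Small.of_lt hβ₂
  obtain ⟨a, ha, ha₁, ha₂⟩ := ND.amalgamation hmonster hNSOP2 hCK.1 hMs hs hsα hs₁ hs₂
    (ND.of_conantIndep hmonster hs₁ hMs hs h1) (ND.of_conantIndep hmonster hs₂ hMs hs h2) h12 hqstrong
    hqb₂b₁.realizesType
  exact ⟨a, ha₁.of_elim, ha₂.of_elim, ha.conantIndep hmonster (hs₁.sum hmonster.1 hs₂) hMs hs⟩

end NSOP2Paper
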